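/- Let G be an n-vertex graph whose vertex set is partitioned into q equal parts V₁,...,V_q of size n/q, each inducing a connected subgraph H_i. Then st(G) = O(log q · (rt(G) + max_i st(H_i))). -/

import Mathlib

open Finset

variable {V : Type*}

/-- A stage of a sorting network on a graph `G`: a finite set of vertex-disjoint
edges of `G`, each either directed (compare-exchange) or undirected (swap). -/
structure Stage {V : Type*} (G : SimpleGraph V) where
  pairs : Finset (V × V)
  adj : ∀ p ∈ pairs, G.Adj p.1 p.2
  directed : V × V → Bool
  disj : ∀ p ∈ pairs, ∀ q ∈ pairs, p ≠ q →
    p.1 ≠ q.1 ∧ p.1 ≠ q.2 ∧ p.2 ≠ q.1 ∧ p.2 ≠ q.2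

open scoped Classical in
/-- Apply a stage to a configuration of keys `f : V → ℕ`.  For a directed pair
`(u,v)` the smaller key goes to `u` and the larger to `v`; an undirected pair
unconditionally swaps its keys. -/
noncomputable def Stage.apply {G : SimpleGraph V} (s : Stage G) (f : V → ℕ) (v : V) : ℕ :=
  if h1 : ∃ p, p ∈ s.pairs ∧ p.1 = v then
    (if s.directed h1.choose then min (f h1.choose.1) (f h1.choose.2) else f h1.choose.2)
  else if h2 : ∃ p, p ∈ s.pairs ∧ p.2 = v then
    (if s.directed h2.choose then max (f h2.choose.1) (f h2.choose.2) else f h2.choose.1)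
  else f v

noncomputable def runNetwork {G : SimpleGraph V} (L : List (Stage G)) (f : V → ℕ) : V → ℕ :=
  L.foldl (fun g s => s.apply g) f

/-- `L` is a sorting network on `(G, π)`: for every injective assignment of keys,
after running all stages, the key at a vertex of smaller `π`-rank is smaller. -/
def IsSortingNetwork {n : ℕ} (G : SimpleGraph V) (π : V ≃ Fin n) (L : List (Stage G)) : Prop :=
  ∀ f : V → ℕ, Function.Injective f →
    ∀ u w : V, π u < π w → runNetwork L f u < runNetwork L f w

/-- Minimal depth of a sorting network on `(G, π)`. -/
noncomputable def stP {n : ℕ} (G : SimpleGraph V) (π : V ≃ Fin n) : ℕ :=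
  sInf {t | ∃ L : List (Stage G), L.length = t ∧ IsSortingNetwork G π L}

/-- The sorting number of `G` : the minimum over sorted orders `π` of the
minimal depth of a sorting network on `(G, π)`. -/
noncomputable def st [Fintype V] (G : SimpleGraph V) : ℕ :=
  sInf {t | ∃ π : V ≃ Fin (Fintype.card V), ∃ L : List (Stage G),
    L.length = t ∧ IsSortingNetwork G π L}

/-- A matching step: an involution of the vertices moving pebbles only along edges. -/
def IsMatchingStep (G : SimpleGraph V) (σ : Equiv.Perm V) : Prop :=
  (∀ v, σ (σ v) = v) ∧ ∀ v, σ v ≠ v → G.Adj v (σ v)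

/-- Position of a pebble starting at `v` after applying the matching steps in `L`. -/
def finalPos (L : List (Equiv.Perm V)) (v : V) : V :=
  L.foldl (fun p σ => σ p) v

/-- `t` matching steps of `G` suffice to route every pebble from `v` to `σ v`. -/
def RoutesIn (G : SimpleGraph V) (σ : Equiv.Perm V) (t : ℕ) : Prop :=
  ∃ L : List (Equiv.Perm V), L.length = t ∧ (∀ τ ∈ L, IsMatchingStep G τ) ∧
    ∀ v, finalPos L v = σ v

/-- Routing time of the permutation `σ` on `G`. -/
noncomputable def rtP (G : SimpleGraph V) (σ : Equiv.Perm V) : ℕ :=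
  sInf {t | RoutesIn G σ t}

/-- The routing number of `G`. -/
noncomputable def rt [Fintype V] [DecidableEq V] (G : SimpleGraph V) : ℕ :=
  Finset.univ.sup fun σ : Equiv.Perm V => rtP G σ


/-! ### Part A: expanders from random permutations -/

theorem aks_perm_count_step (f : ℕ) (Z W : Finset (Fin f)) (a : Fin f) (ha : a ∉ Z) :
    #{σ : Equiv.Perm (Fin f) | ∀ z ∈ insert a Z, σ z ∈ W} * (f - #Z)
      = #{σ : Equiv.Perm (Fin f) | ∀ z ∈ Z, σ z ∈ W} * (#W - #Z) := by
  classical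
  have h1 : ∀ b ∈ Zᶜ, #{σ : Equiv.Perm (Fin f) | ∀ z ∈ insert a Z, σ z ∈ W}
      = #{σ : Equiv.Perm (Fin f) | (∀ z ∈ Z, σ z ∈ W) ∧ σ b ∈ W} := by
    intro b hb
    have hb' : b ∉ Z := by simpa using hb
    have key : ∀ (σ : Equiv.Perm (Fin f)) z, z ∈ Z → (σ * Equiv.swap a b) z = σ z := by
      intro σ z hz
      rw [Equiv.Perm.mul_apply, Equiv.swap_apply_of_ne_of_ne]
      · rintro rfl; exact ha hz
      · rintro rfl; exact hb' hz
    apply Finset.card_bij' (fun σ _ => σ * Equiv.swap a b) (fun σ _ => σ * Equiv.swap a b)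
    · intro σ hσ
      simp only [mem_filter, mem_univ, true_and, mem_insert, forall_eq_or_imp] at hσ ⊢
      refine ⟨fun z hz => ?_, ?_⟩
      · rw [key σ z hz]; exact hσ.2 z hz
      · simpa using hσ.1
    · intro σ hσ
      simp only [mem_filter, mem_univ, true_and, mem_insert, forall_eq_or_imp] at hσ ⊢
      refine ⟨?_, fun z hz => ?_⟩
      · simpa using hσ.2
      · rw [key σ z hz]; exact hσ.1 z hz
    · intro σ _; simp [mul_assoc]
    · intro σ _; simp [mul_assoc]
  have hc : #(Zᶜ) = f - #Z := by simp [Finset.card_compl]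
  have h2 : #{σ : Equiv.Perm (Fin f) | ∀ z ∈ insert a Z, σ z ∈ W} * (f - #Z)
      = ∑ b ∈ Zᶜ, #{σ : Equiv.Perm (Fin f) | (∀ z ∈ Z, σ z ∈ W) ∧ σ b ∈ W} := by
    rw [← Finset.sum_congr rfl h1, Finset.sum_const, hc, smul_eq_mul, mul_comm]
  rw [h2]
  have h3 : ∑ b ∈ Zᶜ, #{σ : Equiv.Perm (Fin f) | (∀ z ∈ Z, σ z ∈ W) ∧ σ b ∈ W}
      = ∑ σ ∈ ({σ : Equiv.Perm (Fin f) | ∀ z ∈ Z, σ z ∈ W} : Finset _), #{b ∈ Zᶜ | σ b ∈ W} := by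
    have := Finset.sum_card_bipartiteAbove_eq_sum_card_bipartiteBelow
      (s := Zᶜ) (t := ({σ : Equiv.Perm (Fin f) | ∀ z ∈ Z, σ z ∈ W} : Finset _))
      (r := fun b σ => σ b ∈ W)
    simp only [Finset.bipartiteAbove, Finset.bipartiteBelow, Finset.filter_filter] at this
    exact this
  rw [h3, Finset.sum_congr rfl (g := fun _ => #W - #Z), Finset.sum_const, smul_eq_mul]
  intro σ hσ
  simp only [mem_filter, mem_univ, true_and] at hσ
  have e1 : ({b ∈ Zᶜ | σ b ∈ W} : Finset (Fin f)) = (W.map σ.symm.toEmbedding) \ Z := by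
    ext b
    simp only [mem_filter, mem_compl, mem_sdiff, mem_map_equiv, Equiv.symm_symm]
    tauto
  rw [e1, Finset.card_sdiff_of_subset, Finset.card_map]
  intro z hz
  simp only [mem_map_equiv, Equiv.symm_symm]
  exact hσ z hz

theorem aks_perm_count (f : ℕ) (Z W : Finset (Fin f)) :
    #{σ : Equiv.Perm (Fin f) | ∀ z ∈ Z, σ z ∈ W} * f ^ #Z ≤ #W ^ #Z * f.factorial := by
  classical
  induction Z using Finset.induction_on with
  | empty => simp [Fintype.card_perm]
  | insert a Z ha ih =>
    have hs := aks_perm_count_step f Z W a ha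
    rw [Finset.card_insert_of_notMem ha]
    set N' := #{σ : Equiv.Perm (Fin f) | ∀ z ∈ insert a Z, σ z ∈ W}
    set N := #{σ : Equiv.Perm (Fin f) | ∀ z ∈ Z, σ z ∈ W}
    have hlt : #Z < f := by
      have := Finset.card_lt_univ_of_notMem ha
      simpa using this
    have hw : #W ≤ f := by simpa using Finset.card_le_univ W
    have h1 : N' * f ≤ N * #W := by
      have hp : 0 < f - #Z := by omega
      apply Nat.le_of_mul_le_mul_right _ hp
      calc N' * f * (f - #Z) = (N' * (f - #Z)) * f := by ring
        _ = N * ((#W - #Z) * f) := by rw [hs]; ring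
        _ ≤ N * (#W * (f - #Z)) := by
            apply Nat.mul_le_mul_left
            rcases le_total #W #Z with h | h
            · simp [Nat.sub_eq_zero_of_le h]
            · zify [h, hlt.le]; nlinarith
        _ = N * #W * (f - #Z) := by ring
    calc N' * f ^ (#Z + 1) = (N' * f) * f ^ #Z := by ring
      _ ≤ (N * #W) * f ^ #Z := Nat.mul_le_mul_right _ h1
      _ = #W * (N * f ^ #Z) := by ring
      _ ≤ #W * (#W ^ #Z * f.factorial) := Nat.mul_le_mul_left _ ih
      _ = #W ^ (#Z + 1) * f.factorial := by ring

theorem aks_term_bound (β D' : ℕ) (ρ : ℝ) (hρ0 : 0 < ρ) (hρ1 : ρ < 1)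
    (hD : ρ ^ D' * (Real.exp 1 ^ (2 * β) * 4 ^ (1 + β)) ≤ 1)
    (f z w : ℕ) (hf : 0 < f) (hzβ : w ≤ β * z) (hw : (w : ℝ) ≤ ρ * f) :
    (f.choose z : ℝ) * f.choose w * ((w / f : ℝ) ^ z) ^ (1 + β + D') ≤ (1/4 : ℝ) ^ z * (1/4) ^ w := by
  have hf' : (0:ℝ) < f := by exact_mod_cast hf
  set x : ℝ := w / f with hx
  have hx0 : 0 ≤ x := by positivity
  have hxρ : x ≤ ρ := by rw [hx, div_le_iff₀ hf']; exact hw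
  have hx1 : x ≤ 1 := hxρ.trans hρ1.le
  have hch : ∀ k : ℕ, (f.choose k : ℝ) * x ^ k ≤ Real.exp 1 ^ w := by
    intro k
    have h1 : (f.choose k : ℝ) ≤ f ^ k / k.factorial := Nat.choose_le_pow_div k f
    have h2 : (w : ℝ) ^ k / k.factorial ≤ Real.exp w :=
      Real.pow_div_factorial_le_exp _ (by positivity) k
    calc (f.choose k : ℝ) * x ^ k ≤ f ^ k / k.factorial * x ^ k := by gcongr
      _ = (w : ℝ) ^ k / k.factorial := by rw [hx, div_pow]; field_simp
      _ ≤ Real.exp w := h2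
      _ = Real.exp 1 ^ w := by rw [← Real.exp_nat_mul]; simp
  have he : (1:ℝ) ≤ Real.exp 1 := Real.one_le_exp (by norm_num)
  obtain ⟨r, hr⟩ := Nat.exists_eq_add_of_le hzβ
  have hpow : (x ^ z) ^ (1 + β + D') = x ^ z * x ^ w * (x ^ r * (x ^ D') ^ z) := by
    rw [← pow_mul, ← pow_mul, ← pow_add, ← pow_add, ← pow_add]
    congr 1
    have : z * (1 + β + D') = z + β * z + D' * z := by ring
    rw [this, hr]; ring
  have h3 : x ^ r * (x ^ D') ^ z ≤ (ρ ^ D') ^ z := by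
    have : x ^ r ≤ 1 := pow_le_one₀ hx0 hx1
    have h4 : (x ^ D') ^ z ≤ (ρ ^ D') ^ z := by gcongr
    calc x ^ r * (x ^ D') ^ z ≤ 1 * (x ^ D') ^ z := by gcongr
      _ ≤ _ := by rw [one_mul]; exact h4
  have h5 : (f.choose z : ℝ) * f.choose w * (x ^ z) ^ (1 + β + D')
      ≤ Real.exp 1 ^ w * Real.exp 1 ^ w * (ρ ^ D') ^ z := by
    rw [hpow]
    calc (f.choose z : ℝ) * f.choose w * (x ^ z * x ^ w * (x ^ r * (x ^ D') ^ z))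
        = (f.choose z * x ^ z) * (f.choose w * x ^ w) * (x ^ r * (x ^ D') ^ z) := by ring
      _ ≤ _ := by
        have := hch z
        have := hch w
        gcongr
  have h6 : Real.exp 1 ^ w * Real.exp 1 ^ w * 4 ^ (z + w) ≤ (Real.exp 1 ^ (2 * β) * 4 ^ (1 + β)) ^ z := by
    rw [← pow_add, mul_pow, ← pow_mul, ← pow_mul]
    have e1 : w + w ≤ 2 * β * z := by nlinarith
    have e2 : z + w ≤ (1 + β) * z := by nlinarith
    gcongr
    · norm_num
  have h7 : (ρ ^ D') ^ z * (Real.exp 1 ^ (2 * β) * 4 ^ (1 + β)) ^ z ≤ 1 := by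
    rw [← mul_pow]
    exact pow_le_one₀ (by positivity) hD
  have h8 : (1/4 : ℝ) ^ z * (1/4) ^ w = 1 / 4 ^ (z + w) := by
    rw [← pow_add]; simp
  rw [h8, le_div_iff₀ (by positivity)]
  calc _ ≤ Real.exp 1 ^ w * Real.exp 1 ^ w * (ρ ^ D') ^ z * 4 ^ (z + w) := by gcongr
    _ = (ρ ^ D') ^ z * (Real.exp 1 ^ w * Real.exp 1 ^ w * 4 ^ (z + w)) := by ring
    _ ≤ (ρ ^ D') ^ z * (Real.exp 1 ^ (2 * β) * 4 ^ (1 + β)) ^ z := by gcongr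
    _ ≤ 1 := h7

theorem aks_geom (m : ℕ) : ∑ z ∈ Finset.range m, (1/4 : ℝ) ^ z ≤ 4/3 := by
  have := geom_sum_eq (show (1/4:ℝ) ≠ 1 by norm_num) m
  rw [this]
  have : (0:ℝ) ≤ (1/4) ^ m := by positivity
  rw [div_le_iff_of_neg (by norm_num)]
  nlinarith

theorem aks_geom' (m : ℕ) : ∑ z ∈ (Finset.range m).filter (fun z => 0 < z), (1/4 : ℝ) ^ z ≤ 1/3 := by
  rcases m with _ | m
  · simp
  · have h := aks_geom (m+1)
    have h2 : ∑ z ∈ Finset.range (m+1), (1/4 : ℝ) ^ z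
        = ∑ z ∈ (Finset.range (m+1)).filter (fun z => 0 < z), (1/4 : ℝ) ^ z + 1 := by
      rw [Finset.sum_range_succ', Finset.sum_filter, Finset.sum_range_succ']
      simp
    linarith

theorem aks_expander (β : ℕ) (ρ : ℝ) (hρ0 : 0 < ρ) (hρ1 : ρ < 1) :
    ∃ D : ℕ, ∀ f : ℕ, ∃ σ : Fin D → Equiv.Perm (Fin f), ∀ Z W : Finset (Fin f),
      (∀ i, ∀ z ∈ Z, σ i z ∈ W) → β * #Z ≤ #W ∨ ρ * f < #W := by
  classical
  obtain ⟨D', hD'⟩ : ∃ D' : ℕ, ρ ^ D' * (Real.exp 1 ^ (2 * β) * 4 ^ (1 + β)) ≤ 1 := by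
    have hpos : (0:ℝ) < Real.exp 1 ^ (2 * β) * 4 ^ (1 + β) := by positivity
    obtain ⟨D', h⟩ := exists_pow_lt_of_lt_one (inv_pos.mpr hpos) hρ1
    refine ⟨D', ?_⟩
    have := mul_le_mul_of_nonneg_right h.le hpos.le
    rwa [inv_mul_cancel₀ hpos.ne'] at this
  refine ⟨1 + β + D', fun f => ?_⟩
  set D := 1 + β + D' with hDdef
  rcases Nat.eq_zero_or_pos f with rfl | hf
  · refine ⟨fun _ => 1, fun Z W _ => Or.inl ?_⟩
    simp [Finset.eq_empty_of_isEmpty Z]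
  by_contra hcon
  push Not at hcon
  -- bad pairs
  set Bad : Finset (Finset (Fin f) × Finset (Fin f)) :=
    {q | 0 < #q.1 ∧ #q.2 ≤ β * #q.1 ∧ (#q.2 : ℝ) ≤ ρ * f ∧ 0 < #q.2} with hBad
  set B : Finset (Fin f) × Finset (Fin f) → Finset (Fin D → Equiv.Perm (Fin f)) :=
    fun q => Fintype.piFinset (fun _ => ({σ : Equiv.Perm (Fin f) | ∀ z ∈ q.1, σ z ∈ q.2} : Finset _)) with hB
  have hcover : (Finset.univ : Finset (Fin D → Equiv.Perm (Fin f))) ⊆ Bad.biUnion B := by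
    intro σ _
    obtain ⟨Z, W, h1, h2, h3⟩ := hcon σ
    rw [Finset.mem_biUnion]
    refine ⟨(Z, W), ?_, ?_⟩
    · rw [hBad, mem_filter]
      have hZ : 0 < #Z := by
        by_contra h0
        have : #Z = 0 := by omega
        simp [this] at h2
      refine ⟨mem_univ _, hZ, h2.le, h3, ?_⟩
      obtain ⟨z, hz⟩ := Finset.card_pos.mp hZ
      have hD0 : 0 < D := by omega
      exact Finset.card_pos.mpr ⟨_, h1 ⟨0, hD0⟩ z hz⟩
    · rw [hB, Fintype.mem_piFinset]
      intro i
      simp only [mem_filter, mem_univ, true_and]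
      exact h1 i
  have hcard : (f.factorial : ℝ) ^ D ≤ ∑ q ∈ Bad, (#(B q) : ℝ) := by
    have h := (Finset.card_le_card hcover).trans Finset.card_biUnion_le
    have h' : #(Finset.univ : Finset (Fin D → Equiv.Perm (Fin f))) = f.factorial ^ D := by
      simp [Fintype.card_perm]
    rw [h'] at h
    exact_mod_cast h
  have hf' : (0:ℝ) < f := by exact_mod_cast hf
  have hfac : (0:ℝ) < f.factorial := by exact_mod_cast f.factorial_pos
  have hBq : ∀ q : Finset (Fin f) × Finset (Fin f),
      (#(B q) : ℝ) ≤ (f.factorial : ℝ) ^ D * ((#q.2 / f : ℝ) ^ #q.1) ^ D := by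
    intro q
    have h1 : #(B q) = #{σ : Equiv.Perm (Fin f) | ∀ z ∈ q.1, σ z ∈ q.2} ^ D := by
      rw [hB]; simp [Fintype.card_piFinset]
    rw [h1, ← mul_pow]
    push_cast
    have h2 := aks_perm_count f q.1 q.2
    have h3 : (#{σ : Equiv.Perm (Fin f) | ∀ z ∈ q.1, σ z ∈ q.2} : ℝ) * f ^ #q.1 ≤ (#q.2 : ℝ) ^ #q.1 * f.factorial := by
      exact_mod_cast h2
    have h4 : (#{σ : Equiv.Perm (Fin f) | ∀ z ∈ q.1, σ z ∈ q.2} : ℝ) ≤ f.factorial * (#q.2 / f : ℝ) ^ #q.1 := by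
      rw [div_pow, mul_div_assoc', le_div_iff₀ (by positivity)]
      linarith
    gcongr
  have hsum : ∑ q ∈ Bad, (#(B q) : ℝ) ≤ (f.factorial : ℝ) ^ D * ∑ q ∈ Bad, ((#q.2 / f : ℝ) ^ #q.1) ^ D := by
    rw [Finset.mul_sum]
    exact Finset.sum_le_sum (fun q _ => hBq q)
  have hlt : ∑ q ∈ Bad, ((#q.2 / f : ℝ) ^ #q.1) ^ D < 1 := by
    set g : ℕ → ℕ → ℝ := fun z w => if 0 < z ∧ w ≤ β * z ∧ (w : ℝ) ≤ ρ * f ∧ 0 < w then ((w / f : ℝ) ^ z) ^ D else 0 with hg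
    have e1 : ∑ q ∈ Bad, ((#q.2 / f : ℝ) ^ #q.1) ^ D = ∑ Z : Finset (Fin f), ∑ W : Finset (Fin f), g #Z #W := by
      rw [hBad, Finset.sum_filter, ← Finset.univ_product_univ, Finset.sum_product]
    have e2 : ∀ u : ℕ → ℝ, ∑ Z : Finset (Fin f), u #Z = ∑ m ∈ Finset.range (f+1), (f.choose m : ℝ) * u m := by
      intro u
      have := Finset.sum_powerset_apply_card u (x := (Finset.univ : Finset (Fin f)))
      simpa using this
    rw [e1, e2 (fun z => ∑ W : Finset (Fin f), g z #W)]
    have e3 : ∀ z, ∑ W : Finset (Fin f), g z #W = ∑ m ∈ Finset.range (f+1), (f.choose m : ℝ) * g z m := fun z => e2 (g z)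
    simp only [e3]
    have hb : ∀ z w, (f.choose z : ℝ) * (f.choose w * g z w) ≤ (if 0 < z then (1/4:ℝ)^z else 0) * (if 0 < w then (1/4:ℝ)^w else 0) := by
      intro z w
      by_cases hc : 0 < z ∧ w ≤ β * z ∧ (w : ℝ) ≤ ρ * f ∧ 0 < w
      · simp only [hg, if_pos hc, if_pos hc.1, if_pos hc.2.2.2]
        rw [← mul_assoc]
        exact aks_term_bound β D' ρ hρ0 hρ1 hD' f z w hf hc.2.1 hc.2.2.1
      · simp only [hg, if_neg hc, mul_zero]
        positivity
    calc _ = ∑ z ∈ Finset.range (f+1), ∑ w ∈ Finset.range (f+1), (f.choose z : ℝ) * (f.choose w * g z w) := by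
            simp only [Finset.mul_sum]
      _ ≤ ∑ z ∈ Finset.range (f+1), ∑ w ∈ Finset.range (f+1), (if 0 < z then (1/4:ℝ)^z else 0) * (if 0 < w then (1/4:ℝ)^w else 0) :=
            Finset.sum_le_sum (fun z _ => Finset.sum_le_sum (fun w _ => hb z w))
      _ = (∑ z ∈ Finset.range (f+1), (if 0 < z then (1/4:ℝ)^z else 0)) * (∑ w ∈ Finset.range (f+1), (if 0 < w then (1/4:ℝ)^w else 0)) := by
            rw [Finset.sum_mul_sum]
      _ ≤ (1/3) * (1/3) := by
            have := aks_geom' (f+1)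
            rw [Finset.sum_filter] at this
            gcongr
      _ < 1 := by norm_num
  have : (0:ℝ) < (f.factorial : ℝ) ^ D := by positivity
  nlinarith


/-! ### Part B: comparator layers, networks, halvers and separators -/

structure AksLayer (W : Type*) where
  p : W → W
  inv : ∀ w, p (p w) = w
  lo : W → Bool
  opp : ∀ w, p w ≠ w → lo (p w) = !lo w

namespace AksLayer

variable {W : Type*} {α γ : Type*} [LinearOrder α] [LinearOrder γ]

def apply (l : AksLayer W) (x : W → α) (w : W) : α :=
  if l.lo w then min (x w) (x (l.p w)) else max (x w) (x (l.p w))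

def flip (l : AksLayer W) : AksLayer W where
  p := l.p
  inv := l.inv
  lo := fun w => !l.lo w
  opp := by intro w hw; rw [l.opp w hw]

def idle (W : Type*) : AksLayer W where
  p := fun w => w
  inv := fun _ => rfl
  lo := fun _ => true
  opp := fun _ h => absurd rfl h

@[simp] theorem flip_flip (l : AksLayer W) : l.flip.flip = l := by
  cases l; simp [flip]

theorem apply_fix (l : AksLayer W) (x : W → α) (w : W) (h : l.p w = w) : l.apply x w = x w := by
  simp [apply, h]

@[simp] theorem idle_apply (x : W → α) : (idle W).apply x = x := by
  funext w; simp [apply, idle]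

theorem apply_mono (l : AksLayer W) {g : α → γ} (hg : Monotone g) (x : W → α) :
    g ∘ l.apply x = l.apply (g ∘ x) := by
  funext w
  simp only [apply, Function.comp]
  split_ifs
  · exact hg.map_min
  · exact hg.map_max

theorem apply_anti (l : AksLayer W) {g : α → γ} (hg : Antitone g) (x : W → α) :
    g ∘ l.apply x = l.flip.apply (g ∘ x) := by
  funext w
  have hp : l.flip.p w = l.p w := rfl
  rcases h : l.lo w with _ | _
  · have h' : l.flip.lo w = true := by simp [flip, h]
    simp only [apply, Function.comp, h, h', hp]
    simpa using hg.map_max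
  · have h' : l.flip.lo w = false := by simp [flip, h]
    simp only [apply, Function.comp, h, h', hp]
    simpa using hg.map_min

theorem apply_perm (l : AksLayer W) (x : W → α) :
    ∃ π : Equiv.Perm W, l.apply x = x ∘ π ∧ ∀ w, π w = w ∨ π w = l.p w := by
  classical
  set q : W → W := fun w => if l.apply x w = x w then w else l.p w with hq
  have hqp : ∀ w, q w = w ∨ q w = l.p w := by
    intro w; simp only [hq]; split_ifs <;> simp
  have hval : ∀ w, l.apply x w = x (q w) := by
    intro w
    simp only [hq]
    split_ifs with h
    · exact h
    · simp only [apply] at h ⊢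
      split_ifs with h1
      · rw [if_pos h1] at h
        rcases min_choice (x w) (x (l.p w)) with h2 | h2
        · exact absurd h2 h
        · exact h2
      · rw [if_neg h1] at h
        rcases max_choice (x w) (x (l.p w)) with h2 | h2
        · exact absurd h2 h
        · exact h2
  have hinv : ∀ w, q (q w) = w := by
    intro w
    by_cases hw : l.p w = w
    · have : q w = w := by rcases hqp w with h | h <;> simp [h, hw]
      rw [this, this]
    · have hiff : (l.apply x w = x w) ↔ (l.apply x (l.p w) = x (l.p w)) := by
        simp only [apply, l.inv, l.opp w hw]
        cases l.lo w
        · simp only [Bool.false_eq_true, if_false, Bool.not_false, if_true]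
          rw [max_eq_left_iff, min_eq_left_iff]
        · simp only [Bool.false_eq_true, if_false, Bool.not_true, if_true]
          rw [max_eq_left_iff, min_eq_left_iff]
      by_cases h1 : l.apply x w = x w
      · have : q w = w := by simp only [hq, if_pos h1]
        rw [this, this]
      · have e1 : q w = l.p w := by simp only [hq, if_neg h1]
        have e2 : q (l.p w) = l.p (l.p w) := by
          simp only [hq, if_neg (fun h => h1 (hiff.mpr h))]
        rw [e1, e2, l.inv]
  exact ⟨⟨q, q, hinv, hinv⟩, funext hval, hqp⟩

def run (L : ℕ → AksLayer W) : ℕ → (W → α) → (W → α)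
  | 0, x => x
  | t + 1, x => (L t).apply (run L t x)

@[simp] theorem run_zero (L : ℕ → AksLayer W) (x : W → α) : run L 0 x = x := rfl
theorem run_succ (L : ℕ → AksLayer W) (t : ℕ) (x : W → α) :
    run L (t+1) x = (L t).apply (run L t x) := rfl

theorem run_mono (L : ℕ → AksLayer W) {g : α → γ} (hg : Monotone g) (t : ℕ) (x : W → α) :
    g ∘ run L t x = run L t (g ∘ x) := by
  induction t with
  | zero => rfl
  | succ t ih => rw [run_succ, apply_mono _ hg, ih, run_succ]

theorem run_anti (L : ℕ → AksLayer W) {g : α → γ} (hg : Antitone g) (t : ℕ) (x : W → α) :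
    g ∘ run L t x = run (fun i => (L i).flip) t (g ∘ x) := by
  induction t with
  | zero => rfl
  | succ t ih => rw [run_succ, apply_anti _ hg, ih, run_succ]

theorem run_perm (L : ℕ → AksLayer W) (t : ℕ) (x : W → α) :
    ∃ π : Equiv.Perm W, run L t x = x ∘ π ∧
      ∀ S : Set W, (∀ i w, w ∈ S → (L i).p w ∈ S) → ∀ w ∈ S, π w ∈ S := by
  induction t with
  | zero => exact ⟨1, rfl, fun S _ w hw => hw⟩
  | succ t ih =>
    obtain ⟨π, h1, h2⟩ := ih
    obtain ⟨τ, h3, h4⟩ := apply_perm (L t) (run L t x)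
    refine ⟨π * τ, ?_, fun S hS w hw => ?_⟩
    · rw [run_succ, h3, h1]; rfl
    · apply h2 S hS
      rcases h4 w with h | h
      · rw [h]; exact hw
      · rw [h]; exact hS t w hw

theorem run_card [DecidableEq W] (L : ℕ → AksLayer W) (t : ℕ) (x : W → α) (S : Finset W)
    (hS : ∀ i w, w ∈ S → (L i).p w ∈ S) (P : α → Prop) [DecidablePred P] :
    #{w ∈ S | P (run L t x w)} = #{w ∈ S | P (x w)} := by
  obtain ⟨π, h1, h2⟩ := run_perm L t x
  have h3 := h2 (S : Set W) (fun i w hw => by simpa using hS i w (by simpa using hw))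
  have hSmap : S.map π.toEmbedding = S := by
    apply Finset.eq_of_subset_of_card_le
    · intro w hw
      rw [Finset.mem_map] at hw
      obtain ⟨v, hv, rfl⟩ := hw
      simpa using h3 v (by simpa using hv)
    · simp
  rw [← Finset.card_map π.toEmbedding]
  congr 1
  ext w
  simp only [mem_map, mem_filter, h1]
  constructor
  · rintro ⟨v, ⟨hv, hp⟩, rfl⟩
    exact ⟨by simpa using h3 v (by simpa using hv), by simpa using hp⟩
  · rintro ⟨hw, hp⟩
    rw [← hSmap, Finset.mem_map] at hw
    obtain ⟨v, hv, rfl⟩ := hw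
    exact ⟨v, ⟨hv, by simpa using hp⟩, rfl⟩

/-- only wires in `S` are touched -/
def LocalOn (L : ℕ → AksLayer W) (S : Finset W) : Prop := ∀ t w, w ∉ S → (L t).p w = w

theorem LocalOn.mono {L : ℕ → AksLayer W} {S T : Finset W} (h : LocalOn L S) (hST : S ⊆ T) :
    LocalOn L T := fun t w hw => h t w (fun h' => hw (hST h'))

theorem LocalOn.closed {L : ℕ → AksLayer W} {S T : Finset W} (h : LocalOn L S) (hST : S ⊆ T)
    (t : ℕ) (w : W) (hw : w ∈ T) : (L t).p w ∈ T := by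
  by_contra hc
  have h1 := h t _ (fun h' => hc (hST h'))
  rw [(L t).inv] at h1
  rw [← h1] at hc
  exact hc hw

theorem LocalOn.closed_disj {L : ℕ → AksLayer W} {S T : Finset W} (h : LocalOn L S)
    (hST : Disjoint S T) (t : ℕ) (w : W) (hw : w ∈ T) : (L t).p w ∈ T := by
  rw [h t w (fun h' => (Finset.disjoint_left.mp hST h') hw)]; exact hw

theorem LocalOn.run_eq {L : ℕ → AksLayer W} {S : Finset W} (h : LocalOn L S) (t : ℕ) (x : W → α)
    (w : W) (hw : w ∉ S) : run L t x w = x w := by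
  induction t with
  | zero => rfl
  | succ t ih => rw [run_succ, apply_fix _ _ _ (h t w hw), ih]

def cat (L : ℕ → AksLayer W) (n : ℕ) (M : ℕ → AksLayer W) : ℕ → AksLayer W :=
  fun t => if t < n then L t else M (t - n)

theorem run_congr (L M : ℕ → AksLayer W) (t : ℕ) (h : ∀ i < t, L i = M i) (x : W → α) :
    run L t x = run M t x := by
  induction t with
  | zero => rfl
  | succ t ih => rw [run_succ, run_succ, ih (fun i hi => h i (by omega)), h t (by omega)]

theorem run_cat (L M : ℕ → AksLayer W) (n m : ℕ) (x : W → α) :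
    run (cat L n M) (n + m) x = run M m (run L n x) := by
  induction m with
  | zero =>
    apply run_congr
    intro i hi
    simp only [cat]
    rw [if_pos (by omega)]
  | succ m ih =>
    rw [← add_assoc, run_succ, ih, run_succ]
    congr 1
    simp only [cat]
    rw [if_neg (by omega)]
    congr 1
    omega

theorem LocalOn.cat {L M : ℕ → AksLayer W} {S : Finset W} (hL : LocalOn L S) (hM : LocalOn M S)
    (n : ℕ) : LocalOn (cat L n M) S := by
  intro t w hw
  simp only [AksLayer.cat]
  split_ifs
  · exact hL t w hw
  · exact hM _ w hw

theorem LocalOn.flip {L : ℕ → AksLayer W} {S : Finset W} (hL : LocalOn L S) :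
    LocalOn (fun i => (L i).flip) S := fun t w hw => hL t w hw

theorem localOn_idle (S : Finset W) : LocalOn (fun _ => idle W) S := fun _ _ _ => rfl

@[simp] theorem run_idle (t : ℕ) (x : W → α) : run (fun _ => idle W) t x = x := by
  induction t with
  | zero => rfl
  | succ t ih => rw [run_succ, ih, idle_apply]

/-- parallel composition -/
def par {I : Type*} (ι : W → I) (L : I → ℕ → AksLayer W)
    (hL : ∀ i t w, ι w = i → ι ((L i t).p w) = i) : ℕ → AksLayer W := fun t =>
  { p := fun w => (L (ι w) t).p w
    inv := by
      intro w
      have h := hL (ι w) t w rfl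
      simp only [h]
      exact (L (ι w) t).inv w
    lo := fun w => (L (ι w) t).lo w
    opp := by
      intro w hw
      have h := hL (ι w) t w rfl
      simp only [h]
      exact (L (ι w) t).opp w hw }

theorem run_par {I : Type*} (ι : W → I) (L : I → ℕ → AksLayer W)
    (hL : ∀ i t w, ι w = i → ι ((L i t).p w) = i) (t : ℕ) (x : W → α) (w : W) :
    run (par ι L hL) t x w = run (L (ι w)) t x w := by
  induction t generalizing w with
  | zero => rfl
  | succ t ih =>
    have h := hL (ι w) t w rfl
    have e1 := ih w
    have e2 := ih ((L (ι w) t).p w)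
    rw [h] at e2
    have hp : (par ι L hL t).p w = (L (ι w) t).p w := rfl
    have hl : (par ι L hL t).lo w = (L (ι w) t).lo w := rfl
    simp only [run_succ, apply]
    rw [hp, e1, e2]
    simp only [hl]

/-- all comparators of `L` join `R` (receiving the min) with `F` (receiving the max) -/
def Directed (L : ℕ → AksLayer W) (R F : Finset W) : Prop :=
  ∀ t w, (L t).p w ≠ w → (w ∈ R ∧ (L t).p w ∈ F ∧ (L t).lo w = true) ∨
    (w ∈ F ∧ (L t).p w ∈ R ∧ (L t).lo w = false)

theorem Directed.local [DecidableEq W] {L : ℕ → AksLayer W} {R F : Finset W} (h : Directed L R F) :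
    LocalOn L (F ∪ R) := by
  intro t w hw
  by_contra hc
  rcases h t w hc with h1 | h1
  · exact hw (mem_union_right _ h1.1)
  · exact hw (mem_union_left _ h1.1)

theorem Directed.apply_le {L : ℕ → AksLayer W} {R F : Finset W} (h : Directed L R F)
    (hd : Disjoint F R) (t : ℕ) (x : W → α) (w : W) (hw : w ∈ R) : (L t).apply x w ≤ x w := by
  by_cases hc : (L t).p w = w
  · rw [apply_fix _ _ _ hc]
  · rcases h t w hc with h1 | h1
    · simp [apply, h1.2.2]
    · exact absurd hw (Finset.disjoint_left.mp hd h1.1)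

theorem Directed.le_apply {L : ℕ → AksLayer W} {R F : Finset W} (h : Directed L R F)
    (hd : Disjoint F R) (t : ℕ) (x : W → α) (w : W) (hw : w ∈ F) : x w ≤ (L t).apply x w := by
  by_cases hc : (L t).p w = w
  · rw [apply_fix _ _ _ hc]
  · rcases h t w hc with h1 | h1
    · exact absurd h1.1 (Finset.disjoint_left.mp hd hw)
    · simp [apply, h1.2.2]

theorem Directed.run_anti {L : ℕ → AksLayer W} {R F : Finset W} (h : Directed L R F)
    (hd : Disjoint F R) {s t : ℕ} (hst : s ≤ t) (x : W → α) (w : W) (hw : w ∈ R) :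
    run L t x w ≤ run L s x w := by
  induction t, hst using Nat.le_induction with
  | base => exact le_rfl
  | succ t _ ih => exact (h.apply_le hd t _ w hw).trans ih

theorem Directed.run_mono {L : ℕ → AksLayer W} {R F : Finset W} (h : Directed L R F)
    (hd : Disjoint F R) {s t : ℕ} (hst : s ≤ t) (x : W → α) (w : W) (hw : w ∈ F) :
    run L s x w ≤ run L t x w := by
  induction t, hst using Nat.le_induction with
  | base => exact le_rfl
  | succ t _ ih => exact ih.trans (h.le_apply hd t _ w hw)

open scoped Classical in
/-- layer joining `w ∈ R` (min side) with `φ w ∉ R` (max side) -/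
noncomputable def ofMap (R : Finset W) (φ : W → W) (hφ : Set.InjOn φ R) (hR : ∀ w ∈ R, φ w ∉ R) :
    AksLayer W where
  p := fun w => if w ∈ R then φ w else if h : ∃ v ∈ R, φ v = w then h.choose else w
  inv := by
    intro w
    by_cases hw : w ∈ R
    · have hex : ∃ v ∈ R, φ v = φ w := ⟨w, hw, rfl⟩
      simp only [if_pos hw, if_neg (hR w hw), dif_pos hex]
      exact hφ hex.choose_spec.1 hw hex.choose_spec.2
    · by_cases hex : ∃ v ∈ R, φ v = w
      · simp only [if_neg hw, dif_pos hex, if_pos hex.choose_spec.1]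
        exact hex.choose_spec.2
      · simp only [if_neg hw, dif_neg hex]
  lo := fun w => decide (w ∈ R)
  opp := by
    intro w
    by_cases hw : w ∈ R
    · simp only [if_pos hw]
      intro _
      simp [hw, hR w hw]
    · by_cases hex : ∃ v ∈ R, φ v = w
      · simp only [if_neg hw, dif_pos hex]
        intro _
        simp [hw, hex.choose_spec.1]
      · simp only [if_neg hw, dif_neg hex]
        intro h; exact absurd rfl h

theorem ofMap_p (R : Finset W) (φ : W → W) (hφ : Set.InjOn φ R) (hR : ∀ w ∈ R, φ w ∉ R)
    (w : W) (hw : w ∈ R) : (ofMap R φ hφ hR).p w = φ w := by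
  simp [ofMap, hw]

theorem ofMap_lo (R : Finset W) (φ : W → W) (hφ : Set.InjOn φ R) (hR : ∀ w ∈ R, φ w ∉ R)
    (w : W) (hw : w ∈ R) : (ofMap R φ hφ hR).lo w = true := by
  simp [ofMap, hw]

theorem ofMap_lo' (R : Finset W) (φ : W → W) (hφ : Set.InjOn φ R) (hR : ∀ w ∈ R, φ w ∉ R)
    (w : W) (hw : w ∉ R) : (ofMap R φ hφ hR).lo w = false := by
  simp [ofMap, hw]

theorem ofMap_ne (R : Finset W) (φ : W → W) (hφ : Set.InjOn φ R) (hR : ∀ w ∈ R, φ w ∉ R)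
    (w : W) (hw : (ofMap R φ hφ hR).p w ≠ w) : w ∈ R ∨ ∃ v ∈ R, φ v = w := by
  classical
  by_contra hc
  push Not at hc
  apply hw
  have : ¬ ∃ v ∈ R, φ v = w := by push Not; exact hc.2
  simp only [ofMap, if_neg hc.1, dif_neg this]

end AksLayer

open AksLayer

theorem aks_gadget (β : ℕ) (ρ : ℝ) (hρ0 : 0 < ρ) (hρ1 : ρ < 1) :
    ∃ D : ℕ, ∀ (c : ℕ) (W : Type) [DecidableEq W] (F R : Finset W),
      Disjoint F R → #R ≤ c * #F → ∃ L : ℕ → AksLayer W, Directed L R F ∧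
        ∀ x : W → Bool,
          β * #{w ∈ R | run L (c * D) x w = true} ≤ c * #{w ∈ F | run L (c * D) x w = true} ∨
          ρ * #F < #{w ∈ F | run L (c * D) x w = true} := by
  obtain ⟨D, hD⟩ := aks_expander β ρ hρ0 hρ1
  refine ⟨D, fun c W _ F R hd hcard => ?_⟩
  obtain ⟨σ, hσ⟩ := hD #F
  rcases Nat.eq_zero_or_pos D with hD0 | hDpos
  · refine ⟨fun _ => idle W, fun t w h => absurd rfl h, fun x => ?_⟩
    subst hD0
    have h1 := hσ univ ∅ (fun i => i.elim0)
    rcases h1 with h1 | h1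
    · left
      simp only [card_univ, Fintype.card_fin, card_empty, Nat.le_zero, mul_eq_zero] at h1
      rcases h1 with h1 | h1
      · simp [h1]
      · rw [h1] at hcard
        have : R = ∅ := by simpa using hcard
        simp [this]
    · simp at h1
      have : (0:ℝ) ≤ ρ * #F := by positivity
      linarith
  -- enumeration of F and addresses of R
  have a : Fin #F ≃ F := F.equivFin.symm
  have e : Nonempty (R ↪ Fin c × Fin #F) := by
    apply Function.Embedding.nonempty_of_card_le
    simpa using hcard
  obtain ⟨e⟩ := e
  rcases R.eq_empty_or_nonempty with hR0 | hRne
  · refine ⟨fun _ => idle W, fun t w h => absurd rfl h, fun x => Or.inl ?_⟩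
    simp [hR0]
  obtain ⟨w₀, hw₀⟩ := hRne
  set addr : W → Fin c × Fin #F := fun w => if h : w ∈ R then e ⟨w, h⟩ else e ⟨w₀, hw₀⟩ with haddr
  have haddr_inj : Set.InjOn addr R := by
    intro u hu v hv huv
    have hu' : u ∈ R := hu
    have hv' : v ∈ R := hv
    simp only [haddr, dif_pos hu', dif_pos hv'] at huv
    simpa using e.injective huv
  set Rt : ℕ → Finset W := fun t => R.filter (fun w => ((addr w).1 : ℕ) = t / D) with hRt
  set φ : ℕ → W → W := fun t w => (a (σ ⟨t % D, Nat.mod_lt _ hDpos⟩ (addr w).2) : W) with hφ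
  have hφF : ∀ t w, φ t w ∈ F := fun t w => (a _).2
  have hinj : ∀ t, Set.InjOn (φ t) (Rt t) := by
    intro t u hu v hv huv
    have hu' : u ∈ R ∧ ((addr u).1 : ℕ) = t / D := by simpa [hRt] using hu
    have hv' : v ∈ R ∧ ((addr v).1 : ℕ) = t / D := by simpa [hRt] using hv
    have h2 : (addr u).2 = (addr v).2 := by
      have := a.injective (Subtype.ext huv)
      exact (σ _).injective this
    exact haddr_inj hu'.1 hv'.1 (Prod.ext (Fin.ext (hu'.2.trans hv'.2.symm)) h2)
  have hnot : ∀ t, ∀ w ∈ Rt t, φ t w ∉ Rt t := by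
    intro t w _ h
    exact Finset.disjoint_left.mp hd (hφF t w) (Finset.mem_filter.mp h).1
  set L : ℕ → AksLayer W := fun t => ofMap (Rt t) (φ t) (hinj t) (hnot t) with hL
  have hdir : Directed L R F := by
    intro t w hw
    rcases ofMap_ne _ _ _ _ w hw with h | ⟨v, hv, rfl⟩
    · left
      refine ⟨(Finset.mem_filter.mp h).1, ?_, ofMap_lo _ _ _ _ _ h⟩
      simp only [hL]
      rw [ofMap_p _ _ _ _ _ h]; exact hφF t w
    · right
      refine ⟨hφF t v, ?_, ofMap_lo' _ _ _ _ _ (hnot t v hv)⟩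
      have h1 : (L t).p v = φ t v := ofMap_p _ _ _ _ _ hv
      rw [← h1, (L t).inv]
      exact (Finset.mem_filter.mp hv).1
  refine ⟨L, hdir, fun x => ?_⟩
  set y := run L (c * D) x with hy
  set Y : Finset (Fin #F) := {j | y (a j) = true} with hYdef
  have hY : #{w ∈ F | y w = true} = #Y := by
    symm
    apply Finset.card_bij (fun j _ => (a j : W))
    · intro j hj
      simp only [hYdef, mem_filter, mem_univ, true_and] at hj
      simp [hj]
    · intro i _ j _ hij
      exact a.injective (Subtype.ext hij)
    · intro w hw
      obtain ⟨h1, h2⟩ := Finset.mem_filter.mp hw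
      refine ⟨a.symm ⟨w, h1⟩, ?_, by simp⟩
      simp [hYdef, h2]
  set Z : Fin c → Finset (Fin #F) := fun ch =>
    ({w ∈ R | y w = true ∧ (addr w).1 = ch}).image (fun w => (addr w).2) with hZ
  have hZcard : ∀ ch, #(Z ch) = #{w ∈ R | y w = true ∧ (addr w).1 = ch} := by
    intro ch
    apply Finset.card_image_of_injOn
    intro u hu v hv huv
    have hu' : u ∈ R ∧ y u = true ∧ (addr u).1 = ch := by simpa using hu
    have hv' : v ∈ R ∧ y v = true ∧ (addr v).1 = ch := by simpa using hv
    exact haddr_inj hu'.1 hv'.1 (Prod.ext (hu'.2.2.trans hv'.2.2.symm) huv)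
  have hkey : ∀ ch, ∀ i, ∀ z ∈ Z ch, σ i z ∈ Y := by
    intro ch i z hz
    simp only [hZ, mem_image, mem_filter] at hz
    obtain ⟨w, ⟨hwR, hyw, hch⟩, rfl⟩ := hz
    set t := ch * D + i with ht
    have htlt : t < c * D := by
      have h1 := ch.2
      have h2 := i.2
      calc t < ch * D + D := by omega
        _ = (ch + 1) * D := by ring
        _ ≤ c * D := Nat.mul_le_mul_right _ h1
    have hdiv : t / D = ch := by
      rw [ht, mul_comm, Nat.mul_add_div hDpos, Nat.div_eq_of_lt i.2]; simp
    have hmod : t % D = i := by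
      rw [ht, mul_comm, Nat.mul_add_mod, Nat.mod_eq_of_lt i.2]
    have hwRt : w ∈ Rt t := by
      simp only [hRt, mem_filter]
      exact ⟨hwR, by rw [hch, hdiv]⟩
    have hp : (L t).p w = φ t w := ofMap_p _ _ _ _ _ hwRt
    have hφe : φ t w = a (σ i (addr w).2) := by
      simp only [hφ]
      congr 3
      simp [hmod]
    have hlow : (L t).lo w = true := ofMap_lo _ _ _ _ _ hwRt
    have h1 : run L (t+1) x w = true := by
      have h := hdir.run_anti hd (show t + 1 ≤ c * D by omega) x w hwR
      rw [← hy, hyw] at h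
      exact top_le_iff.mp h
    have h2 : run L t x w = true ∧ run L t x (φ t w) = true := by
      rw [run_succ] at h1
      simp only [AksLayer.apply, hlow, if_true, hp] at h1
      simpa using h1
    have h3 := hdir.run_mono hd (show t ≤ c * D by omega) x (φ t w) (hφF t w)
    rw [h2.2, ← hy] at h3
    have h4 : y (φ t w) = true := top_le_iff.mp h3
    simp only [hYdef, mem_filter, mem_univ, true_and]
    rw [← hφe]; exact h4
  rw [hY]
  by_cases hbig : ρ * #F < #Y
  · exact Or.inr hbig
  · left
    have hsum : #{w ∈ R | y w = true} = ∑ ch : Fin c, #(Z ch) := by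
      simp only [hZcard]
      rw [Finset.card_eq_sum_card_fiberwise (f := fun w => (addr w).1) (t := univ) (by intro w _; simp)]
      apply Finset.sum_congr rfl
      intro ch _
      rw [Finset.filter_filter]
    rw [hsum, Finset.mul_sum]
    calc ∑ ch : Fin c, β * #(Z ch) ≤ ∑ ch : Fin c, #Y := by
          apply Finset.sum_le_sum
          intro ch _
          rcases hσ (Z ch) Y (hkey ch) with h | h
          · exact h
          · exact absurd h hbig
      _ = c * #Y := by simp


/-! ### Part C: separators -/

namespace AksLayer

theorem flip_cat {W : Type*} (L M : ℕ → AksLayer W) (n : ℕ) :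
    (fun i => (cat L n M i).flip) = cat (fun i => (L i).flip) n (fun i => (M i).flip) := by
  funext i
  simp only [cat]
  split_ifs <;> rfl

end AksLayer

open AksLayer

theorem sep_arith1 (β : ℕ) (ε : ℝ) (h a b K : ℕ) (hε0 : 0 < ε) (hβ : 1 ≤ ε * β)
    (h1 : β * a ≤ b ∨ (1 - ε) * h < b) (h2 : a + b ≤ K) (h3 : b ≤ h) :
    (a : ℝ) ≤ max 0 ((K : ℝ) - h) + ε * h ∧ (K ≤ h → (a : ℝ) ≤ ε * K) := by
  have h2' : (a : ℝ) + b ≤ K := by exact_mod_cast h2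
  have h3' : (b : ℝ) ≤ h := by exact_mod_cast h3
  have ha : (0:ℝ) ≤ a := Nat.cast_nonneg _
  rcases h1 with h1 | h1
  · have h1' : (β : ℝ) * a ≤ b := by exact_mod_cast h1
    have h4 : (a : ℝ) ≤ ε * b := by
      calc (a : ℝ) = 1 * a := by ring
        _ ≤ ε * β * a := by gcongr
        _ = ε * (β * a) := by ring
        _ ≤ ε * b := by gcongr
    constructor
    · have := le_max_left 0 ((K : ℝ) - h)
      nlinarith
    · intro _; nlinarith
  · constructor
    · have := le_max_right 0 ((K : ℝ) - h)
      nlinarith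
    · intro hk
      have hk' : (K : ℝ) ≤ h := by exact_mod_cast hk
      by_cases he : ε ≤ 1
      · nlinarith
      · nlinarith

theorem sep_arith2 (β c : ℕ) (ε : ℝ) (f r s K : ℕ) (hε0 : 0 < ε) (hε1 : ε < 1) (hβ : c ≤ ε * β)
    (hβ1 : 1 ≤ ε * β)
    (h1 : β * r ≤ c * s ∨ (1 - ε) * f < s) (h2 : r + s ≤ K) (hK : K ≤ f) :
    (r : ℝ) ≤ ε * K := by
  have h2' : (r : ℝ) + s ≤ K := by exact_mod_cast h2
  have hK' : (K : ℝ) ≤ f := by exact_mod_cast hK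
  have hr : (0:ℝ) ≤ r := Nat.cast_nonneg _
  have hs : (0:ℝ) ≤ s := Nat.cast_nonneg _
  rcases h1 with h1 | h1
  · have h1' : (β : ℝ) * r ≤ c * s := by exact_mod_cast h1
    have hβ0 : (0:ℝ) < β := by
      by_contra hc
      have : (β:ℝ) ≤ 0 := not_lt.mp hc
      nlinarith
    have : (β : ℝ) * r ≤ β * (ε * K) := by
      calc (β : ℝ) * r ≤ c * s := h1'
        _ ≤ (ε * β) * s := by gcongr
        _ ≤ (ε * β) * K := by gcongr; linarith
        _ = _ := by ring
    exact le_of_mul_le_mul_left this hβ0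
  · nlinarith

theorem sep_count {W : Type*} [DecidableEq W] (S A B : Finset W) (hA : A ⊆ S) (hB : B ⊆ S)
    (hd : Disjoint A B) (P : W → Prop) [DecidablePred P] :
    #{w ∈ A | P w} + #{w ∈ B | P w} ≤ #{w ∈ S | P w} := by
  rw [← card_union_of_disjoint (Finset.disjoint_filter_filter hd)]
  apply card_le_card
  rw [← filter_union]
  exact filter_subset_filter _ (union_subset hA hB)

/-- one side of the separator, on Boolean inputs.  `A` is the half in which trues are unwanted. -/
theorem sep_side {W : Type} [DecidableEq W] (β c : ℕ) (ε : ℝ) (hε0 : 0 < ε) (hε1 : ε < 1)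
    (hβ1 : 1 ≤ ε * β) (hβ : c ≤ ε * β) (S A B F : Finset W) (h f : ℕ) (hA : A ⊆ S) (hB : B ⊆ S)
    (hd : Disjoint A B) (hBc : #B = h) (hF : F ⊆ B) (hFc : #F = f) (hfh : f ≤ h)
    (x y z : W → Bool) (K : ℕ)
    (hK : #{w ∈ S | x w = true} = K)
    (hxS : #{w ∈ S | y w = true} = K)
    (hg : β * #{w ∈ A | y w = true} ≤ #{w ∈ B | y w = true} ∨
      (1 - ε) * #B < #{w ∈ B | y w = true})
    (hzA : #{w ∈ A | z w = true} ≤ #{w ∈ A | y w = true})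
    (hzS : #{w ∈ S | z w = true} = K)
    (hg2 : f = 0 ∨ (β * #{w ∈ B \ F | z w = true} ≤ c * #{w ∈ F | z w = true} ∨
      (1 - ε) * #F < #{w ∈ F | z w = true}))
    (Ca : Finset W) (hCa : Ca ⊆ A) :
    (#{w ∈ Ca | z w = true} : ℝ) ≤ max 0 ((K : ℝ) - h) + ε * h ∧
    (K ≤ f → (#{w ∈ Ca ∪ (B \ F) | z w = true} : ℝ) ≤ 2 * ε * K) := by
  have e1 := sep_arith1 β ε h #{w ∈ A | y w = true} #{w ∈ B | y w = true} K hε0 hβ1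
    (by rwa [hBc] at hg) (by rw [← hxS]; exact sep_count S A B hA hB hd _)
    (by rw [← hBc]; exact card_filter_le _ _)
  have e2 : #{w ∈ Ca | z w = true} ≤ #{w ∈ A | z w = true} :=
    card_le_card (filter_subset_filter _ hCa)
  have e3 : (#{w ∈ Ca | z w = true} : ℝ) ≤ #{w ∈ A | y w = true} := by
    exact_mod_cast e2.trans hzA
  refine ⟨e3.trans e1.1, fun hKf => ?_⟩
  have e4 := e3.trans (e1.2 (hKf.trans hfh))
  have e5 : (#{w ∈ B \ F | z w = true} : ℝ) ≤ ε * K := by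
    rcases hg2 with h0 | hg2
    · have hK0 : K = 0 := by omega
      have : #{w ∈ B \ F | z w = true} ≤ #{w ∈ S | z w = true} :=
        card_le_card (filter_subset_filter _ (sdiff_subset.trans hB))
      rw [hzS, hK0] at this
      have : #{w ∈ B \ F | z w = true} = 0 := by omega
      rw [this, hK0]; simp
    · apply sep_arith2 β c ε f _ #{w ∈ F | z w = true} K hε0 hε1 hβ hβ1 _ _ hKf
      · rwa [hFc] at hg2
      · rw [← hzS]
        exact sep_count S (B \ F) F (sdiff_subset.trans hB) (hF.trans hB) sdiff_disjoint _
  have e6 : (#{w ∈ Ca ∪ (B \ F) | z w = true} : ℝ) ≤ #{w ∈ Ca | z w = true} + #{w ∈ B \ F | z w = true} := by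
    rw [filter_union]
    exact_mod_cast card_union_le _ _
  linarith

theorem aks_sep (ε : ℝ) (hε0 : 0 < ε) (hε1 : ε < 1) (c : ℕ) :
    ∃ D : ℕ, ∀ (W : Type) [DecidableEq W] (S : Finset W) (h f : ℕ), 2 * h ≤ #S → f ≤ h →
      (f = 0 ∨ h ≤ c * f) → ∃ L : ℕ → AksLayer W, LocalOn L S ∧ ∃ Cl Cr : Finset W,
        Cl ⊆ S ∧ Cr ⊆ S ∧ Disjoint Cl Cr ∧ #Cl = h - f ∧ #Cr = h - f ∧
        ∀ x : W → ℕ, ∀ (P : ℕ → Prop) [DecidablePred P] (K : ℕ), #{w ∈ S | P (x w)} = K →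
          ((∀ a b, a ≤ b → P b → P a) →
            (#{w ∈ Cr | P (run L D x w)} : ℝ) ≤ max 0 ((K : ℝ) - h) + ε * h ∧
            (K ≤ f → (#{w ∈ Cl ∪ Cr | P (run L D x w)} : ℝ) ≤ 2 * ε * K)) ∧
          ((∀ a b, a ≤ b → P a → P b) →
            (#{w ∈ Cl | P (run L D x w)} : ℝ) ≤ max 0 ((K : ℝ) - h) + ε * h ∧
            (K ≤ f → (#{w ∈ Cl ∪ Cr | P (run L D x w)} : ℝ) ≤ 2 * ε * K)) := by
  obtain ⟨β, hβ⟩ := exists_nat_gt ((c + 1) / ε)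
  have hβ' : (c : ℝ) + 1 ≤ ε * β := by
    rw [div_lt_iff₀ hε0] at hβ
    linarith
  have hc0 : (0:ℝ) ≤ c := Nat.cast_nonneg _
  obtain ⟨D, hD⟩ := aks_gadget β (1 - ε) (by linarith) (by linarith)
  refine ⟨1 * D + (1 * D + (c * D + c * D)), fun W _ S h f hS hfh hf => ?_⟩
  obtain ⟨A, hA, hAc⟩ := Finset.exists_subset_card_eq (s := S) (n := h) (by omega)
  obtain ⟨B, hB, hBc⟩ := Finset.exists_subset_card_eq (s := S \ A) (n := h)
    (by rw [card_sdiff_of_subset hA]; omega)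
  obtain ⟨FL, hFL, hFLc⟩ := Finset.exists_subset_card_eq (s := A) (n := f) (by omega)
  obtain ⟨FR, hFR, hFRc⟩ := Finset.exists_subset_card_eq (s := B) (n := f) (by omega)
  have hBS : B ⊆ S := hB.trans sdiff_subset
  have hAB : Disjoint A B := (disjoint_sdiff).mono_right hB
  obtain ⟨L1, hL1, hL1g⟩ := hD 1 W A B hAB (by omega)
  obtain ⟨L2, hL2, hL2g⟩ := hD 1 W B A hAB.symm (by omega)
  have key : ∀ X FX : Finset W, FX ⊆ X → #X = h → #FX = f → ∃ M : ℕ → AksLayer W, LocalOn M X ∧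
      (∀ x : W → Bool, f = 0 ∨ (β * #{w ∈ X \ FX | run M (c * D) x w = true} ≤
        c * #{w ∈ FX | run M (c * D) x w = true} ∨
        (1 - ε) * #FX < #{w ∈ FX | run M (c * D) x w = true})) := by
    intro X FX hFX hX hFXc
    rcases hf with hf | hf
    · exact ⟨fun _ => idle W, localOn_idle _, fun x => Or.inl hf⟩
    · obtain ⟨M, hM, hMg⟩ := hD c W FX (X \ FX) disjoint_sdiff
        (by rw [card_sdiff_of_subset hFX]; rw [hX, hFXc]; omega)
      refine ⟨M, hM.local.mono (union_subset hFX sdiff_subset), fun x => Or.inr (hMg x)⟩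
  obtain ⟨L3, hL3, hL3g⟩ := key A FL hFL hAc hFLc
  obtain ⟨L4, hL4, hL4g⟩ := key B FR hFR hBc hFRc
  set N1 : ℕ → AksLayer W := fun i => (L1 i).flip with hN1
  set N3 : ℕ → AksLayer W := fun i => (L3 i).flip with hN3
  have l1 : LocalOn L1 S := hL1.local.mono (union_subset hA hBS)
  have l2 : LocalOn L2 S := hL2.local.mono (union_subset hBS hA)
  have l3 : LocalOn L3 S := hL3.mono hA
  have l4 : LocalOn L4 S := hL4.mono hBS
  set L := cat N1 (1 * D) (cat L2 (1 * D) (cat N3 (c * D) L4)) with hLdef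
  have hL : LocalOn L S := l1.flip.cat (l2.cat (l3.flip.cat l4 _) _) _
  have hBool : ∀ x : W → Bool, ∀ K, #{w ∈ S | x w = true} = K →
      ((#{w ∈ A \ FL | run L (1 * D + (1 * D + (c * D + c * D))) x w = true} : ℝ) ≤
          max 0 ((K : ℝ) - h) + ε * h ∧
        (K ≤ f → (#{w ∈ A \ FL ∪ B \ FR |
          run L (1 * D + (1 * D + (c * D + c * D))) x w = true} : ℝ) ≤ 2 * ε * K)) := by
    intro x K hK
    set x1 := run N1 (1 * D) x with hx1
    set x2 := run L2 (1 * D) x1 with hx2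
    set x3 := run N3 (c * D) x2 with hx3
    set x4 := run L4 (c * D) x3 with hx4
    have hrun : run L (1 * D + (1 * D + (c * D + c * D))) x = x4 := by
      rw [hLdef, run_cat, run_cat, run_cat]
    rw [hrun]
    have c1 : #{w ∈ S | x1 w = true} = K := by
      rw [hx1, run_card N1 _ x S (fun i w hw => l1.flip.closed subset_rfl i w hw) (fun b => b = true)]
      exact hK
    have c2 : #{w ∈ S | x2 w = true} = K := by
      rw [hx2, run_card L2 _ x1 S (fun i w hw => l2.closed subset_rfl i w hw) (fun b => b = true)]
      exact c1
    have c3 : #{w ∈ S | x3 w = true} = K := by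
      rw [hx3, run_card N3 _ x2 S (fun i w hw => l3.flip.closed subset_rfl i w hw) (fun b => b = true)]
      exact c2
    have c4 : #{w ∈ S | x4 w = true} = K := by
      rw [hx4, run_card L4 _ x3 S (fun i w hw => l4.closed subset_rfl i w hw) (fun b => b = true)]
      exact c3
    have d3 : #{w ∈ A | x3 w = true} = #{w ∈ A | x2 w = true} :=
      run_card N3 _ x2 A (fun i w hw => hL3.flip.closed subset_rfl i w hw) (fun b => b = true)
    have d4 : #{w ∈ A | x4 w = true} = #{w ∈ A | x3 w = true} :=
      run_card L4 _ x3 A (fun i w hw => hL4.closed_disj hAB.symm i w hw) (fun b => b = true)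
    exact sep_side β c ε hε0 hε1 (by linarith) (by linarith) S A B FR h f hA hBS hAB hBc hFR hFRc hfh
      x x2 x4 K hK c2 ((hL2g x1).imp_left (fun h => h.trans (one_mul _).le)) (by omega) c4 (hL4g x3) _ sdiff_subset
  have hBoolF : ∀ x : W → Bool, ∀ K, #{w ∈ S | x w = true} = K →
      ((#{w ∈ B \ FR | run (fun i => (L i).flip) (1 * D + (1 * D + (c * D + c * D))) x w = true} : ℝ) ≤
          max 0 ((K : ℝ) - h) + ε * h ∧
        (K ≤ f → (#{w ∈ B \ FR ∪ A \ FL |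
          run (fun i => (L i).flip) (1 * D + (1 * D + (c * D + c * D))) x w = true} : ℝ) ≤ 2 * ε * K)) := by
    intro x K hK
    set N2 : ℕ → AksLayer W := fun i => (L2 i).flip with hN2
    set N4 : ℕ → AksLayer W := fun i => (L4 i).flip with hN4
    set x1 := run L1 (1 * D) x with hx1
    set x2 := run N2 (1 * D) x1 with hx2
    set x3 := run L3 (c * D) x2 with hx3
    set x4 := run N4 (c * D) x3 with hx4
    have hrun : run (fun i => (L i).flip) (1 * D + (1 * D + (c * D + c * D))) x = x4 := by
      rw [hLdef, flip_cat, flip_cat, flip_cat, run_cat, run_cat, run_cat]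
      simp only [hN1, hN3, AksLayer.flip_flip]
      rfl
    rw [hrun]
    have c1 : #{w ∈ S | x1 w = true} = K := by
      rw [hx1, run_card L1 _ x S (fun i w hw => l1.closed subset_rfl i w hw) (fun b => b = true)]
      exact hK
    have c2 : #{w ∈ S | x2 w = true} = K := by
      rw [hx2, run_card N2 _ x1 S (fun i w hw => l2.flip.closed subset_rfl i w hw) (fun b => b = true)]
      exact c1
    have c3 : #{w ∈ S | x3 w = true} = K := by
      rw [hx3, run_card L3 _ x2 S (fun i w hw => l3.closed subset_rfl i w hw) (fun b => b = true)]
      exact c2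
    have c4 : #{w ∈ S | x4 w = true} = K := by
      rw [hx4, run_card N4 _ x3 S (fun i w hw => l4.flip.closed subset_rfl i w hw) (fun b => b = true)]
      exact c3
    have hN2d : Directed N2 B A := by
      intro t w hw
      rcases hL2 t w hw with h1 | h1
      · right
        exact ⟨h1.1, h1.2.1, by simp [hN2, AksLayer.flip, h1.2.2]⟩
      · left
        exact ⟨h1.1, h1.2.1, by simp [hN2, AksLayer.flip, h1.2.2]⟩
    have m2 : #{w ∈ B | x2 w = true} ≤ #{w ∈ B | x1 w = true} := by
      apply card_le_card
      intro w hw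
      simp only [mem_filter] at hw ⊢
      have := hN2d.run_anti hAB (Nat.zero_le (1 * D)) x1 w hw.1
      rw [← hx2, hw.2] at this
      exact ⟨hw.1, top_le_iff.mp this⟩
    have d3 : #{w ∈ B | x3 w = true} = #{w ∈ B | x2 w = true} :=
      run_card L3 _ x2 B (fun i w hw => hL3.closed_disj hAB i w hw) (fun b => b = true)
    have d4 : #{w ∈ B | x4 w = true} = #{w ∈ B | x3 w = true} :=
      run_card N4 _ x3 B (fun i w hw => hL4.flip.closed subset_rfl i w hw) (fun b => b = true)
    have e3 : ∀ X : Finset W, Disjoint B X → #{w ∈ X | x4 w = true} = #{w ∈ X | x3 w = true} := 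
      fun X hX => run_card N4 _ x3 X (fun i w hw => hL4.flip.closed_disj hX i w hw) (fun b => b = true)
    have e4 := e3 (A \ FL) (hAB.symm.mono_right sdiff_subset)
    have e5 := e3 FL (hAB.symm.mono_right hFL)
    exact sep_side β c ε hε0 hε1 (by linarith) (by linarith) S B A FL h f hBS hA hAB.symm hAc hFL hFLc hfh
      x x1 x4 K hK c1 ((hL1g x).imp_left (fun h => h.trans (one_mul _).le)) (by omega) c4 (by rw [e4, e5]; exact hL3g x2) _ sdiff_subset
  refine ⟨L, hL, A \ FL, B \ FR, sdiff_subset.trans hA, sdiff_subset.trans hBS,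
    hAB.mono sdiff_subset sdiff_subset, by rw [card_sdiff_of_subset hFL]; omega,
    by rw [card_sdiff_of_subset hFR]; omega, fun x P _ K hK => ⟨fun hP => ?_, fun hP => ?_⟩⟩
  · have hg : Antitone (fun a => decide (P a)) := by
      intro a b hab
      by_cases hb : P b
      · simp [hb, hP a b hab hb]
      · simp [hb]
    have e := hBoolF ((fun a => decide (P a)) ∘ x) K (by simpa using hK)
    rw [← AksLayer.run_anti L hg] at e
    rw [union_comm]
    simpa using e
  · have hg : Monotone (fun a => decide (P a)) := by
      intro a b hab
      by_cases hb : P a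
      · simp [hb, hP a b hab hb]
      · simp [hb]
    have e := hBool ((fun a => decide (P a)) ∘ x) K (by simpa using hK)
    rw [← AksLayer.run_mono L hg] at e
    simpa using e


/-! ### Part D: the AKS invariant -/

open AksLayer

structure AksInv (k : ℕ) {W : Type} [Fintype W] [DecidableEq W] (loc : W → ℕ × ℕ) (cnt : ℕ → ℕ)
    (r : ℕ) (B : ℝ) (Y : Set (W → ℕ)) : Prop where
  inj : ∀ y ∈ Y, Function.Injective y
  lt : ∀ y ∈ Y, ∀ w, y w < 2 ^ k
  pos : 0 < B
  cardW : Fintype.card W = 2 ^ k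
  dle : ∀ w, (loc w).1 ≤ k
  alt : ∀ w, (loc w).2 < 2 ^ (loc w).1
  card : ∀ d a, a < 2 ^ d → #{w | loc w = (d, a)} = cnt d
  cap : ∀ d, (cnt d : ℝ) ≤ B * 8 ^ d
  odd : ∀ d, (d + r) % 2 = 1 → cnt d = 0
  str : ∀ y ∈ Y, ∀ d a j, (#{w | loc w = (d, a) ∧ y w / 2 ^ (k - d + j) ≠ a / 2 ^ j} : ℝ) ≤
    1 / 160 * (1 / 1024) ^ j * (B * 8 ^ d)

namespace AksInv

variable {k : ℕ} {W : Type} [Fintype W] [DecidableEq W] {loc : W → ℕ × ℕ} {cnt : ℕ → ℕ}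
    {r : ℕ} {B : ℝ} {Y : Set (W → ℕ)}

theorem subtree_sum (I : AksInv k loc cnt r B Y) (e c : ℕ) (Q : W → Prop) [DecidablePred Q] :
    #{w | (e ≤ (loc w).1 ∧ (loc w).2 / 2 ^ ((loc w).1 - e) = c) ∧ Q w} =
      ∑ d ∈ range (k + 1), if e ≤ d then
        ∑ a ∈ Ico (c * 2 ^ (d - e)) ((c + 1) * 2 ^ (d - e)), #{w | loc w = (d, a) ∧ Q w} else 0 := by
  rw [Finset.card_eq_sum_card_fiberwise (f := fun w => (loc w).1) (t := range (k + 1))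
    (by intro w _; have := I.dle w; simp; omega)]
  apply Finset.sum_congr rfl
  intro d _
  split_ifs with hed
  · rw [Finset.card_eq_sum_card_fiberwise (f := fun w => (loc w).2)
      (t := Ico (c * 2 ^ (d - e)) ((c + 1) * 2 ^ (d - e)))]
    · apply Finset.sum_congr rfl
      intro a ha
      congr 1
      ext w
      simp only [mem_filter, mem_univ, true_and]
      constructor
      · rintro ⟨⟨⟨⟨h1, h2⟩, h3⟩, h4⟩, h5⟩
        exact ⟨Prod.ext h4 h5, h3⟩
      · rintro ⟨h1, h2⟩
        rw [h1]
        refine ⟨⟨⟨⟨hed, ?_⟩, h2⟩, rfl⟩, rfl⟩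
        rw [mem_Ico] at ha
        simp only
        rw [Nat.div_eq_iff (by positivity)]
        have : (c + 1) * 2 ^ (d - e) = c * 2 ^ (d - e) + 2 ^ (d - e) := by ring
        have h0 : 0 < 2 ^ (d - e) := by positivity
        omega
    · intro w hw
      simp only [coe_filter, mem_filter, mem_univ, true_and, Set.mem_ofPred_eq] at hw
      obtain ⟨⟨⟨h1, h2⟩, h3⟩, h4⟩ := hw
      rw [h4, Nat.div_eq_iff (by positivity)] at h2
      have : (c + 1) * 2 ^ (d - e) = c * 2 ^ (d - e) + 2 ^ (d - e) := by ring
      have h0 : 0 < 2 ^ (d - e) := by positivity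
      simp only [coe_Ico, Set.mem_Ico]
      omega
  · rw [Finset.card_eq_zero, Finset.filter_eq_empty_iff]
    intro w hw h
    simp only [mem_filter, mem_univ, true_and] at hw
    omega

theorem node_lt {e c d a : ℕ} (hc : c < 2 ^ e) (hed : e ≤ d)
    (ha : a ∈ Ico (c * 2 ^ (d - e)) ((c + 1) * 2 ^ (d - e))) : a < 2 ^ d := by
  rw [mem_Ico] at ha
  calc a < (c + 1) * 2 ^ (d - e) := ha.2
    _ ≤ 2 ^ e * 2 ^ (d - e) := Nat.mul_le_mul_right _ hc
    _ = 2 ^ d := by rw [← pow_add]; congr 1; omega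

theorem node_card (c i : ℕ) : #(Ico (c * 2 ^ i) ((c + 1) * 2 ^ i)) = 2 ^ i := by
  rw [Nat.card_Ico]
  rw [add_mul, one_mul, Nat.add_sub_cancel_left]

theorem subtree_card (I : AksInv k loc cnt r B Y) (e c : ℕ) (hc : c < 2 ^ e) :
    #{w | e ≤ (loc w).1 ∧ (loc w).2 / 2 ^ ((loc w).1 - e) = c} =
      ∑ d ∈ range (k + 1), if e ≤ d then 2 ^ (d - e) * cnt d else 0 := by
  have h := I.subtree_sum e c (fun _ => True)
  simp only [and_true] at h
  rw [h]
  apply Finset.sum_congr rfl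
  intro d _
  split_ifs with hed
  · rw [Finset.sum_congr rfl (fun a ha => I.card d a (node_lt hc hed ha))]
    rw [Finset.sum_const, node_card, smul_eq_mul]
  · rfl

theorem total (I : AksInv k loc cnt r B Y) : ∑ d ∈ range (k + 1), 2 ^ d * cnt d = 2 ^ k := by
  have h := I.subtree_card 0 0 (by simp)
  simp only [Nat.zero_le, if_true, Nat.sub_zero] at h
  rw [← h, ← I.cardW, ← Finset.card_univ]
  congr 1
  ext w
  simpa using I.alt w

/-- mass split at level `e` -/
theorem split (I : AksInv k loc cnt r B Y) (e : ℕ) (he : e ≤ k) :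
    (∑ d ∈ range e, 2 ^ d * cnt d) +
      2 ^ e * (∑ d ∈ range (k + 1), if e ≤ d then 2 ^ (d - e) * cnt d else 0) = 2 ^ k := by
  rw [← I.total, Finset.mul_sum, ← Finset.sum_range_add_sum_Ico _ (show e ≤ k + 1 by omega),
    ← Finset.sum_range_add_sum_Ico (fun d => 2 ^ d * cnt d) (show e ≤ k + 1 by omega)]
  have h1 : ∑ d ∈ range e, 2 ^ e * (if e ≤ d then 2 ^ (d - e) * cnt d else 0) = 0 := by
    apply Finset.sum_eq_zero
    intro d hd
    rw [mem_range] at hd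
    rw [if_neg (by omega), mul_zero]
  have h2 : ∑ d ∈ Ico e (k + 1), 2 ^ e * (if e ≤ d then 2 ^ (d - e) * cnt d else 0) =
      ∑ d ∈ Ico e (k + 1), 2 ^ d * cnt d := by
    apply Finset.sum_congr rfl
    intro d hd
    rw [mem_Ico] at hd
    rw [if_pos hd.1, ← mul_assoc, ← pow_add]
    congr 2
    omega
  rw [h1, h2, zero_add]

theorem cnt_big (I : AksInv k loc cnt r B Y) (d : ℕ) (hd : k < d) : cnt d = 0 := by
  rw [← I.card d 0 (by positivity), Finset.card_eq_zero, Finset.filter_eq_empty_iff]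
  intro w _ h
  have := I.dle w
  rw [h] at this
  simp at this
  omega

theorem cnt_k (I : AksInv k loc cnt r B Y) : cnt k ≤ 1 := by
  have h : 2 ^ k * cnt k ≤ ∑ d ∈ range (k + 1), 2 ^ d * cnt d :=
    Finset.single_le_sum (f := fun d => 2 ^ d * cnt d) (fun _ _ => Nat.zero_le _) (by simp)
  rw [I.total] at h
  have h0 : 0 < 2 ^ k := by positivity
  by_contra hc
  have : 2 ^ k * 2 ≤ 2 ^ k * cnt k := Nat.mul_le_mul_left _ (by omega)
  omega

theorem even (I : AksInv k loc cnt r B Y) (d : ℕ) (hd : d < k) (hb : d = 0 ∨ B * 8 ^ d < 64) :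
    Even (cnt d) := by
  by_cases hm : cnt d = 0
  · rw [hm]; exact Even.zero
  have hpar : (d + r) % 2 = 0 := by
    by_contra hc
    exact hm (I.odd d (by omega))
  have hz : ∀ d' ∈ range d, 2 ^ d' * cnt d' = 0 := by
    intro d' hd'
    rw [mem_range] at hd'
    rcases hb with hb | hb
    · omega
    by_cases h1 : d' + 1 = d
    · rw [I.odd d' (by omega), mul_zero]
    · have h2 := I.cap d'
      have h3 : B * 8 ^ d' * 64 ≤ B * 8 ^ d := by
        have : d = d' + 2 + (d - d' - 2) := by omega
        rw [this, pow_add, pow_add]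
        have h1 : (1:ℝ) ≤ 8 ^ (d - d' - 2) := one_le_pow₀ (by norm_num)
        have h0 : 0 < B * 8 ^ d' * 64 := by have := I.pos; positivity
        nlinarith
      have h4 : (cnt d' : ℝ) < 1 := by linarith
      have : cnt d' = 0 := by
        have : cnt d' < 1 := by exact_mod_cast h4
        omega
      rw [this, mul_zero]
  have h1 := I.split (d + 1) (by omega)
  rw [Finset.sum_range_succ, Finset.sum_eq_zero hz, zero_add] at h1
  set X := ∑ d_1 ∈ range (k + 1), if d + 1 ≤ d_1 then 2 ^ (d_1 - (d + 1)) * cnt d_1 else 0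
  have h2 : 2 ^ d * (cnt d + 2 * X) = 2 ^ d * (2 * 2 ^ (k - d - 1)) := by
    rw [← pow_succ', ← pow_add]
    have : d + (k - d - 1 + 1) = k := by omega
    rw [this, ← h1]
    ring
  have h3 := Nat.eq_of_mul_eq_mul_left (by positivity) h2
  rw [Nat.even_iff]
  omega

theorem geo_low (B : ℝ) (hB : 0 < B) (d : ℕ) (f : ℕ → ℝ) (hf : ∀ i < d, f i ≤ B * 16 ^ i)
    (h1 : ∀ i, i + 1 = d → f i = 0) : ∑ i ∈ range d, f i ≤ B * 16 ^ d / 240 := by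
  rcases d with _ | d
  · simp; positivity
  · rw [Finset.sum_range_succ, h1 d rfl, add_zero]
    have : ∀ n, n ≤ d → ∑ i ∈ range n, f i ≤ B * 16 ^ n / 15 := by
      intro n hn
      induction n with
      | zero => simp; positivity
      | succ n ih =>
        rw [Finset.sum_range_succ]
        have e1 := ih (by omega)
        have e2 := hf n (by omega)
        rw [pow_succ]
        have : 0 < B * 16 ^ n := by positivity
        linarith
    have e := this d le_rfl
    rw [pow_succ]
    linarith

theorem geo_high (M : ℝ) (hM : 0 ≤ M) (n : ℕ) :
    ∑ i ∈ range n, (if i = 0 then 0 else M * (1 / 64) ^ i) ≤ M / 63 := by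
  have : ∑ i ∈ range n, (if i = 0 then 0 else M * (1 / 64) ^ i) ≤
      M / 63 - (if n = 0 then 0 else M / 63 * (1 / 64) ^ (n - 1)) := by
    induction n with
    | zero => simp; positivity
    | succ n ih =>
      rw [Finset.sum_range_succ]
      rcases n with _ | n
      · simp
      · simp only [Nat.add_eq_zero_iff, one_ne_zero, and_false, if_false, Nat.add_sub_cancel] at ih ⊢
        rw [pow_succ]
        linarith
  refine this.trans ?_
  split_ifs
  · simp
  · have : 0 ≤ M / 63 * (1 / 64) ^ (n - 1) := by positivity
    linarith

theorem natives (I : AksInv k loc cnt r B Y) (d c : ℕ) (hd : d < k) (hm : cnt d ≠ 0)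
    (hc : c < 2 ^ (d + 1)) (y : W → ℕ) (hy : y ∈ Y) :
    (#{w | loc w = (d, c / 2) ∧ y w / 2 ^ (k - d - 1) = c} : ℝ) ≤
      cnt d / 2 + (B * 8 ^ d) / 480 + 8 / 63 * (1 / 160) * (B * 8 ^ d) := by
  have hpar : (d + r) % 2 = 0 := by
    by_contra hc
    exact hm (I.odd d (by omega))
  have hB := I.pos
  set T : Finset W := {w | d + 1 ≤ (loc w).1 ∧ (loc w).2 / 2 ^ ((loc w).1 - (d + 1)) = c} with hT
  set Nc : Finset W := {w | loc w = (d, c / 2) ∧ y w / 2 ^ (k - d - 1) = c} with hNc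
  set N : Finset W := {w | (d + 1 ≤ (loc w).1 ∧ (loc w).2 / 2 ^ ((loc w).1 - (d + 1)) = c) ∧
    y w / 2 ^ (k - d - 1) ≠ c} with hN
  -- natives inject
  have e1 : #Nc + #(T \ N) ≤ 2 ^ (k - d - 1) := by
    have hdis : Disjoint Nc (T \ N) := by
      rw [Finset.disjoint_left]
      intro w h1 h2
      simp only [hNc, hT, hN, mem_filter, mem_univ, true_and, mem_sdiff] at h1 h2
      have := h2.1.1
      rw [h1.1] at this
      simp at this
    rw [← card_union_of_disjoint hdis, ← node_card c (k - d - 1),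
      ← Finset.card_image_of_injective _ (I.inj y hy)]
    apply card_le_card
    intro v hv
    rw [mem_image] at hv
    obtain ⟨w, hw, rfl⟩ := hv
    have : y w / 2 ^ (k - d - 1) = c := by
      rw [mem_union] at hw
      rcases hw with hw | hw
      · simp only [hNc, mem_filter] at hw; exact hw.2.2
      · simp only [hT, hN, mem_filter, mem_univ, true_and, mem_sdiff] at hw
        by_contra hcon
        exact hw.2 ⟨hw.1, hcon⟩
    rw [Nat.div_eq_iff (by positivity)] at this
    have h2 : (c + 1) * 2 ^ (k - d - 1) = c * 2 ^ (k - d - 1) + 2 ^ (k - d - 1) := by ring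
    have h0 : 0 < 2 ^ (k - d - 1) := by positivity
    rw [mem_Ico]
    omega
  have e2 : #T ≤ #(T \ N) + #N := by
    have := Finset.le_card_sdiff N T
    omega
  have e3 := I.subtree_card (d + 1) c hc
  have e4 := I.split (d + 1) (by omega)
  rw [← e3, Finset.sum_range_succ] at e4
  -- non natives
  have e5 : (#N : ℝ) ≤ 8 / 63 * (1 / 160) * (B * 8 ^ d) := by
    rw [hN, I.subtree_sum (d + 1) c (fun w => y w / 2 ^ (k - d - 1) ≠ c)]
    push_cast
    set M : ℝ := 8 * (1 / 160) * (B * 8 ^ d) with hM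
    calc _ ≤ ∑ d' ∈ range (k + 1), (if d + 1 ≤ d' then
            (if d' - (d + 1) = 0 then 0 else M * (1 / 64) ^ (d' - (d + 1))) else 0) := by
          apply Finset.sum_le_sum
          intro d' hd'
          rw [mem_range] at hd'
          split_ifs with h1 h2
          · have : d' = d + 1 := by omega
            subst this
            push_cast
            apply le_of_eq
            apply Finset.sum_eq_zero
            intro a ha
            have h3 := I.card (d + 1) a (node_lt hc le_rfl (by simpa using ha))
            rw [I.odd (d + 1) (by omega), Finset.card_eq_zero] at h3
            have : ∀ w, loc w ≠ (d + 1, a) := by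
              intro w hw
              have : w ∈ ({w | loc w = (d + 1, a)} : Finset W) := by simp [hw]
              rw [h3] at this
              simp at this
            simp [this]
          · push_cast
            obtain ⟨i, rfl⟩ : ∃ i, d' = d + 1 + i := ⟨d' - (d + 1), by omega⟩
            have e6 : d + 1 + i - (d + 1) = i := by omega
            rw [e6]
            calc _ ≤ ∑ a ∈ Ico (c * 2 ^ i) ((c + 1) * 2 ^ i),
                  1 / 160 * (1 / 1024 : ℝ) ^ i * (B * 8 ^ (d + 1 + i)) := by
                  apply Finset.sum_le_sum
                  intro a ha
                  refine le_trans ?_ (I.str y hy (d + 1 + i) a i)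
                  have e7 : k - (d + 1 + i) + i = k - d - 1 := by omega
                  have e8 : a / 2 ^ i = c := by
                    rw [mem_Ico] at ha
                    rw [Nat.div_eq_iff (by positivity)]
                    have : (c + 1) * 2 ^ i = c * 2 ^ i + 2 ^ i := by ring
                    have h0 : 0 < 2 ^ i := by positivity
                    omega
                  rw [e7, e8]
              _ = M * (1 / 64) ^ i := by
                  rw [Finset.sum_const, node_card, nsmul_eq_mul, hM]
                  have : (1 / 64 : ℝ) ^ i = 2 ^ i * (1 / 1024) ^ i * 8 ^ i := by
                    rw [← mul_pow, ← mul_pow]; norm_num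
                  rw [this, pow_add, pow_add]
                  push_cast
                  ring
          · simp
      _ ≤ ∑ i ∈ range (k + 1), (if i = 0 then 0 else M * (1 / 64) ^ i) := by
          rw [← Finset.sum_filter]
          have : ∀ i ∈ range (k + 1), 0 ≤ (if i = 0 then 0 else M * (1 / 64) ^ i) := by
            intro i _
            split_ifs
            · exact le_rfl
            · positivity
          rw [← Finset.sum_image (s := {a ∈ range (k + 1) | d + 1 ≤ a}) (g := fun d' => d' - (d + 1))
            (f := fun i => if i = 0 then 0 else M * (1 / 64) ^ i)]
          · apply Finset.sum_le_sum_of_subset_of_nonneg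
            · intro i hi
              simp only [mem_image, mem_filter, mem_range] at hi ⊢
              omega
            · intro i hi _; exact this i hi
          · intro a ha b hb hab
            simp only [coe_filter, mem_range, Set.mem_ofPred_eq] at ha hb
            simp only at hab
            omega
      _ ≤ M / 63 := geo_high M (by positivity) _
      _ = _ := by rw [hM]; ring
  -- low levels
  have e6 : ∑ d' ∈ range d, ((2 ^ d' * cnt d' : ℕ) : ℝ) ≤ B * 16 ^ d / 240 := by
    apply geo_low B I.pos
    · intro i hi
      push_cast
      have := I.cap i
      have h16 : (16:ℝ) ^ i = 2 ^ i * 8 ^ i := by rw [← mul_pow]; norm_num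
      rw [h16]
      have : (0:ℝ) < 2 ^ i := by positivity
      nlinarith
    · intro i hi
      rw [I.odd i (by omega)]
      simp
  have e7 : (((∑ d' ∈ range d, 2 ^ d' * cnt d') + 2 ^ d * cnt d + 2 ^ (d + 1) * #T : ℕ) : ℝ) =
      2 ^ (d + 1) * 2 ^ (k - d - 1) := by
    rw [e4]
    push_cast
    rw [← pow_add]
    congr 1
    omega
  push_cast at e6 e7
  have e8 : (#Nc : ℝ) + #T ≤ 2 ^ (k - d - 1) + #N := by
    have : #Nc + #T ≤ 2 ^ (k - d - 1) + #N := by omega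
    exact_mod_cast this
  have h16 : (16:ℝ) ^ d = 2 ^ d * 8 ^ d := by rw [← mul_pow]; norm_num
  rw [h16] at e6
  have hp : (0:ℝ) < 2 ^ d := by positivity
  have e9 : (2:ℝ) ^ d * (2 * #Nc) ≤
      2 ^ d * (cnt d + (B * 8 ^ d) / 240 + 2 * (8 / 63 * (1 / 160) * (B * 8 ^ d))) := by
    have e10 : (2:ℝ) ^ d * (2 * #Nc + 2 * #T) ≤ 2 ^ d * (2 * 2 ^ (k - d - 1) + 2 * #N) := by
      apply mul_le_mul_of_nonneg_left _ hp.le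
      linarith
    have e11 : (2:ℝ) ^ d * #N ≤ 2 ^ d * (8 / 63 * (1 / 160) * (B * 8 ^ d)) :=
      mul_le_mul_of_nonneg_left e5 hp.le
    rw [pow_succ] at e7
    nlinarith
  have := le_of_mul_le_mul_left e9 hp
  linarith

end AksInv

theorem aks_numbers (m d k : ℕ) (b : ℝ) (hmb : (m : ℝ) ≤ b) (hk1 : 1 ≤ k)
    (hkm : k ≤ d → (m : ℝ) ≤ b / 32) (hpar : d < k → (d = 0 ∨ b < 64) → Even m) :
    ∃ h f : ℕ, 2 * h ≤ m ∧ f ≤ h ∧ (f = 0 ∨ h ≤ 160 * f) ∧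
      ((m - 2 * (h - f) : ℕ) : ℝ) ≤ b / 32 ∧ (d = 0 → m = 2 * (h - f)) ∧ (k ≤ d → h = f) ∧
      (h ≠ f → (m = 2 * h ∨ (m = 2 * h + 1 ∧ 64 ≤ b)) ∧
        ∀ K : ℕ, (K : ℝ) ≤ b / 160 → K ≤ f ∨ d = 0) := by
  have hb0 : 0 ≤ b := le_trans (Nat.cast_nonneg _) hmb
  by_cases hd : d = 0
  · have he := hpar (by omega) (Or.inl hd)
    rw [Nat.even_iff] at he
    refine ⟨m / 2, 0, by omega, by omega, Or.inl rfl, ?_, by omega, by omega, fun _ => ⟨by omega, fun _ _ => Or.inr hd⟩⟩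
    have : m - 2 * (m / 2 - 0) = 0 := by omega
    rw [this]
    simp
    positivity
  by_cases hm : (m : ℝ) ≤ b / 32
  · exact ⟨0, 0, by omega, by omega, by omega, by simpa using hm, by omega, by omega, by omega⟩
  · have hdk : d < k := by
      by_contra hc
      exact hm (hkm (by omega))
    set r := m % 2 with hr
    have hr1 : r ≤ 1 := by omega
    have hrr : (r : ℝ) ≤ 1 := by exact_mod_cast hr1
    have hodd : r = 1 → 64 ≤ b := by
      intro h1
      by_contra hc
      have := hpar hdk (Or.inr (not_le.mp hc))
      rw [Nat.even_iff] at this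
      omega
    have hrb : (r : ℝ) ≤ b / 32 := by
      by_cases h1 : r = 1
      · have := hodd h1
        rw [h1]; push_cast; linarith
      · have : r = 0 := by omega
        rw [this]; simp; positivity
    have hnn : 0 ≤ (b / 32 - r) / 2 := by linarith
    set f := ⌊(b / 32 - r) / 2⌋₊ with hf
    have hf1 : (f : ℝ) ≤ (b / 32 - r) / 2 := Nat.floor_le hnn
    have hf2 : (b / 32 - r) / 2 < f + 1 := Nat.lt_floor_add_one _
    have hm2 : m = 2 * (m / 2) + r := by omega
    have hm2' : (m : ℝ) = 2 * ((m / 2 : ℕ) : ℝ) + r := by exact_mod_cast hm2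
    have hfh : f ≤ m / 2 := by
      have : (f : ℝ) < ((m / 2 : ℕ) : ℝ) := by
        push Not at hm
        linarith
      exact_mod_cast this.le
    refine ⟨m / 2, f, by omega, hfh, ?_, ?_, by omega, by omega, fun _ => ⟨?_, ?_⟩⟩
    · by_cases hf0 : f = 0
      · exact Or.inl hf0
      · right
        have : (1:ℝ) ≤ f := by exact_mod_cast Nat.one_le_iff_ne_zero.mpr hf0
        have h3 : ((m / 2 : ℕ) : ℝ) ≤ 160 * f := by linarith [(Nat.cast_nonneg r : (0:ℝ) ≤ r)]
        exact_mod_cast h3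
    · have : m - 2 * (m / 2 - f) = r + 2 * f := by omega
      rw [this]
      push_cast
      linarith
    · by_cases h1 : r = 1
      · right
        exact ⟨by omega, hodd h1⟩
      · left; omega
    · intro K hK
      left
      by_cases hK0 : K = 0
      · omega
      · have : (1:ℝ) ≤ K := by exact_mod_cast Nat.one_le_iff_ne_zero.mpr hK0
        apply Nat.le_floor
        linarith


/-! ### Part E: one AKS step -/

open AksLayer

theorem aks_down {k : ℕ} {W : Type} [Fintype W] [DecidableEq W] {loc : W → ℕ × ℕ} {cnt : ℕ → ℕ}
    {r : ℕ} {B : ℝ} {Y : Set (W → ℕ)} (I : AksInv k loc cnt r B Y) (y : W → ℕ) (hy : y ∈ Y)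
    (d a : ℕ) (hd : d < k) (ha : a < 2 ^ d) (h f : ℕ) (h2 : 2 * h ≤ cnt d) (hfh : f ≤ h)
    (hf : h ≠ f → (cnt d = 2 * h ∨ (cnt d = 2 * h + 1 ∧ 64 ≤ B * 8 ^ d)) ∧
        ∀ K : ℕ, (K : ℝ) ≤ B * 8 ^ d / 160 → K ≤ f ∨ d = 0)
    (z : W → ℕ) (Cl Cr : Finset W) (hCl : #Cl = h - f) (hCr : #Cr = h - f)
    (hsep : ∀ (P : ℕ → Prop) [DecidablePred P] (K : ℕ), #{w | loc w = (d, a) ∧ P (y w)} = K →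
          ((∀ a b, a ≤ b → P b → P a) →
            (#{w ∈ Cr | P (z w)} : ℝ) ≤ max 0 ((K : ℝ) - h) + 1 / 2048 * h ∧
            (K ≤ f → (#{w ∈ Cl ∪ Cr | P (z w)} : ℝ) ≤ 2 * (1 / 2048) * K)) ∧
          ((∀ a b, a ≤ b → P a → P b) →
            (#{w ∈ Cl | P (z w)} : ℝ) ≤ max 0 ((K : ℝ) - h) + 1 / 2048 * h ∧
            (K ≤ f → (#{w ∈ Cl ∪ Cr | P (z w)} : ℝ) ≤ 2 * (1 / 2048) * K))) :
    (∀ i, (#{w ∈ Cl ∪ Cr | z w / 2 ^ (k - d + i) ≠ a / 2 ^ i} : ℝ) ≤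
      1 / 1024 * (1 / 160 * (1 / 1024) ^ i * (B * 8 ^ d))) ∧
    (#{w ∈ Cl | z w / 2 ^ (k - d - 1) ≠ 2 * a} : ℝ) ≤ 2 / 100 * (B * 8 ^ d) ∧
    (#{w ∈ Cr | z w / 2 ^ (k - d - 1) ≠ 2 * a + 1} : ℝ) ≤ 2 / 100 * (B * 8 ^ d) := by
  have hB := I.pos
  set b := B * 8 ^ d with hb
  have hb0 : 0 < b := by positivity
  by_cases hhf : h = f
  · have e1 : Cl = ∅ := by rw [← Finset.card_eq_zero]; omega
    have e2 : Cr = ∅ := by rw [← Finset.card_eq_zero]; omega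
    subst e1 e2
    refine ⟨fun i => ?_, ?_, ?_⟩
    · simp; positivity
    · simp; positivity
    · simp; positivity
  obtain ⟨hm, hKf⟩ := hf hhf
  have hcap : (cnt d : ℝ) ≤ b := I.cap d
  have hhb : (h : ℝ) ≤ b / 2 := by
    have : (2 * h : ℝ) ≤ cnt d := by exact_mod_cast h2
    linarith
  have hmh : (cnt d : ℝ) / 2 ≤ h + b / 128 := by
    rcases hm with hm | ⟨hm, hb64⟩
    · rw [hm]; push_cast; linarith
    · rw [hm]; push_cast; linarith
  have part1 : ∀ i, (#{w ∈ Cl ∪ Cr | z w / 2 ^ (k - d + i) ≠ a / 2 ^ i} : ℝ) ≤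
      1 / 1024 * (1 / 160 * (1 / 1024) ^ i * b) := by
    intro i
    have hstr := I.str y hy d a i
    set K1 := #{w | loc w = (d, a) ∧ y w / 2 ^ (k - d + i) < a / 2 ^ i} with hK1
    set K2 := #{w | loc w = (d, a) ∧ a / 2 ^ i < y w / 2 ^ (k - d + i)} with hK2
    set K := #{w | loc w = (d, a) ∧ y w / 2 ^ (k - d + i) ≠ a / 2 ^ i} with hK
    have hsum : K1 + K2 = K := by
      rw [hK1, hK2, hK, ← card_union_of_disjoint]
      · congr 1
        ext w
        simp only [mem_union, mem_filter, mem_univ, true_and]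
        constructor
        · rintro (h | h)
          · exact ⟨h.1, h.2.ne⟩
          · exact ⟨h.1, h.2.ne'⟩
        · rintro ⟨h1, h2⟩
          rcases lt_or_gt_of_ne h2 with h | h
          · exact Or.inl ⟨h1, h⟩
          · exact Or.inr ⟨h1, h⟩
      · rw [Finset.disjoint_left]
        intro w h1 h2
        simp only [mem_filter, mem_univ, true_and] at h1 h2
        omega
    have hpow : (1 / 1024 : ℝ) ^ i ≤ 1 := pow_le_one₀ (by norm_num) (by norm_num)
    have hKb : (K : ℝ) ≤ b / 160 := by
      refine hstr.trans ?_
      rw [← hb]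
      nlinarith
    have hKf' : K ≤ f := by
      rcases hKf K hKb with h1 | h1
      · exact h1
      · have : K = 0 := by
          rw [hK, Finset.card_eq_zero, Finset.filter_eq_empty_iff]
          rintro w - ⟨h3, h4⟩
          apply h4
          subst h1
          have : a = 0 := by simpa using ha
          subst this
          rw [Nat.zero_div, Nat.div_eq_of_lt]
          refine (I.lt y hy w).trans_le ?_
          exact Nat.pow_le_pow_right (by norm_num) (by omega)
        omega
    have s1 := ((hsep (fun v => v / 2 ^ (k - d + i) < a / 2 ^ i) K1 rfl).1
      (fun u v huv hv => (Nat.div_le_div_right huv).trans_lt hv)).2 (by omega)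
    have s2 := ((hsep (fun v => a / 2 ^ i < v / 2 ^ (k - d + i)) K2 rfl).2
      (fun u v huv hv => hv.trans_le (Nat.div_le_div_right huv))).2 (by omega)
    have hle : #{w ∈ Cl ∪ Cr | z w / 2 ^ (k - d + i) ≠ a / 2 ^ i} ≤
        #{w ∈ Cl ∪ Cr | z w / 2 ^ (k - d + i) < a / 2 ^ i} +
        #{w ∈ Cl ∪ Cr | a / 2 ^ i < z w / 2 ^ (k - d + i)} := by
      refine le_trans (card_le_card ?_) (card_union_le _ _)
      intro w hw
      simp only [mem_union, mem_filter] at hw ⊢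
      rcases lt_or_gt_of_ne hw.2 with h | h
      · exact Or.inl ⟨hw.1, h⟩
      · exact Or.inr ⟨hw.1, h⟩
    have hle' : (#{w ∈ Cl ∪ Cr | z w / 2 ^ (k - d + i) ≠ a / 2 ^ i} : ℝ) ≤
        #{w ∈ Cl ∪ Cr | z w / 2 ^ (k - d + i) < a / 2 ^ i} +
        #{w ∈ Cl ∪ Cr | a / 2 ^ i < z w / 2 ^ (k - d + i)} := by exact_mod_cast hle
    have hsum' : (K1 : ℝ) + K2 = K := by exact_mod_cast hsum
    linarith
  have hdiv : ∀ v : ℕ, v / 2 ^ (k - d) = v / 2 ^ (k - d - 1) / 2 := by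
    intro v
    rw [Nat.div_div_eq_div_mul, ← pow_succ]
    congr 2
    omega
  have p0 := part1 0
  have str0 := I.str y hy d a 0
  simp only [pow_zero, Nat.div_one, add_zero, mul_one] at p0 str0
  rw [← hb] at str0
  have hm0 : cnt d ≠ 0 := by omega
  refine ⟨part1, ?_, ?_⟩
  · have hnat := I.natives d (2 * a + 1) hd hm0 (by rw [pow_succ]; omega) y hy
    have ea : (2 * a + 1) / 2 = a := by omega
    rw [ea, ← hb] at hnat
    set K := #{w | loc w = (d, a) ∧ 2 * a + 1 ≤ y w / 2 ^ (k - d - 1)} with hK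
    have hKle : K ≤ #{w | loc w = (d, a) ∧ y w / 2 ^ (k - d) ≠ a} +
        #{w | loc w = (d, a) ∧ y w / 2 ^ (k - d - 1) = 2 * a + 1} := by
      refine le_trans (card_le_card ?_) (card_union_le _ _)
      intro w hw
      simp only [mem_union, mem_filter, mem_univ, true_and] at hw ⊢
      rw [hdiv]
      by_cases h3 : y w / 2 ^ (k - d - 1) = 2 * a + 1
      · exact Or.inr ⟨hw.1, h3⟩
      · exact Or.inl ⟨hw.1, by omega⟩
    have hKle' : (K : ℝ) ≤ #{w | loc w = (d, a) ∧ y w / 2 ^ (k - d) ≠ a} +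
        #{w | loc w = (d, a) ∧ y w / 2 ^ (k - d - 1) = 2 * a + 1} := by exact_mod_cast hKle
    have s1 := ((hsep (fun v => 2 * a + 1 ≤ v / 2 ^ (k - d - 1)) K rfl).2
      (fun u v huv hv => hv.trans (Nat.div_le_div_right huv))).1
    have hle : #{w ∈ Cl | z w / 2 ^ (k - d - 1) ≠ 2 * a} ≤
        #{w ∈ Cl ∪ Cr | z w / 2 ^ (k - d) ≠ a} +
        #{w ∈ Cl | 2 * a + 1 ≤ z w / 2 ^ (k - d - 1)} := by
      refine le_trans (card_le_card ?_) (card_union_le _ _)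
      intro w hw
      simp only [mem_union, mem_filter] at hw ⊢
      rw [hdiv]
      by_cases h3 : 2 * a + 1 ≤ z w / 2 ^ (k - d - 1)
      · exact Or.inr ⟨hw.1, h3⟩
      · exact Or.inl ⟨Or.inl hw.1, by omega⟩
    have hle' : (#{w ∈ Cl | z w / 2 ^ (k - d - 1) ≠ 2 * a} : ℝ) ≤
        #{w ∈ Cl ∪ Cr | z w / 2 ^ (k - d) ≠ a} +
        #{w ∈ Cl | 2 * a + 1 ≤ z w / 2 ^ (k - d - 1)} := by exact_mod_cast hle
    have hmax : max 0 ((K : ℝ) - h) ≤ (1 / 160 + 1 / 480 + 8 / 63 * (1 / 160) + 1 / 128) * b := by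
      apply max_le
      · positivity
      · linarith
    linarith
  · have hnat := I.natives d (2 * a) hd hm0 (by rw [pow_succ]; omega) y hy
    have ea : (2 * a) / 2 = a := by omega
    rw [ea, ← hb] at hnat
    set K := #{w | loc w = (d, a) ∧ y w / 2 ^ (k - d - 1) ≤ 2 * a} with hK
    have hKle : K ≤ #{w | loc w = (d, a) ∧ y w / 2 ^ (k - d) ≠ a} +
        #{w | loc w = (d, a) ∧ y w / 2 ^ (k - d - 1) = 2 * a} := by
      refine le_trans (card_le_card ?_) (card_union_le _ _)
      intro w hw
      simp only [mem_union, mem_filter, mem_univ, true_and] at hw ⊢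
      rw [hdiv]
      by_cases h3 : y w / 2 ^ (k - d - 1) = 2 * a
      · exact Or.inr ⟨hw.1, h3⟩
      · exact Or.inl ⟨hw.1, by omega⟩
    have hKle' : (K : ℝ) ≤ #{w | loc w = (d, a) ∧ y w / 2 ^ (k - d) ≠ a} +
        #{w | loc w = (d, a) ∧ y w / 2 ^ (k - d - 1) = 2 * a} := by exact_mod_cast hKle
    have s1 := ((hsep (fun v => v / 2 ^ (k - d - 1) ≤ 2 * a) K rfl).1
      (fun u v huv hv => (Nat.div_le_div_right huv).trans hv)).1
    have hle : #{w ∈ Cr | z w / 2 ^ (k - d - 1) ≠ 2 * a + 1} ≤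
        #{w ∈ Cl ∪ Cr | z w / 2 ^ (k - d) ≠ a} +
        #{w ∈ Cr | z w / 2 ^ (k - d - 1) ≤ 2 * a} := by
      refine le_trans (card_le_card ?_) (card_union_le _ _)
      intro w hw
      simp only [mem_union, mem_filter] at hw ⊢
      rw [hdiv]
      by_cases h3 : z w / 2 ^ (k - d - 1) ≤ 2 * a
      · exact Or.inr ⟨hw.1, h3⟩
      · exact Or.inl ⟨Or.inr hw.1, by omega⟩
    have hle' : (#{w ∈ Cr | z w / 2 ^ (k - d - 1) ≠ 2 * a + 1} : ℝ) ≤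
        #{w ∈ Cl ∪ Cr | z w / 2 ^ (k - d) ≠ a} +
        #{w ∈ Cr | z w / 2 ^ (k - d - 1) ≤ 2 * a} := by exact_mod_cast hle
    have hmax : max 0 ((K : ℝ) - h) ≤ (1 / 160 + 1 / 480 + 8 / 63 * (1 / 160) + 1 / 128) * b := by
      apply max_le
      · positivity
      · linarith
    linarith

theorem aks_step : ∃ D : ℕ, ∀ (k : ℕ) (W : Type) [Fintype W] [DecidableEq W] (loc : W → ℕ × ℕ)
    (cnt : ℕ → ℕ) (r : ℕ) (B : ℝ) (Y : Set (W → ℕ)), AksInv k loc cnt r B Y → 1 ≤ k →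
    160 ≤ B * 8 ^ k → ∃ (N : ℕ → AksLayer W) (loc' : W → ℕ × ℕ) (cnt' : ℕ → ℕ),
      AksInv k loc' cnt' (r + 1) (9 / 16 * B) (run N D '' Y) := by
  obtain ⟨D, hD⟩ := aks_sep (1 / 2048) (by norm_num) (by norm_num) 160
  refine ⟨D, fun k W _ _ loc cnt r B Y I hk1 hBk => ?_⟩
  have hB := I.pos
  have hnum : ∀ d, ∃ h f : ℕ, 2 * h ≤ cnt d ∧ f ≤ h ∧ (f = 0 ∨ h ≤ 160 * f) ∧
      ((cnt d - 2 * (h - f) : ℕ) : ℝ) ≤ B * 8 ^ d / 32 ∧ (d = 0 → cnt d = 2 * (h - f)) ∧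
      (k ≤ d → h = f) ∧
      (h ≠ f → (cnt d = 2 * h ∨ (cnt d = 2 * h + 1 ∧ 64 ≤ B * 8 ^ d)) ∧
        ∀ K : ℕ, (K : ℝ) ≤ B * 8 ^ d / 160 → K ≤ f ∨ d = 0) := by
    intro d
    apply aks_numbers (cnt d) d k (B * 8 ^ d) (I.cap d) hk1
    · intro hkd
      rcases hkd.eq_or_lt with h | h
      · subst h
        have : (cnt k : ℝ) ≤ 1 := by exact_mod_cast I.cnt_k
        linarith
      · rw [I.cnt_big d h]
        simp; positivity
    · intro h1 h2
      exact I.even d h1 h2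
  choose h f hn1 hn2 hn3 hn4 hn5 hn6 hn7 using hnum
  set S : ℕ × ℕ → Finset W := fun i => {w | loc w = i} with hS
  have memS : ∀ i w, w ∈ S i ↔ loc w = i := by intro i w; simp [hS]
  have cardS : ∀ i : ℕ × ℕ, i.2 < 2 ^ i.1 → #(S i) = cnt i.1 := fun i hi => I.card i.1 i.2 hi
  have hsep : ∀ i : ℕ × ℕ, ∃ L : ℕ → AksLayer W, LocalOn L (S i) ∧ ∃ Cl Cr : Finset W,
        Cl ⊆ S i ∧ Cr ⊆ S i ∧ Disjoint Cl Cr ∧ (i.2 < 2 ^ i.1 → #Cl = h i.1 - f i.1) ∧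
        (i.2 < 2 ^ i.1 → #Cr = h i.1 - f i.1) ∧
        (i.2 < 2 ^ i.1 → ∀ x : W → ℕ, ∀ (P : ℕ → Prop) [DecidablePred P] (K : ℕ),
          #{w ∈ S i | P (x w)} = K →
          ((∀ a b, a ≤ b → P b → P a) →
            (#{w ∈ Cr | P (run L D x w)} : ℝ) ≤ max 0 ((K : ℝ) - h i.1) + 1 / 2048 * h i.1 ∧
            (K ≤ f i.1 → (#{w ∈ Cl ∪ Cr | P (run L D x w)} : ℝ) ≤ 2 * (1 / 2048) * K)) ∧
          ((∀ a b, a ≤ b → P a → P b) →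
            (#{w ∈ Cl | P (run L D x w)} : ℝ) ≤ max 0 ((K : ℝ) - h i.1) + 1 / 2048 * h i.1 ∧
            (K ≤ f i.1 → (#{w ∈ Cl ∪ Cr | P (run L D x w)} : ℝ) ≤ 2 * (1 / 2048) * K))) := by
    intro i
    by_cases hi : i.2 < 2 ^ i.1
    · obtain ⟨L, hL, Cl, Cr, h1, h2, h3, h4, h5, h6⟩ := hD W (S i) (h i.1) (f i.1)
        (by rw [cardS i hi]; exact hn1 _) (hn2 _) (hn3 _)
      exact ⟨L, hL, Cl, Cr, h1, h2, h3, fun _ => h4, fun _ => h5, fun _ => h6⟩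
    · exact ⟨fun _ => idle W, localOn_idle _, ∅, ∅, by simp, by simp, by simp,
        fun h => absurd h hi, fun h => absurd h hi, fun h => absurd h hi⟩
  choose N hN Cl Cr hCl hCr hdis cCl cCr hsepp using hsep
  have hpar : ∀ i t w, loc w = i → loc ((N i t).p w) = i := by
    intro i t w hw
    rw [← memS]
    exact (hN i).closed subset_rfl t w ((memS _ _).mpr hw)
  set Ls := par loc N hpar with hLs
  have hrun : ∀ (y : W → ℕ) w i, loc w = i → run Ls D y w = run (N i) D y w := by
    intro y w i hi
    rw [hLs, run_par, hi]
  set loc' : W → ℕ × ℕ := fun w => if w ∈ Cl (loc w) then ((loc w).1 + 1, 2 * (loc w).2) else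
    if w ∈ Cr (loc w) then ((loc w).1 + 1, 2 * (loc w).2 + 1) else ((loc w).1 - 1, (loc w).2 / 2)
    with hloc'
  set U : ℕ × ℕ → Finset W := fun i => S i \ (Cl i ∪ Cr i) with hU
  have cU : ∀ i : ℕ × ℕ, i.2 < 2 ^ i.1 → #(U i) = cnt i.1 - 2 * (h i.1 - f i.1) := by
    intro i hi
    rw [hU]
    simp only
    rw [card_sdiff_of_subset (union_subset (hCl i) (hCr i)), card_union_of_disjoint (hdis i),
      cCl i hi, cCr i hi, cardS i hi]
    omega
  have hU0 : U (0, 0) = ∅ := by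
    rw [← Finset.card_eq_zero, cU (0, 0) (by simp)]
    have := hn5 0 rfl
    simp only
    omega
  set C : ℕ → ℕ → Finset W := fun d a => if d = 0 then ∅ else
    if a % 2 = 0 then Cl (d - 1, a / 2) else Cr (d - 1, a / 2) with hC
  have hClloc : ∀ i w, w ∈ Cl i → loc w = i := fun i w hw => (memS i w).mp (hCl i hw)
  have hCrloc : ∀ i w, w ∈ Cr i → loc w = i := fun i w hw => (memS i w).mp (hCr i hw)
  have hUloc : ∀ i w, w ∈ U i → loc w = i := fun i w hw => (memS i w).mp (mem_sdiff.mp hw).1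
  -- the new location classes
  have hclass : ∀ d a, ({w | loc' w = (d, a)} : Finset W) =
      C d a ∪ (U (d + 1, 2 * a) ∪ U (d + 1, 2 * a + 1)) := by
    intro d a
    ext w
    simp only [mem_filter, mem_univ, true_and, mem_union]
    constructor
    · intro hw
      simp only [hloc'] at hw
      split_ifs at hw with h1 h2
      · left
        simp only [Prod.mk.injEq] at hw
        simp only [hC]
        rw [if_neg (by omega), if_pos (by omega)]
        have : ((d - 1, a / 2) : ℕ × ℕ) = loc w := Prod.ext (by simp; omega) (by simp; omega)
        rw [this]; exact h1
      · left
        simp only [Prod.mk.injEq] at hw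
        simp only [hC]
        rw [if_neg (by omega), if_neg (by omega)]
        have : ((d - 1, a / 2) : ℕ × ℕ) = loc w := Prod.ext (by simp; omega) (by simp; omega)
        rw [this]; exact h2
      · right
        simp only [Prod.mk.injEq] at hw
        have hwU : w ∈ U (loc w) := by
          simp only [hU, mem_sdiff, mem_union, not_or]
          exact ⟨(memS _ _).mpr rfl, h1, h2⟩
        have hne : (loc w).1 ≠ 0 := by
          intro h0
          have h3 := I.alt w
          rw [h0] at h3
          have : loc w = (0, 0) := Prod.ext h0 (by simpa using h3)
          rw [this, hU0] at hwU
          simp at hwU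
        by_cases hpar : (loc w).2 % 2 = 0
        · left
          have : ((d + 1, 2 * a) : ℕ × ℕ) = loc w := Prod.ext (by simp; omega) (by simp; omega)
          rw [this]; exact hwU
        · right
          have : ((d + 1, 2 * a + 1) : ℕ × ℕ) = loc w := Prod.ext (by simp; omega) (by simp; omega)
          rw [this]; exact hwU
    · have hUcase : ∀ i, w ∈ U i → loc' w = (i.1 - 1, i.2 / 2) := by
        intro i hi
        have h1 := hUloc i w hi
        simp only [hU, mem_sdiff, mem_union, not_or] at hi
        simp only [hloc', h1]
        rw [if_neg hi.2.1, if_neg hi.2.2]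
      rintro (hw | hw | hw)
      · simp only [hC] at hw
        split_ifs at hw with h1 h2
        · simp at hw
        · have h3 := hClloc _ _ hw
          simp only [hloc', h3]
          rw [if_pos hw]
          exact Prod.ext (by simp; omega) (by simp; omega)
        · have h3 := hCrloc _ _ hw
          simp only [hloc', h3]
          rw [if_neg (fun h => Finset.disjoint_left.mp (hdis _) h hw), if_pos hw]
          exact Prod.ext (by simp; omega) (by simp; omega)
      · rw [hUcase _ hw]
        exact Prod.ext (by simp) (by simp)
      · rw [hUcase _ hw]
        exact Prod.ext (by simp) (by simp; omega)
  have hCloc : ∀ d a w, w ∈ C d a → loc w = (d - 1, a / 2) ∧ d ≠ 0 := by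
    intro d a w hw
    simp only [hC] at hw
    split_ifs at hw with h1 h2
    · simp at hw
    · exact ⟨hClloc _ _ hw, h1⟩
    · exact ⟨hCrloc _ _ hw, h1⟩
  set cnt' : ℕ → ℕ := fun d => (if d = 0 then 0 else h (d - 1) - f (d - 1)) +
    2 * (cnt (d + 1) - 2 * (h (d + 1) - f (d + 1))) with hcnt'
  have half : ∀ d a, a < 2 ^ d → d ≠ 0 → a / 2 < 2 ^ (d - 1) := by
    intro d a ha hd
    obtain ⟨d, rfl⟩ := Nat.exists_eq_succ_of_ne_zero hd
    rw [Nat.succ_eq_add_one, pow_succ] at ha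
    simp only [Nat.succ_eq_add_one, Nat.add_sub_cancel]
    omega
  have cC : ∀ d a, a < 2 ^ d → #(C d a) = if d = 0 then 0 else h (d - 1) - f (d - 1) := by
    intro d a ha
    simp only [hC]
    split_ifs with h1 h2
    · simp
    · exact cCl (d - 1, a / 2) (half d a ha h1)
    · exact cCr (d - 1, a / 2) (half d a ha h1)
  have dbl : ∀ d a, a < 2 ^ d → 2 * a < 2 ^ (d + 1) ∧ 2 * a + 1 < 2 ^ (d + 1) := by
    intro d a ha
    rw [pow_succ]
    omega
  have hdle : ∀ w, (loc' w).1 ≤ k := by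
    intro w
    have h1 := I.dle w
    have hz : (loc w).1 = k → h k - f k = 0 := by
      intro _
      have := hn6 k le_rfl
      omega
    have hk' : (loc w).1 = k → (Cl (loc w) = ∅ ∧ Cr (loc w) = ∅) := by
      intro he
      constructor
      · rw [← Finset.card_eq_zero, cCl _ (I.alt w), he, hz he]
      · rw [← Finset.card_eq_zero, cCr _ (I.alt w), he, hz he]
    simp only [hloc']
    split_ifs with h2 h3
    · by_contra hc
      have := hk' (by simp only at hc; omega)
      rw [this.1] at h2
      simp at h2
    · by_contra hc
      have := hk' (by simp only at hc; omega)
      rw [this.2] at h3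
      simp at h3
    · simp only; omega
  have halt : ∀ w, (loc' w).2 < 2 ^ (loc' w).1 := by
    intro w
    have h1 := I.alt w
    simp only [hloc']
    split_ifs with h2 h3
    · exact (dbl _ _ h1).1
    · exact (dbl _ _ h1).2
    · simp only
      by_cases h0 : (loc w).1 = 0
      · rw [h0] at h1 ⊢
        simp at h1 ⊢
        omega
      · exact half _ _ h1 h0
  refine ⟨Ls, loc', cnt', ?_, ?_, by positivity, I.cardW, hdle, halt, ?_, ?_, ?_, ?_⟩
  · rintro _ ⟨y, hy, rfl⟩
    obtain ⟨π, h1, -⟩ := run_perm Ls D y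
    rw [h1]
    exact (I.inj y hy).comp π.injective
  · rintro _ ⟨y, hy, rfl⟩ w
    obtain ⟨π, h1, -⟩ := run_perm Ls D y
    rw [h1]
    exact I.lt y hy _
  · intro d a ha
    rw [hclass, card_union_of_disjoint, card_union_of_disjoint, cC d a ha,
      cU (d + 1, 2 * a) (dbl d a ha).1, cU (d + 1, 2 * a + 1) (dbl d a ha).2]
    · simp only [hcnt']; ring
    · rw [Finset.disjoint_left]
      intro w h1 h2
      have := (hUloc _ _ h1).symm.trans (hUloc _ _ h2)
      simp at this
    · rw [Finset.disjoint_left]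
      intro w h1 h2
      have h3 := hCloc _ _ _ h1
      rw [mem_union] at h2
      rcases h2 with h2 | h2
      · have := h3.1.symm.trans (hUloc _ _ h2)
        simp only [Prod.mk.injEq] at this
        omega
      · have := h3.1.symm.trans (hUloc _ _ h2)
        simp only [Prod.mk.injEq] at this
        omega
  · intro d
    simp only [hcnt']
    have h1 := hn4 (d + 1)
    rw [pow_succ] at h1
    push_cast
    have h8 : (0:ℝ) < 8 ^ d := by positivity
    rcases d with _ | d
    · simp at h1 ⊢
      linarith
    · have h2 : ((h d - f d : ℕ) : ℝ) ≤ B * 8 ^ d / 2 := by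
        have h3 : 2 * (h d - f d) ≤ cnt d := by have := hn1 d; omega
        have h4 : 2 * ((h d - f d : ℕ) : ℝ) ≤ cnt d := by exact_mod_cast h3
        have := I.cap d
        linarith
      simp only [Nat.add_eq_zero_iff, one_ne_zero, and_false, if_false, Nat.add_sub_cancel]
      rw [pow_succ] at h1 ⊢
      push_cast at h1 h2 ⊢
      linarith
  · intro d hd
    simp only [hcnt']
    have h1 : cnt (d + 1) = 0 := I.odd _ (by omega)
    rcases d with _ | d
    · simp [h1]
    · have h2 : cnt d = 0 := I.odd _ (by omega)
      have := hn1 d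
      simp [h1]
      omega
  · rintro _ ⟨y, hy, rfl⟩ d a j
    by_cases hdk : k < d
    · have : ({w | loc' w = (d, a) ∧ run Ls D y w / 2 ^ (k - d + j) ≠ a / 2 ^ j} : Finset W) = ∅ := by
        rw [Finset.filter_eq_empty_iff]
        rintro w - ⟨h1, -⟩
        have := hdle w
        rw [h1] at this
        simp at this
        omega
      rw [this]
      simp
      positivity
    by_cases ha : ¬ a < 2 ^ d
    · have : ({w | loc' w = (d, a) ∧ run Ls D y w / 2 ^ (k - d + j) ≠ a / 2 ^ j} : Finset W) = ∅ := by
        rw [Finset.filter_eq_empty_iff]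
        rintro w - ⟨h1, -⟩
        have := halt w
        rw [h1] at this
        exact ha this
      rw [this]
      simp
      positivity
    push Not at ha hdk
    set Q : ℕ → Prop := fun v => v / 2 ^ (k - d + j) ≠ a / 2 ^ j with hQ
    have hup : ∀ a', a' / 2 = a → (#{w ∈ S (d + 1, a') | Q (run Ls D y w)} : ℝ) ≤
        1 / 160 * (1 / 1024) ^ (j + 1) * (B * 8 ^ (d + 1)) := by
      intro a' ha'
      by_cases hd1 : k < d + 1
      · have : ({w ∈ S (d + 1, a') | Q (run Ls D y w)} : Finset W) = ∅ := by
          rw [Finset.filter_eq_empty_iff]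
          intro w hw
          rw [memS] at hw
          have := I.dle w
          rw [hw] at this
          simp at this
          omega
        rw [this]
        simp
        positivity
      have e1 : #{w ∈ S (d + 1, a') | Q (run Ls D y w)} = #{w ∈ S (d + 1, a') | Q (y w)} := by
        rw [← run_card (N (d + 1, a')) D y (S (d + 1, a'))
          (fun i w hw => (hN _).closed subset_rfl i w hw) Q]
        congr 1
        apply Finset.filter_congr
        intro w hw
        rw [hrun y w _ ((memS _ _).mp hw)]
      rw [e1]
      refine le_trans ?_ (I.str y hy (d + 1) a' (j + 1))
      apply le_of_eq
      congr 2
      ext w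
      simp only [mem_filter, memS, mem_univ, true_and, hQ]
      have e2 : k - (d + 1) + (j + 1) = k - d + j := by omega
      have e3 : a' / 2 ^ (j + 1) = a / 2 ^ j := by
        rw [pow_succ', ← Nat.div_div_eq_div_mul, ha']
      rw [e2, e3]
    have hup0 := hup (2 * a) (by omega)
    have hup1 := hup (2 * a + 1) (by omega)
    have hle : #{w | loc' w = (d, a) ∧ Q (run Ls D y w)} ≤ #{w ∈ C d a | Q (run Ls D y w)} +
        (#{w ∈ S (d + 1, 2 * a) | Q (run Ls D y w)} + #{w ∈ S (d + 1, 2 * a + 1) | Q (run Ls D y w)}) := by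
      refine le_trans (card_le_card ?_) ((card_union_le _ _).trans (Nat.add_le_add_left (card_union_le _ _) _))
      intro w hw
      have hw1 : w ∈ ({w | loc' w = (d, a)} : Finset W) := by
        simp only [mem_filter, mem_univ, true_and] at hw ⊢
        exact hw.1
      rw [hclass] at hw1
      simp only [mem_filter, mem_univ, true_and] at hw
      simp only [mem_union, mem_filter] at hw1 ⊢
      rcases hw1 with h1 | h1 | h1
      · exact Or.inl ⟨h1, hw.2⟩
      · exact Or.inr (Or.inl ⟨(mem_sdiff.mp h1).1, hw.2⟩)
      · exact Or.inr (Or.inr ⟨(mem_sdiff.mp h1).1, hw.2⟩)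
    have hle' : (#{w | loc' w = (d, a) ∧ Q (run Ls D y w)} : ℝ) ≤ #{w ∈ C d a | Q (run Ls D y w)} +
        (#{w ∈ S (d + 1, 2 * a) | Q (run Ls D y w)} + #{w ∈ S (d + 1, 2 * a + 1) | Q (run Ls D y w)}) := by
      exact_mod_cast hle
    have hδ : (0:ℝ) < (1 / 1024) ^ j := by positivity
    have h8 : (0:ℝ) < 8 ^ d := by positivity
    -- contribution of the parent
    set X : ℝ := 1 / 160 * (1 / 1024) ^ j * (B * 8 ^ d) with hX
    have hX0 : 0 < X := by positivity
    have hCb : (#{w ∈ C d a | Q (run Ls D y w)} : ℝ) ≤ X / 2 := by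
      rcases d with _ | d
      · simp only [hC, if_true, filter_empty, card_empty]
        push_cast
        positivity
      have ha2 : a / 2 < 2 ^ d := half (d + 1) a ha (by omega)
      set i : ℕ × ℕ := (d, a / 2) with hi
      have hdn := aks_down I y hy d (a / 2) (by omega) ha2 (h d) (f d) (hn1 d) (hn2 d) (hn7 d)
        (run (N i) D y) (Cl i) (Cr i) (cCl i ha2) (cCr i ha2) (by
          intro P _ K hK
          exact hsepp i ha2 y P K (by rw [← hK, hS, Finset.filter_filter]))
      obtain ⟨p1, p2, p3⟩ := hdn
      have hCi : C (d + 1) a = if a % 2 = 0 then Cl i else Cr i := by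
        simp [hC, hi]
      have hconv : #{w ∈ C (d + 1) a | Q (run Ls D y w)} = #{w ∈ C (d + 1) a | Q (run (N i) D y w)} := by
        congr 1
        apply Finset.filter_congr
        intro w hw
        rw [hrun y w i]
        simpa using (hCloc _ _ _ hw).1
      rw [hconv]
      have h8' : (0:ℝ) < 8 ^ d := by positivity
      rcases j with _ | j
      · have hkd : k - (d + 1) + 0 = k - d - 1 := by omega
        have hX1 : X = 1 / 20 * (B * 8 ^ d) := by
          rw [hX, pow_succ]; ring
        rw [hCi]
        split_ifs with hpar
        · have : (#{w ∈ Cl i | Q (run (N i) D y w)} : ℝ) ≤ 2 / 100 * (B * 8 ^ d) := by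
            refine le_trans (le_of_eq ?_) p2
            congr 2
            apply Finset.filter_congr
            intro w _
            simp only [hQ]
            rw [hkd, pow_zero, Nat.div_one]
            have : 2 * (a / 2) = a := by omega
            rw [this]
          rw [hX1]
          have : 0 < B * 8 ^ d := by positivity
          linarith
        · have : (#{w ∈ Cr i | Q (run (N i) D y w)} : ℝ) ≤ 2 / 100 * (B * 8 ^ d) := by
            refine le_trans (le_of_eq ?_) p3
            congr 2
            apply Finset.filter_congr
            intro w _
            simp only [hQ]
            rw [hkd, pow_zero, Nat.div_one]
            have : 2 * (a / 2) + 1 = a := by omega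
            rw [this]
          rw [hX1]
          have : 0 < B * 8 ^ d := by positivity
          linarith
      · have hsub : C (d + 1) a ⊆ Cl i ∪ Cr i := by
          rw [hCi]
          split_ifs
          · exact subset_union_left
          · exact subset_union_right
        have h1 : (#{w ∈ C (d + 1) a | Q (run (N i) D y w)} : ℝ) ≤
            1 / 1024 * (1 / 160 * (1 / 1024) ^ j * (B * 8 ^ d)) := by
          refine le_trans ?_ (p1 j)
          have : #{w ∈ C (d + 1) a | Q (run (N i) D y w)} ≤
              #{w ∈ Cl i ∪ Cr i | run (N i) D y w / 2 ^ (k - d + j) ≠ a / 2 / 2 ^ j} := by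
            apply card_le_card
            intro w hw
            simp only [mem_filter] at hw ⊢
            refine ⟨hsub hw.1, ?_⟩
            have h2 := hw.2
            simp only [hQ] at h2
            have e1 : k - (d + 1) + (j + 1) = k - d + j := by omega
            rw [e1] at h2
            rw [Nat.div_div_eq_div_mul, ← pow_succ']
            exact h2
          exact_mod_cast this
        have hX1 : X = 8 * (1 / 1024 * (1 / 160 * (1 / 1024) ^ j * (B * 8 ^ d))) := by
          rw [hX, pow_succ, pow_succ]; ring
        rw [hX1]
        have : 0 < (1 / 1024 * (1 / 160 * (1 / 1024 : ℝ) ^ j * (B * 8 ^ d))) := by positivity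
        linarith
    have hupX : (1 / 160 * (1 / 1024) ^ (j + 1) * (B * 8 ^ (d + 1)) : ℝ) = X / 128 := by
      rw [hX, pow_succ, pow_succ]; ring
    rw [hupX] at hup0 hup1
    have hfin : 1 / 160 * (1 / 1024) ^ j * (9 / 16 * B * 8 ^ d) = 9 / 16 * X := by
      rw [hX]; ring
    rw [hfin]
    linarith


/-! ### Part F: selection sort, finishing AKS -/

namespace AksLayer

variable {W : Type*} {α : Type*} [LinearOrder α]

theorem run_succ' (L : ℕ → AksLayer W) (n : ℕ) (x : W → α) :
    run L (n + 1) x = run (fun t => L (t + 1)) n ((L 0).apply x) := by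
  induction n with
  | zero => rfl
  | succ n ih => rw [run_succ, ih, run_succ]

def lrun (l : List (AksLayer W)) (x : W → α) : W → α := l.foldl (fun y s => s.apply y) x

theorem lrun_append (l m : List (AksLayer W)) (x : W → α) :
    lrun (l ++ m) x = lrun m (lrun l x) := by simp [lrun]

theorem run_getD (l : List (AksLayer W)) (n : ℕ) (hn : l.length ≤ n) (x : W → α) :
    run (fun t => l.getD t (idle W)) n x = lrun l x := by
  induction l generalizing n x with
  | nil => simp [lrun]
  | cons a l ih =>
    obtain ⟨n, rfl⟩ : ∃ m, n = m + 1 := ⟨n - 1, by simp at hn; omega⟩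
    rw [run_succ']
    simp only [List.getD_cons_succ, List.getD_cons_zero]
    rw [ih n (by simpa using hn)]
    simp [lrun]

/-- a single comparator: `u` receives the min, `v` the max -/
def cmp [DecidableEq W] (u v : W) : AksLayer W where
  p := Equiv.swap u v
  inv := fun w => Equiv.swap_apply_self u v w
  lo := fun w => decide (w = u)
  opp := by
    intro w hw
    by_cases h1 : w = u
    · subst h1
      simp at hw ⊢
      exact hw
    · by_cases h2 : w = v
      · subst h2
        simp [h1]
      · exact absurd (Equiv.swap_apply_of_ne_of_ne h1 h2) hw

theorem cmp_apply [DecidableEq W] (u v : W) (x : W → α) (w : W) :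
    (cmp u v).apply x w = if w = u then min (x u) (x v) else if w = v then max (x u) (x v) else x w := by
  simp only [apply, cmp]
  by_cases h1 : w = u
  · subst h1; simp
  · by_cases h2 : w = v
    · subst h2
      simp [h1, max_comm]
    · simp [h1, h2, Equiv.swap_apply_of_ne_of_ne h1 h2]

theorem lrun_perm (l : List (AksLayer W)) (x : W → α) :
    ∃ π : Equiv.Perm W, lrun l x = x ∘ π := by
  obtain ⟨π, h, -⟩ := run_perm (fun t => l.getD t (idle W)) l.length x
  rw [run_getD l _ le_rfl] at h
  exact ⟨π, h⟩

theorem lrun_cmp_fix [DecidableEq W] (l : List (W × W)) (S : Finset W)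
    (hl : ∀ p ∈ l, p.1 ∈ S ∧ p.2 ∈ S) (x : W → α) (w : W) (hw : w ∉ S) :
    lrun (l.map fun p => cmp p.1 p.2) x w = x w := by
  induction l generalizing x with
  | nil => rfl
  | cons a l ih =>
    have h1 := hl a (by simp)
    have := ih (fun p hp => hl p (by simp [hp])) ((cmp a.1 a.2).apply x)
    simp only [lrun, List.map_cons, List.foldl_cons] at this ⊢
    have n1 : w ≠ a.1 := by rintro rfl; exact hw h1.1
    have n2 : w ≠ a.2 := by rintro rfl; exact hw h1.2
    rw [this, cmp_apply, if_neg n1, if_neg n2]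

theorem lrun_cmp_closed [DecidableEq W] (l : List (W × W)) (S : Finset W)
    (hl : ∀ p ∈ l, p.1 ∈ S ∧ p.2 ∈ S) (x : W → α) (M : α) (hx : ∀ w ∈ S, x w ≤ M) :
    ∀ w ∈ S, lrun (l.map fun p => cmp p.1 p.2) x w ≤ M := by
  induction l generalizing x with
  | nil => exact hx
  | cons a l ih =>
    have h1 := hl a (by simp)
    have := ih (fun p hp => hl p (by simp [hp])) ((cmp a.1 a.2).apply x) (by
      intro w hw
      rw [cmp_apply]
      split_ifs
      · exact (min_le_left _ _).trans (hx _ h1.1)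
      · exact max_le (hx _ h1.1) (hx _ h1.2)
      · exact hx w hw)
    simpa only [lrun, List.map_cons, List.foldl_cons] using this

theorem collect [DecidableEq W] (S : Finset W) (m : W) (hm : m ∉ S) :
    ∃ l : List (W × W), l.length = #S ∧ (∀ p ∈ l, p.1 ≠ p.2 ∧ p.1 ∈ insert m S ∧ p.2 ∈ insert m S) ∧
      ∀ x : W → α, ∀ w ∈ S, lrun (l.map fun p => cmp p.1 p.2) x w ≤
        lrun (l.map fun p => cmp p.1 p.2) x m := by
  induction S using Finset.induction_on with
  | empty => exact ⟨[], by simp, by simp, by simp⟩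
  | insert i S hi ih =>
    have hmi : m ≠ i := by rintro rfl; exact hm (mem_insert_self _ _)
    obtain ⟨l, h1, h2, h3⟩ := ih (fun h => hm (mem_insert_of_mem h))
    refine ⟨l ++ [(i, m)], by simp [h1, hi], ?_, ?_⟩
    · intro p hp
      rw [List.mem_append, List.mem_singleton] at hp
      rcases hp with hp | rfl
      · have := h2 p hp
        simp only [mem_insert] at this ⊢
        tauto
      · simp [hmi.symm]
    · intro x w hw
      rw [List.map_append, lrun_append]
      set y := lrun (l.map fun p => cmp p.1 p.2) x
      simp only [lrun, List.map_cons, List.map_nil, List.foldl_cons, List.foldl_nil]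
      rw [cmp_apply, cmp_apply, if_neg hmi, if_pos rfl]
      split_ifs with e1 e2
      · exact (min_le_left _ _).trans (le_max_left _ _)
      · exact le_rfl
      · have hwS : w ∈ S := by
          rw [mem_insert] at hw
          tauto
        exact (h3 x w hwS).trans (le_max_right _ _)

theorem sel_sort [DecidableEq W] (S : Finset W) :
    ∃ l : List (W × W), l.length ≤ #S * #S ∧ (∀ p ∈ l, p.1 ≠ p.2 ∧ p.1 ∈ S ∧ p.2 ∈ S) ∧
      ∃ o : W → ℕ, Set.InjOn o S ∧ (∀ w ∈ S, o w < #S) ∧ ∀ x : W → α, Function.Injective x →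
        ∀ u ∈ S, ∀ v ∈ S, o u < o v → lrun (l.map fun p => cmp p.1 p.2) x u <
          lrun (l.map fun p => cmp p.1 p.2) x v := by
  induction S using Finset.induction_on with
  | empty => exact ⟨[], by simp, by simp, fun _ => 0, by simp, by simp, by simp⟩
  | insert m S hm ih =>
    obtain ⟨l1, h1, h2, h3⟩ := collect (α := α) S m hm
    obtain ⟨l2, g1, g2, o, g3, g4, g5⟩ := ih
    refine ⟨l1 ++ l2, ?_, ?_, fun w => if w = m then #S else o w, ?_, ?_, ?_⟩
    · rw [List.length_append, card_insert_of_notMem hm]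
      nlinarith
    · intro p hp
      rw [List.mem_append] at hp
      rcases hp with hp | hp
      · exact h2 p hp
      · have := g2 p hp
        simp only [mem_insert]
        tauto
    · intro u hu v hv huv
      have hu' : u = m ∨ u ∈ S := by simpa using hu
      have hv' : v = m ∨ v ∈ S := by simpa using hv
      simp only at huv
      split_ifs at huv with e1 e2 e2
      · rw [e1, e2]
      · have := g4 v (hv'.resolve_left e2); omega
      · have := g4 u (hu'.resolve_left e1); omega
      · exact g3 (hu'.resolve_left e1) (hv'.resolve_left e2) huv
    · intro w hw
      rw [mem_insert] at hw
      rw [card_insert_of_notMem hm]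
      simp only
      split_ifs with e1
      · omega
      · have := g4 w (hw.resolve_left e1); omega
    · intro x hx u hu v hv huv
      rw [mem_insert] at hu hv
      rw [List.map_append, lrun_append]
      set y := lrun (l1.map fun p => cmp p.1 p.2) x with hy
      have hyinj : Function.Injective y := by
        obtain ⟨π, hπ⟩ := lrun_perm (l1.map fun p => cmp p.1 p.2) x
        rw [hy, hπ]
        exact hx.comp π.injective
      simp only at huv
      have hum : u ≠ m := by
        rintro rfl
        rw [if_pos rfl] at huv
        split_ifs at huv with e
        · omega
        · have := g4 v (hv.resolve_left e); omega
      rw [if_neg hum] at huv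
      have huS := hu.resolve_left hum
      split_ifs at huv with e
      · subst e
        have hfix := lrun_cmp_fix l2 S (fun p hp => (g2 p hp).2) y v hm
        have hle := lrun_cmp_closed l2 S (fun p hp => (g2 p hp).2) y (y v) (h3 x) u huS
        rw [← hfix] at hle
        refine lt_of_le_of_ne hle ?_
        obtain ⟨π, hπ⟩ := lrun_perm (l2.map fun p => cmp p.1 p.2) y
        rw [hπ]
        intro he
        exact hum ((hyinj.comp π.injective) he)
      · exact g5 y hyinj u huS v (hv.resolve_left e) huv

/-- standardisation of a network -/
theorem standardize [LinearOrder W] (L : ℕ → AksLayer W) :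
    ∃ L' : ℕ → AksLayer W, (∀ t w, (L' t).lo w = decide (w ≤ (L' t).p w)) ∧
      ∀ t (x : W → α) w, run L t x w = run L' t x (run L t (fun w => w) w) := by
  classical
  have hp : ∀ t, ∃ π : Equiv.Perm W, ∀ w, run L t (fun w => w) w = π w := by
    intro t
    obtain ⟨π, h, -⟩ := run_perm L t (fun w : W => w)
    exact ⟨π, fun w => by rw [h]; rfl⟩
  choose π hπ using hp
  refine ⟨fun t =>
    { p := fun w => π t ((L t).p ((π t).symm w))
      inv := fun w => by simp [(L t).inv]
      lo := fun w => decide (w ≤ π t ((L t).p ((π t).symm w)))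
      opp := ?_ }, fun t w => rfl, ?_⟩
  · intro w hw
    simp only [Equiv.symm_apply_apply, (L t).inv, Equiv.apply_symm_apply]
    rw [← decide_not, decide_eq_decide]
    simp only [not_le]
    exact ⟨fun h => lt_of_le_of_ne h hw, fun h => h.le⟩
  · intro t
    induction t with
    | zero => intro x w; rfl
    | succ t ih =>
      intro x w
      rw [run_succ, run_succ, run_succ]
      set L' : ℕ → AksLayer W := fun t =>
        { p := fun w => π t ((L t).p ((π t).symm w))
          inv := fun w => by simp [(L t).inv]
          lo := fun w => decide (w ≤ π t ((L t).p ((π t).symm w)))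
          opp := _ } with hL'
      set y' := run L' t x with hy'
      have e1 : ∀ v, run L t x v = y' (π t v) := fun v => by rw [ih x v, hπ t v]
      have hlo : ∀ v, (L' t).lo v = decide (v ≤ π t ((L t).p ((π t).symm v))) := fun v => rfl
      have hpp : ∀ v, (L' t).p v = π t ((L t).p ((π t).symm v)) := fun v => rfl
      simp only [apply, e1, hπ]
      simp only [hlo, hpp, decide_eq_true_eq]
      rcases le_total (π t w) (π t ((L t).p w)) with h | h <;>
      by_cases hl : (L t).lo w = true
      · simp [hl, h]
      · simp [hl, h]
        split_ifs with h2
        · have : π t ((L t).p w) = π t w := by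
            rw [(L t).inv] at h2
            exact le_antisymm h2 h
          rw [(L t).inv, this]; simp
        · rw [(L t).inv, max_comm]
      · simp [hl, h]
        split_ifs with h2
        · rw [(L t).inv, min_comm]
        · rw [(L t).inv] at h2
          exact absurd h h2
      · simp [hl, h]
        intro h2
        have : π t ((L t).p w) = π t w := le_antisymm h h2
        rw [this]

end AksLayer


/-! ### Part G: the AKS network -/

open AksLayer

theorem aks_iter : ∃ D : ℕ, ∀ k : ℕ, 1 ≤ k → ∀ t : ℕ,
    (∀ s < t, (160 : ℝ) ≤ (9 / 16) ^ s * 2 ^ k * 8 ^ k) →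
    ∃ (L : ℕ → AksLayer (Fin (2 ^ k))) (loc : Fin (2 ^ k) → ℕ × ℕ) (cnt : ℕ → ℕ),
      AksInv k loc cnt t ((9 / 16) ^ t * 2 ^ k)
        (run L (t * D) '' {x | Function.Injective x ∧ ∀ w, x w < 2 ^ k}) := by
  obtain ⟨D, hD⟩ := aks_step
  refine ⟨D, fun k hk t => ?_⟩
  induction t with
  | zero =>
    intro _
    refine ⟨fun _ => idle _, fun _ => (0, 0), fun d => if d = 0 then 2 ^ k else 0, ?_⟩
    have hY : (run (fun _ => idle (Fin (2 ^ k))) (0 * D) ''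
        {x : Fin (2 ^ k) → ℕ | Function.Injective x ∧ ∀ w, x w < 2 ^ k}) =
        {x : Fin (2 ^ k) → ℕ | Function.Injective x ∧ ∀ w, x w < 2 ^ k} := by
      ext x; simp
    rw [hY]
    refine ⟨fun y hy => hy.1, fun y hy => hy.2, by positivity, by simp, by simp, by simp, ?_, ?_, ?_, ?_⟩
    · intro d a ha
      by_cases hd : d = 0
      · subst hd
        have : a = 0 := by simpa using ha
        subst this
        simp
      · simp [hd, Ne.symm hd]
    · intro d
      by_cases hd : d = 0
      · simp [hd]
      · simp only [hd, if_false]; push_cast; positivity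
    · intro d hd
      have : d ≠ 0 := by omega
      simp [this]
    · intro y hy d a j
      have : ({w | ((0, 0) : ℕ × ℕ) = (d, a) ∧ y w / 2 ^ (k - d + j) ≠ a / 2 ^ j} : Finset (Fin (2 ^ k))) = ∅ := by
        rw [Finset.filter_eq_empty_iff]
        rintro w - ⟨h1, h2⟩
        obtain ⟨rfl, rfl⟩ := Prod.mk.inj h1
        apply h2
        rw [Nat.zero_div]
        apply Nat.div_eq_of_lt
        exact lt_of_lt_of_le (hy.2 w) (Nat.pow_le_pow_right (by norm_num) (by omega))
      rw [this]
      simp only [card_empty, Nat.cast_zero]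
      positivity
  | succ t ih =>
    intro h
    obtain ⟨L, loc, cnt, I⟩ := ih (fun s hs => h s (by omega))
    obtain ⟨N, loc', cnt', I'⟩ := hD k _ loc cnt t _ _ I hk (h t (by omega))
    refine ⟨cat L (t * D) N, loc', cnt', ?_⟩
    have e1 : (9 / 16 : ℝ) ^ (t + 1) * 2 ^ k = 9 / 16 * ((9 / 16) ^ t * 2 ^ k) := by ring
    rw [e1]
    have e2 : (run (cat L (t * D) N) ((t + 1) * D) ''
        {x : Fin (2 ^ k) → ℕ | Function.Injective x ∧ ∀ w, x w < 2 ^ k}) =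
        run N D '' (run L (t * D) '' {x | Function.Injective x ∧ ∀ w, x w < 2 ^ k}) := by
      rw [Set.image_image]
      apply Set.image_congr
      intro x _
      rw [add_mul, one_mul, run_cat]
    rw [e2]
    exact I'

theorem aks_rank : ∃ D : ℕ, ∀ k : ℕ, 1 ≤ k → ∃ (L : ℕ → AksLayer (Fin (2 ^ k))) (n : ℕ)
    (ρ : Fin (2 ^ k) → ℕ), n ≤ D * k + 16 ∧ Function.Injective ρ ∧
    ∀ x : Fin (2 ^ k) → ℕ, Function.Injective x → (∀ w, x w < 2 ^ k) →
      ∀ u v, ρ u < ρ v → run L n x u < run L n x v := by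
  obtain ⟨D, hD⟩ := aks_iter
  refine ⟨5 * D, fun k hk => ?_⟩
  have hex : ∃ t, (9 / 16 : ℝ) ^ t * 2 ^ k * 8 ^ k < 160 ∧ t ≤ 5 * k := by
    refine ⟨5 * k, ?_, le_rfl⟩
    rw [pow_mul, ← mul_pow, ← mul_pow]
    calc ((9 / 16 : ℝ) ^ 5 * 2 * 8) ^ k ≤ 1 := pow_le_one₀ (by norm_num) (by norm_num)
      _ < 160 := by norm_num
  classical
  have hT1 := (Nat.find_spec hex).1
  have hT2 := (Nat.find_spec hex).2
  have hT3 : ∀ s < Nat.find hex, (160 : ℝ) ≤ (9 / 16) ^ s * 2 ^ k * 8 ^ k := by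
    intro s hs
    have := Nat.find_min hex hs
    by_contra hc
    exact this ⟨not_le.mp hc, by omega⟩
  obtain ⟨L, loc, cnt, I⟩ := hD k hk _ hT3
  set T := Nat.find hex with hT
  set B : ℝ := (9 / 16) ^ T * 2 ^ k with hB
  have hBpos : 0 < B := by positivity
  have hdge : ∀ w, k - 2 ≤ (loc w).1 := by
    intro w
    by_contra hc
    have h1 := I.card _ _ (I.alt w)
    have h2 : 1 ≤ cnt (loc w).1 := by
      rw [← h1]
      exact Finset.card_pos.mpr ⟨w, by simp⟩
    have h3 := I.cap (loc w).1
    have h4 : (8 : ℝ) ^ (loc w).1 * 512 ≤ 8 ^ k := by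
      have : (8 : ℝ) ^ (loc w).1 * 512 = 8 ^ ((loc w).1 + 3) := by rw [pow_add]; norm_num
      rw [this]
      exact pow_le_pow_right₀ (by norm_num) (by omega)
    have h5 : (1 : ℝ) ≤ cnt (loc w).1 := by exact_mod_cast h2
    nlinarith
  have hns : ∀ x : Fin (2 ^ k) → ℕ, Function.Injective x → (∀ w, x w < 2 ^ k) → ∀ w,
      run L (T * D) x w / 2 ^ (k - (k - 2)) = (loc w).2 / 2 ^ ((loc w).1 - (k - 2)) := by
    intro x hx1 hx2 w
    have h1 := I.str _ ⟨x, ⟨hx1, hx2⟩, rfl⟩ (loc w).1 (loc w).2 0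
    have h2 : run L (T * D) x w / 2 ^ (k - (loc w).1) = (loc w).2 := by
      by_contra hc
      have h3 : 1 ≤ #{v | loc v = ((loc w).1, (loc w).2) ∧
          run L (T * D) x v / 2 ^ (k - (loc w).1 + 0) ≠ (loc w).2 / 2 ^ 0} :=
        Finset.card_pos.mpr ⟨w, by simpa using hc⟩
      have h4 : (8 : ℝ) ^ (loc w).1 ≤ 8 ^ k := pow_le_pow_right₀ (by norm_num) (I.dle w)
      have h5 : (1 : ℝ) ≤ #{v | loc v = ((loc w).1, (loc w).2) ∧
          run L (T * D) x v / 2 ^ (k - (loc w).1 + 0) ≠ (loc w).2 / 2 ^ 0} := by exact_mod_cast h3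
      have h6 : B * (8 : ℝ) ^ (loc w).1 ≤ B * 8 ^ k := by gcongr
      have h7 := h5.trans h1
      rw [pow_zero] at h7
      nlinarith
    rw [← h2, Nat.div_div_eq_div_mul, ← pow_add]
    congr 2
    have := hdge w
    have := I.dle w
    omega
  set g : Fin (2 ^ k) → ℕ := fun w => (loc w).2 / 2 ^ ((loc w).1 - (k - 2)) with hg
  have hinjrun : ∀ x : Fin (2 ^ k) → ℕ, Function.Injective x → Function.Injective (run L (T * D) x) := by
    intro x hx
    obtain ⟨π, h, -⟩ := run_perm L (T * D) x
    rw [h]; exact hx.comp π.injective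
  set S : ℕ → Finset (Fin (2 ^ k)) := fun c => {w | g w = c} with hS
  have hSc : ∀ c, #(S c) ≤ 4 := by
    intro c
    set y := run L (T * D) (fun w : Fin (2 ^ k) => (w : ℕ)) with hy
    have h1 := hns (fun w : Fin (2 ^ k) => (w : ℕ)) Fin.val_injective (fun w => w.2)
    have h2 : (S c).image y ⊆ Ico (c * 2 ^ (k - (k - 2))) (c * 2 ^ (k - (k - 2)) + 2 ^ (k - (k - 2))) := by
      intro v hv
      obtain ⟨w, hw, rfl⟩ := Finset.mem_image.mp hv
      have h3 : g w = c := by simpa [hS] using hw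
      have h4 := h1 w
      rw [← hy] at h4
      change _ = g w at h4
      rw [h3] at h4
      have h5 := Nat.div_add_mod (y w) (2 ^ (k - (k - 2)))
      have h6 := Nat.mod_lt (y w) (show 0 < 2 ^ (k - (k - 2)) by positivity)
      rw [h4, mul_comm] at h5
      rw [mem_Ico]
      omega
    rw [← Finset.card_image_of_injective (S c) (hinjrun _ Fin.val_injective)]
    refine (card_le_card h2).trans ?_
    rw [Nat.card_Ico, Nat.add_sub_cancel_left]
    calc 2 ^ (k - (k - 2)) ≤ 2 ^ 2 := Nat.pow_le_pow_right (by norm_num) (by omega)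
      _ = 4 := by norm_num
  have hsel := fun c => sel_sort (α := ℕ) (S c)
  choose l hl1 hl2 o ho1 ho2 ho3 using hsel
  set M : ℕ → ℕ → AksLayer (Fin (2 ^ k)) :=
    fun c t => ((l c).map fun p => AksLayer.cmp p.1 p.2).getD t (idle _) with hM
  have hMl : ∀ c, LocalOn (M c) (S c) := by
    intro c t w hw
    simp only [hM]
    by_cases ht : t < ((l c).map fun p => AksLayer.cmp p.1 p.2).length
    · rw [List.getD_eq_getElem _ _ ht, List.getElem_map]
      have ht' : t < (l c).length := by simpa using ht
      have h1 := hl2 c ((l c)[t]) (List.getElem_mem _)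
      have n1 : w ≠ (l c)[t].1 := by rintro rfl; exact hw h1.2.1
      have n2 : w ≠ (l c)[t].2 := by rintro rfl; exact hw h1.2.2
      exact Equiv.swap_apply_of_ne_of_ne n1 n2
    · rw [List.getD_eq_default _ _ (by omega)]
      rfl
  have hMc : ∀ i t w, g w = i → g ((M i t).p w) = i := by
    intro i t w hw
    have := (hMl i).closed subset_rfl t w (by simpa [hS] using hw)
    simpa [hS] using this
  refine ⟨cat L (T * D) (par g M hMc), T * D + 16, fun w => g w * 4 + o (g w) w, ?_, ?_, ?_⟩
  · have := Nat.mul_le_mul_right D hT2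
    have e : 5 * k * D = 5 * D * k := by ring
    omega
  · intro u v huv
    simp only at huv
    have h1 := ho2 (g u) u (by simp [hS])
    have h2 := ho2 (g v) v (by simp [hS])
    have h3 := hSc (g u)
    have h4 := hSc (g v)
    have h5 : g u = g v := by omega
    refine ho1 (g u) (by simp [hS]) (by simp [hS, h5]) ?_
    rw [h5] at huv ⊢
    omega
  · intro x hx1 hx2 u v huv
    simp only at huv
    rw [run_cat, run_par, run_par]
    set y := run L (T * D) x with hy
    have hyi := hinjrun x hx1
    have hlen : ∀ c, ((l c).map fun p => AksLayer.cmp p.1 p.2).length ≤ 16 := by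
      intro c
      rw [List.length_map]
      exact (hl1 c).trans (Nat.mul_le_mul (hSc c) (hSc c))
    have h1 := ho2 (g u) u (by simp [hS])
    have h2 := ho2 (g v) v (by simp [hS])
    have h3 := hSc (g u)
    have h4 := hSc (g v)
    by_cases huv' : g u = g v
    · rw [huv'] at huv ⊢
      simp only [hM]
      rw [run_getD _ _ (hlen _)]
      exact ho3 (g v) y hyi u (by simp [hS, huv']) v (by simp [hS]) (by omega)
    · have hlt : g u < g v := by omega
      have hgv : ∀ w, run (M (g w)) 16 y w / 2 ^ (k - (k - 2)) = g w := by
        intro w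
        obtain ⟨π, e1, e2⟩ := run_perm (M (g w)) 16 y
        rw [e1]
        have e3 := e2 (S (g w)) (fun i v hv => (hMl (g w)).closed subset_rfl i v hv) w (by simp [hS])
        have e4 : g (π w) = g w := by simpa [hS] using e3
        rw [← e4]
        exact hns x hx1 hx2 (π w)
      by_contra hc
      have := Nat.div_le_div_right (c := 2 ^ (k - (k - 2))) (not_lt.mp hc)
      rw [hgv, hgv] at this
      omega

theorem aks_sort : ∃ C : ℕ, ∀ k : ℕ, ∃ (L : ℕ → AksLayer (Fin (2 ^ k))) (n : ℕ), n ≤ C * (k + 1) ∧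
    (∀ t w, (L t).lo w = decide (w ≤ (L t).p w)) ∧
    ∀ x : Fin (2 ^ k) → Bool, Monotone (run L n x) := by
  obtain ⟨D, hD⟩ := aks_rank
  refine ⟨D + 16, fun k => ?_⟩
  rcases Nat.eq_zero_or_pos k with rfl | hk
  · refine ⟨fun _ => idle _, 0, by simp, by simp [idle], fun x u v _ => ?_⟩
    have : u = v := by apply Fin.ext; have := u.2; have := v.2; simp only [pow_zero] at *; omega
    rw [this]
  obtain ⟨L, n, ρ, hn, hρ, hs⟩ := hD k hk
  obtain ⟨L', hlo, hL'⟩ := standardize (α := ℕ) L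
  refine ⟨L', n, by nlinarith, hlo, fun x => ?_⟩
  have key : ∀ x : Fin (2 ^ k) → ℕ, Function.Injective x → (∀ w, x w < 2 ^ k) →
      Monotone (run L' n x) := by
    intro x hx1 hx2
    obtain ⟨σ, hσ, -⟩ := run_perm L n (fun w : Fin (2 ^ k) => w)
    have h1 : ∀ w, run L n x w = run L' n x (σ w) := by
      intro w
      rw [hL' n x w, hσ]; rfl
    have h2 : ∀ u v, ρ u < ρ v → σ u < σ v := by
      intro u v huv
      have h3 := hs (fun w => (w : ℕ)) Fin.val_injective (fun w => w.2) u v huv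
      have h4 : run L n (fun w : Fin (2 ^ k) => (w : ℕ)) = fun w => ((σ w : Fin _) : ℕ) := by
        have := run_mono L (g := fun w : Fin (2 ^ k) => (w : ℕ)) (fun a b h => h) n (fun w => w)
        rw [hσ] at this
        exact this.symm
      rw [h4] at h3
      exact h3
    intro a b hab
    rcases eq_or_lt_of_le hab with rfl | hab
    · exact le_rfl
    obtain ⟨u, rfl⟩ := σ.surjective a
    obtain ⟨v, rfl⟩ := σ.surjective b
    have h5 : ρ u < ρ v := by
      by_contra hc
      rcases lt_or_eq_of_le (not_lt.mp hc) with h | h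
      · exact absurd (h2 _ _ h) (not_lt.mpr hab.le)
      · rw [hρ h] at hab; exact lt_irrefl _ hab
    rw [← h1, ← h1]
    exact (hs x hx1 hx2 u v h5).le
  -- reduction of Boolean inputs
  set P : Fin (2 ^ k) → Fin (2 ^ k) → Prop := fun u w => x u < x w ∨ (x u = x w ∧ u < w) with hP
  have hPt : ∀ u v w, P u v → P v w → P u w := by
    rintro u v w (h1 | h1) (h2 | h2)
    · exact Or.inl (h1.trans h2)
    · exact Or.inl (h2.1 ▸ h1)
    · exact Or.inl (h1.1 ▸ h2)
    · exact Or.inr ⟨h1.1.trans h2.1, h1.2.trans h2.2⟩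
  have hPi : ∀ u, ¬ P u u := by rintro u (h | h); exacts [lt_irrefl _ h, lt_irrefl _ h.2]
  have hPtot : ∀ u v, u ≠ v → P u v ∨ P v u := by
    intro u v huv
    rcases lt_trichotomy (x u) (x v) with h | h | h
    · exact Or.inl (Or.inl h)
    · rcases lt_or_gt_of_ne huv with h' | h'
      · exact Or.inl (Or.inr ⟨h, h'⟩)
      · exact Or.inr (Or.inr ⟨h.symm, h'⟩)
    · exact Or.inr (Or.inl h)
  classical
  set x0 : Fin (2 ^ k) → ℕ := fun w => #{u | P u w} with hx0
  have hlt : ∀ u v, P u v → x0 u < x0 v := by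
    intro u v huv
    apply Finset.card_lt_card
    rw [Finset.ssubset_iff_of_subset]
    · exact ⟨u, by simpa using huv, by simpa using hPi u⟩
    · intro w hw
      simp only [mem_filter, mem_univ, true_and] at hw ⊢
      exact hPt _ _ _ hw huv
  have hx0i : Function.Injective x0 := by
    intro u v huv
    by_contra hne
    rcases hPtot u v hne with h | h
    · have := hlt _ _ h; omega
    · have := hlt _ _ h; omega
  have hx0lt : ∀ w, x0 w < 2 ^ k := by
    intro w
    have : x0 w < #(univ : Finset (Fin (2 ^ k))) := by
      apply Finset.card_lt_card
      rw [Finset.ssubset_iff_of_subset (Finset.subset_univ _)]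
      exact ⟨w, by simp, by simpa using hPi w⟩
    simpa using this
  set m := #{u | x u = false} with hm
  have hgm : Monotone (fun v : ℕ => decide (m ≤ v)) := by
    intro a b hab
    by_cases h : m ≤ a
    · simp [h, h.trans hab]
    · simp [h]
  have hgx : (fun v : ℕ => decide (m ≤ v)) ∘ x0 = x := by
    funext w
    simp only [Function.comp]
    rcases hw : x w with _ | _
    · have : x0 w < m := by
        apply Finset.card_lt_card
        rw [Finset.ssubset_iff_of_subset]
        · exact ⟨w, by simpa using hw, by simpa using hPi w⟩
        · intro u hu
          simp only [mem_filter, mem_univ, true_and, hP, hw] at hu ⊢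
          rcases hu with h | h
          · exact absurd h (by simp)
          · exact h.1
      simp [this]
    · have : m ≤ x0 w := by
        apply Finset.card_le_card
        intro u hu
        simp only [mem_filter, mem_univ, true_and, hP, hw] at hu ⊢
        left; rw [hu]; decide
      simp [this]
  rw [← hgx, ← run_mono L' hgm n x0]
  exact hgm.comp (key x0 hx0i hx0lt)


/-! ### Part H: stages as involutions -/

structure GSt (V : Type*) where
  p : V → V
  inv : ∀ v, p (p v) = v
  lo : V → Bool
  opp : ∀ v, p v ≠ v → lo (p v) = !lo v
  dir : V → Bool
  dirp : ∀ v, dir (p v) = dir v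

namespace GSt

variable {V : Type*}

def app {α : Type*} [LinearOrder α] (s : GSt V) (f : V → α) (v : V) : α :=
  if s.dir v then (if s.lo v then min (f v) (f (s.p v)) else max (f v) (f (s.p v))) else f (s.p v)

theorem app_fix (s : GSt V) (f : V → ℕ) (v : V) (h : s.p v = v) : s.app f v = f v := by
  simp [app, h]

theorem app_mono (s : GSt V) {g : ℕ → ℕ} (hg : Monotone g) (f : V → ℕ) :
    g ∘ s.app f = s.app (g ∘ f) := by
  funext v
  simp only [app, Function.comp]
  split_ifs
  · exact hg.map_min
  · exact hg.map_max
  · rfl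

def toLayer (s : GSt V) : AksLayer V where
  p := s.p
  inv := s.inv
  lo := s.lo
  opp := s.opp

theorem app_perm (s : GSt V) (f : V → ℕ) :
    ∃ π : Equiv.Perm V, s.app f = f ∘ π ∧ ∀ v, π v = v ∨ π v = s.p v := by
  obtain ⟨π, h1, h2⟩ := s.toLayer.apply_perm f
  have hd : ∀ v, s.dir (π v) = s.dir v := by
    intro v
    rcases h2 v with h | h
    · rw [h]
    · rw [h]; exact s.dirp v
  have hd' : ∀ v, s.dir (π.symm v) = s.dir v := by
    intro v
    rw [← hd (π.symm v), Equiv.apply_symm_apply]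
  refine ⟨⟨fun v => if s.dir v then π v else s.p v, fun v => if s.dir v then π.symm v else s.p v,
    ?_, ?_⟩, ?_, ?_⟩
  · intro v
    by_cases h : s.dir v
    · simp [h, hd]
    · simp [h, s.dirp, s.inv]
  · intro v
    by_cases h : s.dir v
    · simp [h, hd']
    · simp [h, s.dirp, s.inv]
  · funext v
    have := congrFun h1 v
    simp only [AksLayer.apply, toLayer, Function.comp] at this
    simp only [app, Function.comp, Equiv.coe_fn_mk]
    by_cases h : s.dir v
    · simp only [h, if_true]; exact this
    · simp [h]
  · intro v
    simp only [Equiv.coe_fn_mk]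
    by_cases h : s.dir v
    · simp only [h, if_true]; exact h2 v
    · simp [h]

def run (N : ℕ → GSt V) : ℕ → (V → ℕ) → (V → ℕ)
  | 0, f => f
  | t + 1, f => (N t).app (run N t f)

theorem run_succ (N : ℕ → GSt V) (t : ℕ) (f : V → ℕ) : run N (t + 1) f = (N t).app (run N t f) := rfl

theorem run_mono (N : ℕ → GSt V) {g : ℕ → ℕ} (hg : Monotone g) (t : ℕ) (f : V → ℕ) :
    g ∘ run N t f = run N t (g ∘ f) := by
  induction t with
  | zero => rfl
  | succ t ih => rw [run_succ, app_mono _ hg, ih, run_succ]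

theorem run_perm {I : Type*} (N : ℕ → GSt V) (ι : V → I) (hι : ∀ t v, ι ((N t).p v) = ι v)
    (t : ℕ) (f : V → ℕ) :
    ∃ π : Equiv.Perm V, run N t f = f ∘ π ∧ ∀ v, ι (π v) = ι v := by
  induction t with
  | zero => exact ⟨1, rfl, fun v => rfl⟩
  | succ t ih =>
    obtain ⟨π, h1, h2⟩ := ih
    obtain ⟨π', h3, h4⟩ := (N t).app_perm (run N t f)
    refine ⟨π * π', ?_, ?_⟩
    · rw [run_succ, h3, h1]; rfl
    · intro v
      rw [Equiv.Perm.mul_apply, h2]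
      rcases h4 v with h | h
      · rw [h]
      · rw [h, hι]

def idle (V : Type*) : GSt V where
  p := fun v => v
  inv := fun _ => rfl
  lo := fun _ => true
  opp := fun _ h => absurd rfl h
  dir := fun _ => true
  dirp := fun _ => rfl

theorem idle_app (f : V → ℕ) : (idle V).app f = f := by
  funext v; simp [app, idle]

def AdjOn (G : SimpleGraph V) (s : GSt V) : Prop := ∀ v, s.p v ≠ v → G.Adj v (s.p v)

theorem adjOn_idle (G : SimpleGraph V) : AdjOn G (idle V) := fun _ h => absurd rfl h

open scoped Classical in
theorem toStage [Fintype V] {G : SimpleGraph V} (s : GSt V) (hs : s.AdjOn G) :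
    ∃ S : Stage G, ∀ f, S.apply f = s.app f := by
  have hdis : ∀ v w, s.lo v = true → s.p v ≠ v → s.lo w = true → s.p w ≠ w → v ≠ s.p w := by
    rintro v w h1 h2 h3 h4 rfl
    rw [s.opp w h4, h3] at h1
    simp at h1
  refine ⟨⟨univ.filter fun e : V × V => s.p e.1 = e.2 ∧ s.p e.1 ≠ e.1 ∧ s.lo e.1 = true, ?_,
    fun e => s.dir e.1, ?_⟩, ?_⟩
  · rintro ⟨a, b⟩ h
    simp only [mem_filter, mem_univ, true_and] at h
    obtain ⟨rfl, h2, h3⟩ := h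
    exact hs a h2
  · rintro ⟨a, b⟩ h ⟨a', b'⟩ h' hne
    simp only [mem_filter, mem_univ, true_and] at h h'
    obtain ⟨rfl, h2, h3⟩ := h
    obtain ⟨rfl, h2', h3'⟩ := h'
    have hne' : a ≠ a' := by rintro rfl; exact hne rfl
    refine ⟨hne', hdis _ _ h3 h2 h3' h2', (hdis _ _ h3' h2' h3 h2).symm, ?_⟩
    intro h
    apply hne'
    rw [← s.inv a, ← s.inv a']
    exact congrArg s.p h
  · intro f
    funext v
    unfold Stage.apply
    simp only [mem_filter, mem_univ, true_and]
    split_ifs with h1 d1 h2 d2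
    · obtain ⟨⟨e1, e2, e3⟩, e4⟩ := h1.choose_spec
      rw [e4] at d1
      rw [← e1, e4] at *
      simp [app, d1, e3]
    · obtain ⟨⟨e1, e2, e3⟩, e4⟩ := h1.choose_spec
      rw [e4] at d1
      rw [← e1, e4] at *
      simp [app, d1]
    · obtain ⟨⟨e1, e2, e3⟩, e4⟩ := h2.choose_spec
      set w := h2.choose.1 with hw
      rw [e4] at *
      have e5 : s.lo v = false := by rw [← e1, s.opp w e2, e3]; rfl
      have e6 : s.p v = w := by rw [← e1, s.inv]
      have e7 : s.dir v = true := by rw [← e1, s.dirp, d2]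
      simp [app, e5, e6, e7, max_comm]
    · obtain ⟨⟨e1, e2, e3⟩, e4⟩ := h2.choose_spec
      set w := h2.choose.1 with hw
      rw [e4] at *
      have e6 : s.p v = w := by rw [← e1, s.inv]
      have e7 : s.dir v = false := by rw [← e1, s.dirp]; simpa using d2
      simp [app, e6, e7]
    · have : s.p v = v := by
        by_contra hc
        by_cases hl : s.lo v = true
        · exact h1 ⟨(v, s.p v), ⟨rfl, hc, hl⟩, rfl⟩
        · refine h2 ⟨(s.p v, v), ⟨s.inv v, ?_, ?_⟩, rfl⟩
          · simp only [s.inv]; exact Ne.symm hc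
          · simp only; rw [s.opp v hc]; simpa using hl
      rw [app_fix _ _ _ this]

open scoped Classical in
theorem ofStage {G : SimpleGraph V} (S : Stage G) :
    ∃ s : GSt V, s.AdjOn G ∧ ∀ f, s.app f = S.apply f := by
  have u1 : ∀ e ∈ S.pairs, ∀ e' ∈ S.pairs, e.1 = e'.1 → e = e' := by
    intro e he e' he' h; by_contra hc; exact (S.disj e he e' he' hc).1 h
  have u2 : ∀ e ∈ S.pairs, ∀ e' ∈ S.pairs, e.2 = e'.2 → e = e' := by
    intro e he e' he' h; by_contra hc; exact (S.disj e he e' he' hc).2.2.2 h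
  have u3 : ∀ e ∈ S.pairs, ∀ e' ∈ S.pairs, e.1 ≠ e'.2 := by
    intro e he e' he' h
    by_cases hc : e = e'
    · subst hc; exact (S.adj e he).ne h
    · exact (S.disj e he e' he' hc).2.1 h
  set P1 : V → Prop := fun v => ∃ p, p ∈ S.pairs ∧ p.1 = v with hP1
  set P2 : V → Prop := fun v => ∃ p, p ∈ S.pairs ∧ p.2 = v with hP2
  set pp : V → V := fun v => if h1 : ∃ p, p ∈ S.pairs ∧ p.1 = v then h1.choose.2 else
    if h2 : ∃ p, p ∈ S.pairs ∧ p.2 = v then h2.choose.1 else v with hpp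
  set dd : V → Bool := fun v => if h1 : ∃ p, p ∈ S.pairs ∧ p.1 = v then S.directed h1.choose else
    if h2 : ∃ p, p ∈ S.pairs ∧ p.2 = v then S.directed h2.choose else true with hdd
  have f1 : ∀ e ∈ S.pairs, pp e.1 = e.2 ∧ dd e.1 = S.directed e := by
    intro e he
    have hx : ∃ p, p ∈ S.pairs ∧ p.1 = e.1 := ⟨e, he, rfl⟩
    have : hx.choose = e := u1 _ hx.choose_spec.1 _ he hx.choose_spec.2
    simp only [hpp, hdd]
    rw [dif_pos hx, dif_pos hx, this]; exact ⟨rfl, rfl⟩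
  have f2 : ∀ e ∈ S.pairs, pp e.2 = e.1 ∧ dd e.2 = S.directed e := by
    intro e he
    have hx : ∃ p, p ∈ S.pairs ∧ p.2 = e.2 := ⟨e, he, rfl⟩
    have hn : ¬ ∃ p, p ∈ S.pairs ∧ p.1 = e.2 := by
      rintro ⟨p, hp, h⟩; exact u3 p hp e he h
    have : hx.choose = e := u2 _ hx.choose_spec.1 _ he hx.choose_spec.2
    simp only [hpp, hdd]
    rw [dif_neg hn, dif_pos hx, dif_neg hn, dif_pos hx, this]; exact ⟨rfl, rfl⟩
  have f3 : ∀ v, ¬ P1 v → ¬ P2 v → pp v = v := by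
    intro v h1 h2
    simp only [hpp]
    rw [dif_neg h1, dif_neg h2]
  have tri : ∀ v, (∃ e ∈ S.pairs, v = e.1) ∨ (∃ e ∈ S.pairs, v = e.2) ∨ (¬ P1 v ∧ ¬ P2 v) := by
    intro v
    by_cases h1 : P1 v
    · obtain ⟨e, he, h⟩ := h1; exact Or.inl ⟨e, he, h.symm⟩
    by_cases h2 : P2 v
    · obtain ⟨e, he, h⟩ := h2; exact Or.inr (Or.inl ⟨e, he, h.symm⟩)
    exact Or.inr (Or.inr ⟨h1, h2⟩)
  have l1 : ∀ e ∈ S.pairs, decide (P1 e.1) = true := fun e he => by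
    rw [decide_eq_true_eq]; exact ⟨e, he, rfl⟩
  have l2 : ∀ e ∈ S.pairs, decide (P1 e.2) = false := fun e he => by
    rw [decide_eq_false_iff_not]; rintro ⟨p, hp, h⟩; exact u3 p hp e he h
  refine ⟨⟨pp, ?_, fun v => decide (P1 v), ?_, dd, ?_⟩, ?_, ?_⟩
  · intro v
    rcases tri v with ⟨e, he, rfl⟩ | ⟨e, he, rfl⟩ | ⟨h1, h2⟩
    · rw [(f1 e he).1, (f2 e he).1]
    · rw [(f2 e he).1, (f1 e he).1]
    · rw [f3 v h1 h2, f3 v h1 h2]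
  · intro v hv
    rcases tri v with ⟨e, he, rfl⟩ | ⟨e, he, rfl⟩ | ⟨h1, h2⟩
    · rw [(f1 e he).1, l1 e he, l2 e he]; rfl
    · rw [(f2 e he).1, l1 e he, l2 e he]; rfl
    · exact absurd (f3 v h1 h2) hv
  · intro v
    rcases tri v with ⟨e, he, rfl⟩ | ⟨e, he, rfl⟩ | ⟨h1, h2⟩
    · rw [(f1 e he).1, (f1 e he).2, (f2 e he).2]
    · rw [(f2 e he).1, (f1 e he).2, (f2 e he).2]
    · rw [f3 v h1 h2]
  · intro v hv
    simp only at hv ⊢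
    rcases tri v with ⟨e, he, rfl⟩ | ⟨e, he, rfl⟩ | ⟨h1, h2⟩
    · rw [(f1 e he).1]; exact S.adj e he
    · rw [(f2 e he).1]; exact (S.adj e he).symm
    · exact absurd (f3 v h1 h2) hv
  · intro f
    funext v
    simp only [app]
    rcases tri v with ⟨e, he, rfl⟩ | ⟨e, he, rfl⟩ | ⟨h1, h2⟩
    · rw [l1 e he, (f1 e he).1, (f1 e he).2]
      have hx : ∃ p, p ∈ S.pairs ∧ p.1 = e.1 := ⟨e, he, rfl⟩
      have : hx.choose = e := u1 _ hx.choose_spec.1 _ he hx.choose_spec.2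
      unfold Stage.apply
      rw [dif_pos hx, this]
      simp
    · rw [l2 e he, (f2 e he).1, (f2 e he).2]
      have hx : ∃ p, p ∈ S.pairs ∧ p.2 = e.2 := ⟨e, he, rfl⟩
      have hn : ¬ ∃ p, p ∈ S.pairs ∧ p.1 = e.2 := by
        rintro ⟨p, hp, h⟩; exact u3 p hp e he h
      have : hx.choose = e := u2 _ hx.choose_spec.1 _ he hx.choose_spec.2
      unfold Stage.apply
      rw [dif_neg hn, dif_pos hx, this]
      simp [max_comm]
    · rw [f3 v h1 h2]
      unfold Stage.apply
      rw [dif_neg h1, dif_neg h2]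
      simp

theorem toNetwork [Fintype V] {G : SimpleGraph V} (N : ℕ → GSt V) (T : ℕ)
    (hN : ∀ t < T, (N t).AdjOn G) :
    ∃ L : List (Stage G), L.length = T ∧ ∀ f, runNetwork L f = run N T f := by
  induction T with
  | zero => exact ⟨[], rfl, fun f => rfl⟩
  | succ T ih =>
    obtain ⟨L, h1, h2⟩ := ih (fun t ht => hN t (by omega))
    obtain ⟨S, hS⟩ := toStage (N T) (hN T (by omega))
    refine ⟨L ++ [S], by simp [h1], fun f => ?_⟩
    have := h2 f
    simp only [runNetwork] at this
    simp only [runNetwork, List.foldl_append, List.foldl_cons, List.foldl_nil, this, hS, run_succ]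

theorem ofNetwork {G : SimpleGraph V} (L : List (Stage G)) :
    ∃ N : ℕ → GSt V, (∀ t, (N t).AdjOn G) ∧ ∀ T, L.length ≤ T → ∀ f, run N T f = runNetwork L f := by
  induction L using List.reverseRecOn with
  | nil =>
    refine ⟨fun _ => idle V, fun _ => adjOn_idle G, fun T _ f => ?_⟩
    induction T with
    | zero => rfl
    | succ T ih => rw [run_succ, ih (by simp), idle_app]
  | append_singleton L S ih =>
    obtain ⟨N, h1, h2⟩ := ih
    obtain ⟨s, h3, h4⟩ := ofStage S
    refine ⟨fun t => if t < L.length then N t else if t = L.length then s else idle V, ?_, ?_⟩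
    · intro t
      simp only
      split_ifs
      · exact h1 t
      · exact h3
      · exact adjOn_idle G
    · set N' : ℕ → GSt V := fun t => if t < L.length then N t else if t = L.length then s else idle V with hN'
      have k1 : ∀ T ≤ L.length, ∀ f, run N' T f = run N T f := by
        intro T hT f
        induction T with
        | zero => rfl
        | succ T ih =>
          rw [run_succ, run_succ, ih (by omega)]
          simp only [hN']
          rw [if_pos (by omega)]
      intro T hT f
      rw [List.length_append, List.length_singleton] at hT
      induction T, hT using Nat.le_induction with
      | base =>
        rw [run_succ, k1 _ le_rfl, h2 _ le_rfl]
        simp only [hN', lt_irrefl, if_true, if_false, h4]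
        simp [runNetwork]
      | succ T hT ih =>
        rw [run_succ, ih]
        simp only [hN']
        rw [if_neg (by omega), if_neg (by omega), idle_app]

end GSt

theorem runNetwork_append {V : Type*} {G : SimpleGraph V} (L M : List (Stage G)) (f : V → ℕ) :
    runNetwork (L ++ M) f = runNetwork M (runNetwork L f) := by
  simp [runNetwork]


/-! ### Part I: routing and existence of sorting networks -/

section Routing

variable {V : Type*} [Fintype V] [DecidableEq V] {G : SimpleGraph V}

theorem RoutesIn.comp {σ τ : Equiv.Perm V} {s t : ℕ} (h1 : RoutesIn G σ s) (h2 : RoutesIn G τ t) :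
    RoutesIn G (τ * σ) (s + t) := by
  obtain ⟨L, a1, a2, a3⟩ := h1
  obtain ⟨M, b1, b2, b3⟩ := h2
  refine ⟨L ++ M, by simp [a1, b1], ?_, ?_⟩
  · intro τ hτ
    rw [List.mem_append] at hτ
    exact hτ.elim (a2 τ) (b2 τ)
  · intro v
    have := a3 v
    unfold finalPos at this ⊢
    rw [List.foldl_append, this]
    exact b3 (σ v)

theorem routesIn_swap {a b : V} (h : G.Adj a b) : RoutesIn G (Equiv.swap a b) 1 := by
  refine ⟨[Equiv.swap a b], rfl, ?_, fun v => rfl⟩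
  intro τ hτ
  rw [List.mem_singleton] at hτ
  subst hτ
  refine ⟨fun v => by simp, fun v hv => ?_⟩
  by_cases h1 : v = a
  · subst h1; simpa using h
  · by_cases h2 : v = b
    · subst h2; simpa using h.symm
    · exact absurd (Equiv.swap_apply_of_ne_of_ne h1 h2) hv

theorem routable (hG : G.Connected) (σ : Equiv.Perm V) : ∃ t, RoutesIn G σ t := by
  set S : Set (Equiv.Perm V) := {τ | ∃ a b, G.Adj a b ∧ τ = Equiv.swap a b} with hS
  have hS1 : ∀ τ ∈ S, τ.IsSwap := by
    rintro τ ⟨a, b, h, rfl⟩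
    exact ⟨a, b, h.ne, rfl⟩
  have htr : MulAction.IsPretransitive (Subgroup.closure S) V := by
    constructor
    intro x y
    obtain ⟨w⟩ := hG.preconnected x y
    induction w with
    | nil => exact ⟨1, by simp⟩
    | @cons a b c h w ih =>
      obtain ⟨g, hg⟩ := ih
      refine ⟨g * ⟨Equiv.swap a b, Subgroup.subset_closure ⟨a, b, h, rfl⟩⟩, ?_⟩
      rw [mul_smul]
      have : (⟨Equiv.swap a b, Subgroup.subset_closure ⟨a, b, h, rfl⟩⟩ : Subgroup.closure S) • a = b := by
        change Equiv.swap a b a = b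
        simp
      rw [this, hg]
  have htop := closure_of_isSwap_of_isPretransitive hS1
  have hσ : σ ∈ Subgroup.closure S := by rw [htop]; trivial
  induction hσ using Subgroup.closure_induction with
  | mem τ h =>
    obtain ⟨a, b, h, rfl⟩ := h
    exact ⟨1, routesIn_swap h⟩
  | one => exact ⟨0, [], rfl, by simp, fun v => rfl⟩
  | mul x y _ _ hx hy =>
    obtain ⟨s, hs⟩ := hx
    obtain ⟨t, ht⟩ := hy
    exact ⟨t + s, ht.comp hs⟩
  | inv x _ hx =>
    obtain ⟨s, L, h1, h2, h3⟩ := hx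
    refine ⟨s, L.reverse, by simpa using h1, fun τ hτ => h2 τ (by simpa using hτ), ?_⟩
    have key : ∀ (L : List (Equiv.Perm V)), (∀ τ ∈ L, IsMatchingStep G τ) → ∀ v,
        finalPos L.reverse (finalPos L v) = v := by
      intro L
      induction L with
      | nil => intro _ v; rfl
      | cons τ L ih =>
        intro hL v
        have := ih (fun τ' h => hL τ' (by simp [h])) (τ v)
        simp only [finalPos, List.reverse_cons, List.foldl_append, List.foldl_cons, List.foldl_nil] at this ⊢
        rw [this]
        exact (hL τ (by simp)).1 v
    intro v
    have := key L h2 (x⁻¹ v)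
    rw [h3, show x (x⁻¹ v) = v from x.apply_symm_apply v] at this
    exact this

theorem exists_route_rt (hG : G.Connected) (σ : Equiv.Perm V) :
    ∃ L : List (Equiv.Perm V), L.length ≤ rt G ∧ (∀ τ ∈ L, IsMatchingStep G τ) ∧
    ∀ v, finalPos L v = σ v := by
  have h : RoutesIn G σ (rtP G σ) := Nat.sInf_mem (s := {t | RoutesIn G σ t}) (routable hG σ)
  obtain ⟨L, h1, h2⟩ := h
  refine ⟨L, ?_, h2⟩
  rw [h1]
  exact Finset.le_sup (f := fun σ : Equiv.Perm V => rtP G σ) (mem_univ σ)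

theorem swap_stage [LinearOrder V] (τ : Equiv.Perm V) (hτ : IsMatchingStep G τ) :
    ∃ S : Stage G, ∀ f v, S.apply f (τ v) = f v := by
  obtain ⟨S, hS⟩ := GSt.toStage (G := G)
    { p := τ, inv := hτ.1, lo := fun v => decide (v < τ v)
      opp := by
        intro v hv
        rw [hτ.1, ← decide_not, decide_eq_decide, not_lt]
        exact ⟨fun h => h.le, fun h => lt_of_le_of_ne h hv⟩
      dir := fun _ => false, dirp := fun _ => rfl } hτ.2
  refine ⟨S, fun f v => ?_⟩
  rw [hS]
  simp [GSt.app, hτ.1]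

theorem route_network [LinearOrder V] (L : List (Equiv.Perm V)) (hL : ∀ τ ∈ L, IsMatchingStep G τ) :
    ∃ M : List (Stage G), M.length = L.length ∧ ∀ f v, runNetwork M f (finalPos L v) = f v := by
  induction L with
  | nil => exact ⟨[], rfl, fun f v => rfl⟩
  | cons τ L ih =>
    obtain ⟨M, h1, h2⟩ := ih (fun τ' h => hL τ' (by simp [h]))
    obtain ⟨S, hS⟩ := swap_stage τ (hL τ (by simp))
    refine ⟨S :: M, by simp [h1], fun f v => ?_⟩
    have := h2 (S.apply f) (τ v)
    simp only [runNetwork, finalPos, List.foldl_cons] at this ⊢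
    rw [this, hS]

theorem route_rt [LinearOrder V] (hG : G.Connected) (σ : Equiv.Perm V) :
    ∃ M : List (Stage G), M.length ≤ rt G ∧ ∀ f v, runNetwork M f (σ v) = f v := by
  obtain ⟨L, h1, h2, h3⟩ := exists_route_rt hG σ
  obtain ⟨M, h4, h5⟩ := route_network L h2
  exact ⟨M, by omega, fun f v => by rw [← h3]; exact h5 f v⟩

theorem cmp_network [LinearOrder V] (hG : G.Connected) (u v : V) (huv : u ≠ v) :
    ∃ M : List (Stage G), ∀ f : V → ℕ, runNetwork M f = (AksLayer.cmp u v).apply f := by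
  have hnt : Nontrivial V := ⟨u, v, huv⟩
  obtain ⟨b, hb⟩ := hG.preconnected.exists_adj_of_nontrivial u
  -- route v to b
  set σ : Equiv.Perm V := Equiv.swap v b with hσ
  have hσu : σ u = u := Equiv.swap_apply_of_ne_of_ne huv hb.ne
  have hσv : σ v = b := by simp [hσ]
  obtain ⟨M, -, hM⟩ := route_rt hG σ
  obtain ⟨S, hS⟩ := GSt.toStage (G := G)
    { p := Equiv.swap u b, inv := fun v => by simp, lo := fun w => decide (w = u)
      opp := by
        intro w hw
        by_cases h1 : w = u
        · subst h1; simp [hb.ne']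
        · by_cases h2 : w = b
          · subst h2; simp [h1]
          · exact absurd (Equiv.swap_apply_of_ne_of_ne h1 h2) hw
      dir := fun _ => true, dirp := fun _ => rfl } (by
        intro w hw
        by_cases h1 : w = u
        · subst h1; simpa using hb
        · by_cases h2 : w = b
          · subst h2; simpa using hb.symm
          · exact absurd (Equiv.swap_apply_of_ne_of_ne h1 h2) hw)
  refine ⟨M ++ [S] ++ M, fun f => ?_⟩
  funext w
  rw [runNetwork_append, runNetwork_append]
  have hinv : ∀ w, σ (σ w) = w := fun w => by simp [hσ]
  rw [← hinv w, hM]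
  have e1 : runNetwork [S] (runNetwork M f) = S.apply (runNetwork M f) := rfl
  rw [e1, hS, hinv]
  have e2 : ∀ w, runNetwork M f w = f (σ w) := fun w => by
    conv_lhs => rw [← hinv w, hM]
  simp only [GSt.app, e2, hinv, if_true]
  rw [AksLayer.cmp_apply]
  by_cases h1 : w = u
  · subst h1
    simp [hσu]
    rw [← hσv, hinv]
  · have h1' : σ w ≠ u := by
      intro h; apply h1; rw [← hinv w, h, hσu]
    by_cases h2 : w = v
    · subst h2
      simp [h1, hσv, hb.ne', hσu, max_comm]
    · have h2' : σ w ≠ b := by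
        intro h; apply h2; rw [← hinv w, h, ← hσv, hinv]
      simp [h1, h2, h1', Equiv.swap_apply_of_ne_of_ne h1' h2', hinv]

theorem st_attained [LinearOrder V] (hG : G.Connected) :
    ∃ π : V ≃ Fin (Fintype.card V), ∃ L : List (Stage G),
      L.length = st G ∧ IsSortingNetwork G π L := by
  have : st G ∈ {t | ∃ π : V ≃ Fin (Fintype.card V), ∃ L : List (Stage G),
    L.length = t ∧ IsSortingNetwork G π L} := by
    apply Nat.sInf_mem
    obtain ⟨l, -, hl, o, ho1, ho2, ho3⟩ := AksLayer.sel_sort (α := ℕ) (univ : Finset V)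
    have hnet : ∃ M : List (Stage G), ∀ f : V → ℕ,
        runNetwork M f = AksLayer.lrun (l.map fun p => AksLayer.cmp p.1 p.2) f := by
      clear ho3
      induction l with
      | nil => exact ⟨[], fun f => rfl⟩
      | cons a l ih =>
        obtain ⟨M, hM⟩ := ih (fun p hp => hl p (by simp [hp]))
        obtain ⟨M', hM'⟩ := cmp_network hG a.1 a.2 (hl a (by simp)).1
        refine ⟨M' ++ M, fun f => ?_⟩
        rw [runNetwork_append, hM', hM]
        simp [AksLayer.lrun]
    obtain ⟨M, hM⟩ := hnet
    have hbij : Function.Bijective (fun v : V => (⟨o v, by simpa using ho2 v (mem_univ v)⟩ : Fin (Fintype.card V))) := by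
      rw [Fintype.bijective_iff_injective_and_card]
      refine ⟨fun a b h => ?_, by simp⟩
      exact ho1 (by simp) (by simp) (congrArg Fin.val h)
    refine ⟨M.length, Equiv.ofBijective _ hbij, M, rfl, ?_⟩
    intro f hf u w huw
    rw [hM]
    exact ho3 f hf u (mem_univ _) w (mem_univ _) (by simpa [Fin.lt_def] using huw)
  exact this

end Routing


/-! ### Part J: sorting disjoint sets using slots -/

def SlotCap {n : ℕ} (G : SimpleGraph (Fin n)) (K : ℕ) (S : Fin K → Finset (Fin n)) (T : ℕ) : Prop :=
  ∀ A : Fin K → Finset (Fin n), (∀ k, A k ⊆ S k) → ∃ L : List (Stage G), L.length ≤ T ∧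
    ∃ (γ : Equiv.Perm (Fin n)) (ρ : Fin n → ℕ), (∀ k, Set.InjOn ρ (A k)) ∧
    ∀ f : Fin n → ℕ, Function.Injective f → ∃ π : Equiv.Perm (Fin n),
      (∀ v, runNetwork L f (γ v) = f (π v)) ∧ (∀ k, ∀ v ∈ A k, π v ∈ A k) ∧
      (∀ v, (∀ k, v ∉ A k) → π v = v) ∧
      ∀ k, ∀ u ∈ A k, ∀ v ∈ A k, ρ u < ρ v → runNetwork L f (γ u) < runNetwork L f (γ v)

theorem ord_match {α β : Type*} (S : Finset α) (T : Finset β) (h : #S = #T)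
    (r : α → ℕ) (hr : Set.InjOn r S) (ρ : β → ℕ) (hρ : Set.InjOn ρ T) [Nonempty β] :
    ∃ φ : α → β, (∀ a ∈ S, φ a ∈ T) ∧ ∀ a ∈ S, ∀ b ∈ S, r a < r b → ρ (φ a) < ρ (φ b) := by
  classical
  have h1 : #(S.image r) = #S := Finset.card_image_of_injOn hr
  have h2 : #(T.image ρ) = #S := by rw [h]; exact Finset.card_image_of_injOn hρ
  set e1 := (S.image r).orderIsoOfFin h1
  set e2 := (T.image ρ).orderIsoOfFin h2
  have key : ∀ a : α, ∃ b : β, ∀ ha : a ∈ S, b ∈ T ∧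
      ρ b = e2 (e1.symm ⟨r a, Finset.mem_image_of_mem r ha⟩) := by
    intro a
    by_cases ha : a ∈ S
    · have := (e2 (e1.symm ⟨r a, Finset.mem_image_of_mem r ha⟩)).2
      obtain ⟨b, hb, hb'⟩ := Finset.mem_image.mp this
      exact ⟨b, fun _ => ⟨hb, hb'⟩⟩
    · exact ⟨Classical.arbitrary β, fun h => absurd h ha⟩
  choose φ hφ using key
  refine ⟨φ, fun a ha => (hφ a ha).1, fun a ha b hb hab => ?_⟩
  rw [(hφ a ha).2, (hφ b hb).2]
  have : e2 (e1.symm ⟨r a, Finset.mem_image_of_mem r ha⟩) <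
      e2 (e1.symm ⟨r b, Finset.mem_image_of_mem r hb⟩) := by
    rw [e2.lt_iff_lt, e1.symm.lt_iff_lt]
    exact hab
  exact this

theorem sort_sets {n : ℕ} {G : SimpleGraph (Fin n)} (hG : G.Connected) {K T m : ℕ}
    {S : Fin K → Finset (Fin n)} (hS : SlotCap G K S T)
    (hSd : ∀ i j, i ≠ j → Disjoint (S i) (S j)) (hSm : ∀ k, m ≤ #(S k))
    (Q : Fin K → Finset (Fin n)) (hQd : ∀ i j, i ≠ j → Disjoint (Q i) (Q j))
    (hQm : ∀ k, #(Q k) ≤ m) :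
    ∃ L : List (Stage G), L.length ≤ 2 * rt G + T ∧ ∀ f : Fin n → ℕ, Function.Injective f →
      ∃ π : Equiv.Perm (Fin n), runNetwork L f = f ∘ π ∧ (∀ k, ∀ v ∈ Q k, π v ∈ Q k) ∧
      (∀ v, (∀ k, v ∉ Q k) → π v = v) ∧
      ∀ k, ∀ u ∈ Q k, ∀ v ∈ Q k, u < v → runNetwork L f u < runNetwork L f v := by
  classical
  haveI : Nonempty (Fin n) := hG.nonempty
  have hA : ∀ k, ∃ A ⊆ S k, #A = #(Q k) := fun k =>
    Finset.exists_subset_card_eq ((hQm k).trans (hSm k))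
  choose A hAS hAc using hA
  obtain ⟨L, hL, γ, ρ, hρ, hrun⟩ := hS A hAS
  have hφ := fun k => ord_match (Q k) (A k) (hAc k).symm (fun v : Fin n => (v : ℕ))
    (Fin.val_injective.injOn) ρ (hρ k)
  choose φ hφ1 hφ2 using hφ
  have hAd : ∀ i j, ∀ v, v ∈ A i → v ∈ A j → i = j := by
    intro i j v h1 h2
    by_contra hne
    exact (Finset.disjoint_left.mp (hSd i j hne) (hAS i h1)) (hAS j h2)
  have hQd' : ∀ i j, ∀ v, v ∈ Q i → v ∈ Q j → i = j := by
    intro i j v h1 h2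
    by_contra hne
    exact (Finset.disjoint_left.mp (hQd i j hne) h1) h2
  have hφi : ∀ k, ∀ u ∈ Q k, ∀ v ∈ Q k, φ k u = φ k v → u = v := by
    intro k u hu v hv huv
    rcases lt_trichotomy u v with h | h | h
    · have := hφ2 k u hu v hv h; rw [huv] at this; exact absurd this (lt_irrefl _)
    · exact h
    · have := hφ2 k v hv u hu h; rw [huv] at this; exact absurd this (lt_irrefl _)
  have hτ : ∃ τ : Equiv.Perm (Fin n), ∀ k, ∀ v ∈ Q k, τ v = φ k v := by
    set F : Fin n → Fin n := fun v => if h : ∃ k, v ∈ Q k then φ h.choose v else v with hF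
    have hFk : ∀ k, ∀ v ∈ Q k, F v = φ k v := by
      intro k v hv
      have hx : ∃ k, v ∈ Q k := ⟨k, hv⟩
      simp only [hF]
      rw [dif_pos hx, hQd' _ _ v hx.choose_spec hv]
    obtain ⟨g, hg⟩ := Finset.exists_equiv_extend_of_card_eq (α := Fin n) (t := (univ : Finset (Fin n)))
      (by simp) (s := univ.biUnion Q) (f := F) (Finset.subset_univ _) (by
        intro u hu v hv huv
        simp only [coe_biUnion, Set.mem_iUnion, mem_coe, mem_univ, exists_prop, true_and] at hu hv
        obtain ⟨k, hk⟩ := hu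
        obtain ⟨l, hl⟩ := hv
        rw [hFk k u hk, hFk l v hl] at huv
        have h1 := hφ1 k u hk
        rw [huv] at h1
        have := hAd _ _ _ h1 (hφ1 l v hl)
        subst this
        exact hφi k u hk v hl huv)
    refine ⟨g.trans (Equiv.subtypeUnivEquiv (fun x => mem_univ x)), fun k v hv => ?_⟩
    have := hg v (by simp only [mem_biUnion, mem_univ, true_and]; exact ⟨k, hv⟩)
    rw [← hFk k v hv, ← this]
    rfl
  obtain ⟨τ, hτ⟩ := hτ
  have hτQ : ∀ k v, v ∈ Q k → τ v ∈ A k := fun k v hv => by rw [hτ k v hv]; exact hφ1 k v hv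
  have hτA : ∀ k v, τ v ∈ A k → v ∈ Q k := by
    intro k v hv
    have h1 : (Q k).image τ = A k := by
      apply Finset.eq_of_subset_of_card_le
      · intro w hw
        obtain ⟨u, hu, rfl⟩ := Finset.mem_image.mp hw
        exact hτQ k u hu
      · rw [Finset.card_image_of_injective _ τ.injective, hAc]
    rw [← h1] at hv
    obtain ⟨u, hu, h⟩ := Finset.mem_image.mp hv
    rwa [← τ.injective h]
  obtain ⟨M1, hM1, hM1'⟩ := route_rt hG τ
  obtain ⟨M2, hM2, hM2'⟩ := route_rt hG (τ⁻¹ * γ⁻¹)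
  refine ⟨M1 ++ L ++ M2, by simp only [List.length_append]; omega, fun f hf => ?_⟩
  set f1 := runNetwork M1 f with hf1
  have hf1' : ∀ v, f1 v = f (τ⁻¹ v) := by
    intro v
    have := hM1' f (τ⁻¹ v)
    rw [show τ (τ⁻¹ v) = v from τ.apply_symm_apply v] at this
    exact this
  have hf1i : Function.Injective f1 := by
    intro a b hab
    rw [hf1', hf1'] at hab
    exact τ⁻¹.injective (hf hab)
  obtain ⟨π, p1, p2, p3, p4⟩ := hrun f1 hf1i
  have hfin : ∀ v, runNetwork (M1 ++ L ++ M2) f v = runNetwork L f1 (γ (τ v)) := by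
    intro v
    rw [runNetwork_append, runNetwork_append]
    have := hM2' (runNetwork L f1) (γ (τ v))
    rw [show (τ⁻¹ * γ⁻¹) (γ (τ v)) = v by simp [Equiv.Perm.mul_apply]] at this
    exact this
  refine ⟨τ⁻¹ * π * τ, ?_, ?_, ?_, ?_⟩
  · funext v
    rw [hfin, p1, hf1']; rfl
  · intro k v hv
    apply hτA
    simp only [Equiv.Perm.mul_apply]
    rw [show τ (τ⁻¹ (π (τ v))) = π (τ v) from τ.apply_symm_apply _]
    exact p2 k _ (hτQ k v hv)
  · intro v hv
    simp only [Equiv.Perm.mul_apply]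
    rw [p3 (τ v) (fun k hk => hv k (hτA k v hk))]
    exact τ.symm_apply_apply v
  · intro k u hu v hv huv
    rw [hfin, hfin]
    apply p4 k _ (hτQ k u hu) _ (hτQ k v hv)
    rw [hτ k u hu, hτ k v hv]
    exact hφ2 k u hu v hv huv

theorem sort_classes {n : ℕ} {G : SimpleGraph (Fin n)} (hG : G.Connected) {K T m : ℕ} (hK : 0 < K)
    {S : Fin K → Finset (Fin n)} (hS : SlotCap G K S T)
    (hSd : ∀ i j, i ≠ j → Disjoint (S i) (S j)) (hSm : ∀ k, m ≤ #(S k))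
    (cls : Fin n → ℕ) (R : ℕ) (hcls : ∀ v, cls v < R * K) (hm : ∀ c, #{v | cls v = c} ≤ m) :
    ∃ L : List (Stage G), L.length ≤ R * (2 * rt G + T) ∧ ∀ f : Fin n → ℕ, Function.Injective f →
      ∃ π : Equiv.Perm (Fin n), runNetwork L f = f ∘ π ∧ (∀ v, cls (π v) = cls v) ∧
      ∀ u v, cls u = cls v → u < v → runNetwork L f u < runNetwork L f v := by
  have key : ∀ r : ℕ, ∃ L : List (Stage G), L.length ≤ r * (2 * rt G + T) ∧
      ∀ f : Fin n → ℕ, Function.Injective f →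
      ∃ π : Equiv.Perm (Fin n), runNetwork L f = f ∘ π ∧ (∀ v, cls (π v) = cls v) ∧
      ∀ u v, cls u = cls v → cls v < r * K → u < v → runNetwork L f u < runNetwork L f v := by
    intro r
    induction r with
    | zero => exact ⟨[], by simp, fun f hf => ⟨1, rfl, fun v => rfl, fun u v _ h => by omega⟩⟩
    | succ r ih =>
      obtain ⟨L, hL, h⟩ := ih
      obtain ⟨M, hM, hM'⟩ := sort_sets hG hS hSd hSm
        (fun k : Fin K => ({v | cls v = r * K + k} : Finset (Fin n))) (by
          intro i j hij
          rw [Finset.disjoint_left]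
          intro v hi hj
          simp only [mem_filter, mem_univ, true_and] at hi hj
          apply hij; apply Fin.ext; omega) (fun k => hm _)
      refine ⟨L ++ M, by rw [List.length_append, add_mul, one_mul]; omega, fun f hf => ?_⟩
      obtain ⟨π, h1, h2, h3⟩ := h f hf
      set f1 := runNetwork L f with hf1
      have hf1i : Function.Injective f1 := by rw [h1]; exact hf.comp π.injective
      obtain ⟨π', p1, p2, p3, p4⟩ := hM' f1 hf1i
      have hfix : ∀ v, (¬ (r * K ≤ cls v ∧ cls v < (r + 1) * K)) → π' v = v := by
        intro v hv
        apply p3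
        intro k hk
        simp only [mem_filter, mem_univ, true_and] at hk
        apply hv
        have := k.2
        rw [add_mul, one_mul]; omega
      rw [runNetwork_append, ← hf1]
      refine ⟨π * π', ?_, ?_, ?_⟩
      · rw [p1, h1]; rfl
      · intro v
        rw [Equiv.Perm.mul_apply, h2]
        by_cases hv : r * K ≤ cls v ∧ cls v < (r + 1) * K
        · have hlt : cls v - r * K < K := by rw [add_mul, one_mul] at hv; omega
          have := p2 ⟨cls v - r * K, hlt⟩ v (by simp; omega)
          simp only [mem_filter, mem_univ, true_and] at this
          omega
        · rw [hfix v hv]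
      · intro u v huv hv huv'
        by_cases hv2 : r * K ≤ cls v
        · have hlt : cls v - r * K < K := by rw [add_mul, one_mul] at hv; omega
          exact p4 ⟨cls v - r * K, hlt⟩ u (by simp; omega) v (by simp; omega) huv'
        · rw [p1]
          simp only [Function.comp]
          rw [hfix v (by omega), hfix u (by omega)]
          exact h3 u v huv (by omega) huv'
  obtain ⟨L, hL, h⟩ := key R
  refine ⟨L, hL, fun f hf => ?_⟩
  obtain ⟨π, h1, h2, h3⟩ := h f hf
  exact ⟨π, h1, h2, fun u v huv => h3 u v huv (hcls v)⟩


/-! ### Part K: the block argument -/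

open AksLayer

section Block

variable {n b k : ℕ}

def bcnt (blk : Fin n → Fin (2 ^ k)) (θ : ℕ) (f : Fin n → ℕ) (i : Fin (2 ^ k)) : ℕ :=
  #{v | blk v = i ∧ f v < θ}

def Compat (b : ℕ) (c : Fin (2 ^ k) → ℕ) (z : Fin (2 ^ k) → Bool) : Prop :=
  ∀ i, (c i = b → z i = false) ∧ (c i = 0 → z i = true)

theorem compat_back (hb : 1 ≤ b) (l : AksLayer (Fin (2 ^ k))) (hl : ∀ w, l.lo w = decide (w ≤ l.p w))
    (c c' : Fin (2 ^ k) → ℕ) (hfix : ∀ i, l.p i = i → c' i = c i)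
    (hle : ∀ i, c i ≤ b) (hle' : ∀ i, c' i ≤ b)
    (hsum : ∀ i, i < l.p i → c' i + c' (l.p i) = c i + c (l.p i))
    (hor : ∀ i, i < l.p i → c' i = b ∨ c' (l.p i) = 0) (z' : Fin (2 ^ k) → Bool)
    (hz' : Compat b c' z') : ∃ z, Compat b c z ∧ l.apply z = z' := by
  classical
  set z : Fin (2 ^ k) → Bool := fun w =>
    if c (min w (l.p w)) ≠ 0 ∧ c (max w (l.p w)) ≠ b then z' w else z' (l.p w) with hz
  have hzfix : ∀ i, l.p i = i → z i = z' i := by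
    intro i hi; simp [hz, hi]
  have hzp : ∀ i, i < l.p i →
      (z i = if c i ≠ 0 ∧ c (l.p i) ≠ b then z' i else z' (l.p i)) ∧
      (z (l.p i) = if c i ≠ 0 ∧ c (l.p i) ≠ b then z' (l.p i) else z' i) := by
    intro i hi
    simp only [hz, l.inv]
    rw [min_eq_left hi.le, max_eq_right hi.le, min_eq_right hi.le, max_eq_left hi.le]
    exact ⟨rfl, rfl⟩
  have main : ∀ i, i < l.p i → ((c i = b → z i = false) ∧ (c i = 0 → z i = true)) ∧
      ((c (l.p i) = b → z (l.p i) = false) ∧ (c (l.p i) = 0 → z (l.p i) = true)) ∧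
      min (z i) (z (l.p i)) = z' i ∧ max (z (l.p i)) (z i) = z' (l.p i) := by
    intro i hi
    obtain ⟨e1, e2⟩ := hzp i hi
    have h1 := hz' i
    have h2 := hz' (l.p i)
    have h3 := hsum i hi
    have h4 := hor i hi
    have h5 := hle i
    have h6 := hle (l.p i)
    have h7 := hle' i
    have h8 := hle' (l.p i)
    rcases ha : z' i with _ | _ <;> rcases hb' : z' (l.p i) with _ | _ <;>
      rw [ha] at h1 e1 e2 <;> rw [hb'] at h2 e1 e2 <;> (try simp only [ite_self] at e1) <;> (try simp only [ite_self] at e2) <;>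
      simp only [reduceCtorEq, imp_false, implies_true, true_and, and_true] at h1 h2
    · rw [e1, e2]
      refine ⟨⟨fun _ => rfl, fun h => ?_⟩, ⟨fun _ => rfl, fun h => ?_⟩, rfl, rfl⟩ <;> exfalso <;> omega
    · by_cases hc : c i ≠ 0 ∧ c (l.p i) ≠ b
      · rw [if_pos hc] at e1 e2
        rw [e1, e2]
        exact ⟨⟨fun _ => rfl, fun h => absurd h hc.1⟩, ⟨fun h => absurd h hc.2, fun _ => rfl⟩, rfl, rfl⟩
      · rw [if_neg hc] at e1 e2
        rw [e1, e2]
        refine ⟨⟨fun h => ?_, fun _ => rfl⟩, ⟨fun _ => rfl, fun h => ?_⟩, rfl, rfl⟩ <;> exfalso <;>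
        · rw [not_and_or, not_not, not_not] at hc
          omega
    · exfalso; omega
    · rw [e1, e2]
      refine ⟨⟨fun h => ?_, fun _ => rfl⟩, ⟨fun h => ?_, fun _ => rfl⟩, rfl, rfl⟩ <;> exfalso <;> omega
  refine ⟨z, ?_, ?_⟩
  · intro i
    rcases lt_trichotomy i (l.p i) with h | h | h
    · exact (main i h).1
    · rw [hzfix i h.symm, ← hfix i h.symm]; exact hz' i
    · have := (main (l.p i) (by rwa [l.inv])).2.1
      rw [l.inv] at this
      exact this
  · funext i
    simp only [apply, hl]
    rcases lt_trichotomy i (l.p i) with h | h | h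
    · simp only [h.le, decide_true, if_true]
      exact (main i h).2.2.1
    · rw [← h]; simp [hzfix i h.symm]
    · simp only [not_le.mpr h, decide_false]
      have := (main (l.p i) (by rwa [l.inv])).2.2.2
      rw [l.inv] at this
      simpa using this

theorem merge_compat (hb : 1 ≤ b) (blk : Fin n → Fin (2 ^ k)) (hblk : ∀ v, (blk v : ℕ) = v / b)
    (l : AksLayer (Fin (2 ^ k))) (hl : ∀ w, l.lo w = decide (w ≤ l.p w))
    (f g : Fin n → ℕ) (π : Equiv.Perm (Fin n)) (hg : g = f ∘ π)
    (hπ : ∀ v, min (blk (π v)) (l.p (blk (π v))) = min (blk v) (l.p (blk v)))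
    (hs : ∀ u v, min (blk u) (l.p (blk u)) = min (blk v) (l.p (blk v)) → u < v → g u < g v)
    (θ : ℕ) (z' : Fin (2 ^ k) → Bool) (hz' : Compat b (bcnt blk θ g) z') :
    ∃ z, Compat b (bcnt blk θ f) z ∧ l.apply z = z' := by
  classical
  have hbs : ∀ i, ({v | blk v = i} : Finset (Fin n)).image Fin.val ⊆
      Ico ((i : ℕ) * b) ((i : ℕ) * b + b) := by
    intro i x hx
    obtain ⟨v, hv, rfl⟩ := Finset.mem_image.mp hx
    simp only [mem_filter, mem_univ, true_and] at hv
    have h1 := hblk v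
    rw [hv] at h1
    have h2 := Nat.div_add_mod (v : ℕ) b
    have h3 := Nat.mod_lt (v : ℕ) hb
    rw [← h1, mul_comm] at h2
    rw [mem_Ico]; omega
  have hcle : ∀ f i, bcnt blk θ f i ≤ b := by
    intro f i
    calc bcnt blk θ f i ≤ #{v | blk v = i} := by
          apply Finset.card_le_card
          intro v; simp only [mem_filter, mem_univ, true_and]; exact fun h => h.1
      _ = #(({v | blk v = i} : Finset (Fin n)).image Fin.val) :=
          (Finset.card_image_of_injective _ Fin.val_injective).symm
      _ ≤ #(Ico ((i : ℕ) * b) ((i : ℕ) * b + b)) := Finset.card_le_card (hbs i)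
      _ = b := by simp
  have hclc : ∀ i, #{v | min (blk v) (l.p (blk v)) = i ∧ g v < θ} =
      #{v | min (blk v) (l.p (blk v)) = i ∧ f v < θ} := by
    intro i
    rw [← Finset.card_map π.toEmbedding]
    congr 1
    ext v
    simp only [mem_map, mem_filter, mem_univ, true_and, Equiv.coe_toEmbedding]
    constructor
    · rintro ⟨u, ⟨h1, h2⟩, rfl⟩
      refine ⟨by rw [hπ, h1], ?_⟩
      rw [hg] at h2; exact h2
    · rintro ⟨h1, h2⟩
      refine ⟨π.symm v, ⟨?_, ?_⟩, by simp⟩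
      · have := hπ (π.symm v)
        rw [Equiv.apply_symm_apply] at this
        rw [← this, h1]
      · rw [hg]; simpa using h2
  have hclsfix : ∀ i, l.p i = i → ∀ v, min (blk v) (l.p (blk v)) = i ↔ blk v = i := by
    intro i hi v
    constructor
    · intro h
      rcases min_choice (blk v) (l.p (blk v)) with h' | h'
      · rw [← h', h]
      · rw [h'] at h
        rw [← l.inv (blk v), h, hi]
    · intro h; rw [h, hi, min_self]
  have hclslt : ∀ i, i < l.p i → ∀ v, min (blk v) (l.p (blk v)) = i ↔ (blk v = i ∨ blk v = l.p i) := by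
    intro i hi v
    constructor
    · intro h
      rcases min_choice (blk v) (l.p (blk v)) with h' | h'
      · left; rw [← h', h]
      · right
        rw [h'] at h
        rw [← l.inv (blk v), h]
    · rintro (h | h)
      · rw [h, min_eq_left hi.le]
      · rw [h, l.inv, min_eq_right hi.le]
  have hsplit : ∀ (f : Fin n → ℕ) i, i < l.p i → #{v | min (blk v) (l.p (blk v)) = i ∧ f v < θ} =
      bcnt blk θ f i + bcnt blk θ f (l.p i) := by
    intro f i hi
    unfold bcnt
    rw [← Finset.card_union_of_disjoint]
    · congr 1
      ext v
      simp only [mem_filter, mem_univ, true_and, mem_union]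
      rw [hclslt i hi v]
      tauto
    · rw [Finset.disjoint_left]
      intro v h1 h2
      simp only [mem_filter, mem_univ, true_and] at h1 h2
      rw [h1.1] at h2
      exact hi.ne h2.1
  refine compat_back hb l hl _ _ ?_ (hcle f) (hcle g) ?_ ?_ z' hz'
  · intro i hi
    have := hclc i
    simp only [hclsfix i hi] at this
    exact this
  · intro i hi
    rw [← hsplit g i hi, ← hsplit f i hi, hclc]
  · intro i hi
    by_cases h0 : bcnt blk θ g (l.p i) = 0
    · exact Or.inr h0
    · left
      obtain ⟨v, hv⟩ := Finset.card_ne_zero.mp h0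
      simp only [mem_filter, mem_univ, true_and] at hv
      apply le_antisymm (hcle g i)
      have hjb : ((i : ℕ) + 1) * b ≤ v := by
        have h1 := hblk v
        rw [hv.1] at h1
        have h2 : (i : ℕ) + 1 ≤ (v : ℕ) / b := by rw [← h1]; exact hi
        exact (Nat.le_div_iff_mul_le hb).mp h2
      have hall : Ico ((i : ℕ) * b) ((i : ℕ) * b + b) ⊆
          ({v | blk v = i ∧ g v < θ} : Finset (Fin n)).image Fin.val := by
        intro x hx
        rw [mem_Ico] at hx
        rw [add_mul, one_mul] at hjb
        have hxn : x < n := by have := v.2; omega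
        refine Finset.mem_image.mpr ⟨⟨x, hxn⟩, ?_, rfl⟩
        have hbx : blk ⟨x, hxn⟩ = i := by
          apply Fin.ext
          rw [hblk]
          apply Nat.div_eq_of_lt_le
          · exact hx.1
          · rw [add_mul, one_mul]; exact hx.2
        simp only [mem_filter, mem_univ, true_and]
        refine ⟨hbx, lt_trans (hs _ v ?_ ?_) hv.2⟩
        · rw [(hclslt i hi _).mpr (Or.inl hbx), (hclslt i hi _).mpr (Or.inr hv.1)]
        · rw [Fin.lt_def]; simp only; omega
      calc b = #(Ico ((i : ℕ) * b) ((i : ℕ) * b + b)) := by simp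
        _ ≤ _ := Finset.card_le_card hall
        _ ≤ _ := Finset.card_image_le

theorem block_ordered (hb : 1 ≤ b) (blk : Fin n → Fin (2 ^ k)) (hblk : ∀ v, (blk v : ℕ) = v / b)
    (L : ℕ → AksLayer (Fin (2 ^ k))) (hl : ∀ t w, (L t).lo w = decide (w ≤ (L t).p w)) (N : ℕ)
    (hL : ∀ x : Fin (2 ^ k) → Bool, Monotone (run L N x))
    (fs : ℕ → Fin n → ℕ)
    (hfs : ∀ t, ∃ π : Equiv.Perm (Fin n), fs (t + 1) = fs t ∘ π ∧
      (∀ v, min (blk (π v)) ((L t).p (blk (π v))) = min (blk v) ((L t).p (blk v))) ∧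
      ∀ u v, min (blk u) ((L t).p (blk u)) = min (blk v) ((L t).p (blk v)) → u < v →
        fs (t + 1) u < fs (t + 1) v) (u v : Fin n) (huv : blk u < blk v) :
    fs N u ≤ fs N v := by
  classical
  by_contra hc
  rw [not_le] at hc
  set θ := fs N v + 1 with hθ
  set c := bcnt blk θ (fs N) with hcdef
  have hback : ∀ t z', Compat b (bcnt blk θ (fs t)) z' → ∃ z, run L t z = z' := by
    intro t
    induction t with
    | zero => intro z' _; exact ⟨z', rfl⟩
    | succ t ih =>
      intro z' hz'
      obtain ⟨π, h1, h2, h3⟩ := hfs t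
      obtain ⟨z, e1, e2⟩ := merge_compat hb blk hblk (L t) (hl t) (fs t) (fs (t + 1)) π h1 h2 h3 θ z' hz'
      obtain ⟨y, hy⟩ := ih z e1
      exact ⟨y, by rw [run_succ, hy, e2]⟩
  have hv0 : c (blk v) ≠ 0 := by
    apply Finset.card_ne_zero.mpr
    exact ⟨v, by simp [hθ]⟩
  have hub : c (blk u) ≠ b := by
    apply Nat.ne_of_lt
    have hsub : ({w | blk w = blk u ∧ fs N w < θ} : Finset (Fin n)).image Fin.val ⊆
      (Ico ((blk u : ℕ) * b) ((blk u : ℕ) * b + b)).erase u := by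
      intro x hx
      obtain ⟨w, hw, rfl⟩ := Finset.mem_image.mp hx
      simp only [mem_filter, mem_univ, true_and] at hw
      rw [mem_erase]
      refine ⟨fun h => ?_, ?_⟩
      · have := Fin.ext h
        subst this
        have := hw.2
        omega
      · have h1 := hblk w
        rw [hw.1] at h1
        have h2 := Nat.div_add_mod (w : ℕ) b
        have h3 := Nat.mod_lt (w : ℕ) hb
        rw [← h1, mul_comm] at h2
        rw [mem_Ico]; omega
    have h4 := Finset.card_le_card hsub
    rw [Finset.card_image_of_injective _ Fin.val_injective] at h4
    have hmem : (u : ℕ) ∈ Ico ((blk u : ℕ) * b) ((blk u : ℕ) * b + b) := by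
      have h1 := hblk u
      have h2 := Nat.div_add_mod (u : ℕ) b
      have h3 := Nat.mod_lt (u : ℕ) hb
      rw [← h1, mul_comm] at h2
      rw [mem_Ico]; omega
    rw [Finset.card_erase_of_mem hmem, Nat.card_Ico, Nat.add_sub_cancel_left] at h4
    have h5 : c (blk u) ≤ b - 1 := h4
    omega
  set z' : Fin (2 ^ k) → Bool := fun i => if i = blk v then false else decide (c i ≠ b) with hz'
  have hcompat : Compat b c z' := by
    intro i
    by_cases hi : i = blk v
    · subst hi
      simp [hz', hv0]
    · simp only [hz', hi, if_false]
      refine ⟨fun h => by simp [h], fun h => ?_⟩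
      have : (0 : ℕ) ≠ b := by omega
      simp [h, this]
  obtain ⟨z, hz⟩ := hback N z' hcompat
  have hm := hL z huv.le
  rw [hz] at hm
  simp [hz', huv.ne, hub] at hm
  exact absurd hm (by decide)

end Block

theorem st_le_of_slots : ∃ C : ℕ, ∀ (n : ℕ) (G : SimpleGraph (Fin n)), G.Connected →
    ∀ (K T b k R : ℕ) (S : Fin K → Finset (Fin n)), SlotCap G K S T →
    (∀ i j, i ≠ j → Disjoint (S i) (S j)) → 1 ≤ b → (∀ i, 2 * b ≤ #(S i)) →
    n ≤ 2 ^ k * b → n ≤ R * K * b → st G ≤ (C * (k + 1) + 1) * (R * (2 * rt G + T)) := by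
  classical
  obtain ⟨C, hC⟩ := aks_sort
  refine ⟨C, fun n G hG K T b k R S hS hSd hb hSb hnk hnR => ?_⟩
  obtain ⟨L, N, hN, hlo, hsort⟩ := hC k
  have hlt : ∀ v : Fin n, (v : ℕ) / b < 2 ^ k := fun v =>
    Nat.div_lt_of_lt_mul (by rw [mul_comm]; exact lt_of_lt_of_le v.2 hnk)
  have hlt' : ∀ v : Fin n, (v : ℕ) / b < R * K := fun v =>
    Nat.div_lt_of_lt_mul (by rw [mul_comm]; exact lt_of_lt_of_le v.2 hnR)
  set blk : Fin n → Fin (2 ^ k) := fun v => ⟨v / b, hlt v⟩ with hblk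
  have hblk' : ∀ v, (blk v : ℕ) = v / b := fun v => rfl
  have hbs : ∀ i : ℕ, #({v | (blk v : ℕ) = i} : Finset (Fin n)) ≤ b := by
    intro i
    have hsub : ({v | (blk v : ℕ) = i} : Finset (Fin n)).image Fin.val ⊆
      Ico ((i : ℕ) * b) ((i : ℕ) * b + b) := by
      intro x hx
      obtain ⟨v, hv, rfl⟩ := Finset.mem_image.mp hx
      simp only [mem_filter, mem_univ, true_and] at hv
      have h1 := hblk' v
      rw [hv] at h1
      have h2 := Nat.div_add_mod (v : ℕ) b
      have h3 := Nat.mod_lt (v : ℕ) hb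
      rw [← h1, mul_comm] at h2
      rw [mem_Ico]; omega
    have := Finset.card_le_card hsub
    rw [Finset.card_image_of_injective _ Fin.val_injective] at this
    simpa using this
  have hK : 0 < K := by
    rcases Nat.eq_zero_or_pos K with rfl | h
    · obtain ⟨v⟩ := hG.nonempty
      have := v.2; simp at hnR; omega
    · exact h
  -- the networks for each layer
  have hnet : ∀ t, ∃ M : List (Stage G), M.length ≤ R * (2 * rt G + T) ∧
      ∀ f : Fin n → ℕ, Function.Injective f →
      ∃ π : Equiv.Perm (Fin n), runNetwork M f = f ∘ π ∧
      (∀ v, min (blk (π v)) ((L t).p (blk (π v))) = min (blk v) ((L t).p (blk v))) ∧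
      ∀ u v, min (blk u) ((L t).p (blk u)) = min (blk v) ((L t).p (blk v)) → u < v →
        runNetwork M f u < runNetwork M f v := by
    intro t
    obtain ⟨M, hM, h⟩ := sort_classes hG hK hS hSd hSb
      (fun v => ((min (blk v) ((L t).p (blk v)) : Fin (2 ^ k)) : ℕ)) R (by
        intro v
        refine lt_of_le_of_lt ?_ (hlt' v)
        have : min (blk v) ((L t).p (blk v)) ≤ blk v := min_le_left _ _
        exact this) (by
        intro c
        by_cases hc : c < 2 ^ k
        · have hsub : ({v | ((min (blk v) ((L t).p (blk v)) : Fin (2 ^ k)) : ℕ) = c} : Finset (Fin n)) ⊆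
            ({v | (blk v : ℕ) = c} : Finset (Fin n)) ∪
            ({v | (blk v : ℕ) = ((L t).p ⟨c, hc⟩ : Fin (2 ^ k))} : Finset (Fin n)) := by
            intro v hv
            simp only [mem_filter, mem_univ, true_and, mem_union] at hv ⊢
            rcases min_choice (blk v) ((L t).p (blk v)) with h' | h'
            · left; rw [← h', hv]
            · right
              rw [h'] at hv
              have : (L t).p (blk v) = ⟨c, hc⟩ := Fin.ext hv
              rw [← this, (L t).inv]
          refine (Finset.card_le_card hsub).trans ((Finset.card_union_le _ _).trans ?_)
          have := hbs c
          have := hbs ((L t).p ⟨c, hc⟩ : Fin (2 ^ k))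
          omega
        · rw [Finset.card_eq_zero.mpr]
          · omega
          · rw [Finset.filter_eq_empty_iff]
            intro v _ h
            exact hc (h ▸ (min (blk v) ((L t).p (blk v))).2))
    refine ⟨M, hM, fun f hf => ?_⟩
    obtain ⟨π, h1, h2, h3⟩ := h f hf
    exact ⟨π, h1, fun v => Fin.ext (h2 v), fun u v huv => h3 u v (congrArg Fin.val huv)⟩
  obtain ⟨M0, hM0, h0⟩ := sort_classes hG hK hS hSd hSb (fun v => (blk v : ℕ)) R hlt'
    (fun c => (hbs c).trans (by omega))
  choose M hM hMs using hnet
  set LL : ℕ → List (Stage G) := fun t => Nat.rec [] (fun t l => l ++ M t) t with hLL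
  have hLLlen : ∀ t, (LL t).length ≤ t * (R * (2 * rt G + T)) := by
    intro t
    induction t with
    | zero => simp [hLL]
    | succ t ih =>
      have : LL (t + 1) = LL t ++ M t := rfl
      rw [this, List.length_append, add_mul, one_mul]
      exact Nat.add_le_add ih (hM t)
  have hLLinj : ∀ t f, Function.Injective f → Function.Injective (runNetwork (LL t) f) := by
    intro t f hf
    induction t with
    | zero => exact hf
    | succ t ih =>
      have : LL (t + 1) = LL t ++ M t := rfl
      rw [this, runNetwork_append]
      obtain ⟨π, h1, -⟩ := hMs t _ ih
      rw [h1]; exact ih.comp π.injective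
  have hfinal : (LL N ++ M0).length ≤ (C * (k + 1) + 1) * (R * (2 * rt G + T)) := by
    rw [List.length_append, add_mul, one_mul]
    exact Nat.add_le_add ((hLLlen N).trans (Nat.mul_le_mul_right _ hN)) hM0
  refine le_trans (Nat.sInf_le ⟨finCongr (Fintype.card_fin n).symm, LL N ++ M0, rfl, ?_⟩) hfinal
  intro f hf u w huw
  have huw' : u < w := Fin.lt_def.mpr (Fin.lt_def.mp huw)
  rw [runNetwork_append]
  set f1 := runNetwork (LL N) f with hf1
  obtain ⟨π, p1, p2, p3⟩ := h0 f1 (hLLinj N f hf)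
  by_cases hbe : (blk u : ℕ) = blk w
  · exact p3 u w hbe huw'
  have hblt : blk u < blk w := by
    refine lt_of_le_of_ne ?_ (fun h => hbe (congrArg Fin.val h))
    rw [Fin.le_def, hblk', hblk']
    exact Nat.div_le_div_right huw'.le
  rw [p1]
  have hb2 : blk (π u) < blk (π w) := by
    rw [Fin.lt_def, p2, p2]; exact hblt
  have hord := block_ordered hb blk hblk' L hlo N hsort (fun t => runNetwork (LL t) f) (fun t => by
    have : LL (t + 1) = LL t ++ M t := rfl
    simp only [this, runNetwork_append]
    exact hMs t _ (hLLinj t f hf)) (π u) (π w) hb2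
  refine lt_of_le_of_ne hord ?_
  intro h
  have := hLLinj N f hf h
  rw [this] at hb2
  exact lt_irrefl _ hb2


/-! ### Part L: slots from sorting networks on the parts -/

namespace GSt

def sw {V : Type*} (s : GSt V) (m : V → ℕ) (v : V) : Prop :=
  if s.lo v then m (s.p v) < m v else m v < m (s.p v)

theorem sw_p {V : Type*} (s : GSt V) (m : V → ℕ) (v : V) : s.sw m (s.p v) ↔ s.sw m v := by
  by_cases h : s.p v = v
  · rw [h]
  · unfold sw
    rw [s.opp v h, s.inv]
    cases s.lo v <;> simp

open scoped Classical in
noncomputable def frz {V : Type*} (s : GSt V) (m : V → ℕ) : GSt V where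
  p := fun v => if s.dir v = true ∧ ¬ (m v = 0 ∧ m (s.p v) = 0) ∧ ¬ s.sw m v then v else s.p v
  inv := by
    intro v
    by_cases h : s.dir v = true ∧ ¬ (m v = 0 ∧ m (s.p v) = 0) ∧ ¬ s.sw m v
    · simp only [if_pos h]
    · have h' : ¬ (s.dir (s.p v) = true ∧ ¬ (m (s.p v) = 0 ∧ m (s.p (s.p v)) = 0) ∧ ¬ s.sw m (s.p v)) := by
        rw [s.dirp, s.inv, sw_p]; tauto
      rw [if_neg h, if_neg h', s.inv]
  lo := s.lo
  opp := by
    intro v hv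
    by_cases h : s.dir v = true ∧ ¬ (m v = 0 ∧ m (s.p v) = 0) ∧ ¬ s.sw m v
    · exact absurd (if_pos h) hv
    · rw [if_neg h] at hv ⊢
      exact s.opp v hv
  dir := fun v => decide (s.dir v = true ∧ m v = 0 ∧ m (s.p v) = 0)
  dirp := by
    intro v
    by_cases h : s.dir v = true ∧ ¬ (m v = 0 ∧ m (s.p v) = 0) ∧ ¬ s.sw m v
    · rw [if_pos h]
    · rw [if_neg h, s.dirp, s.inv, decide_eq_decide]
      tauto

theorem frz_adj {V : Type*} {G : SimpleGraph V} (s : GSt V) (hs : s.AdjOn G) (m : V → ℕ) :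
    (s.frz m).AdjOn G := by
  classical
  intro v hv
  simp only [frz] at hv ⊢
  by_cases h : s.dir v = true ∧ ¬ (m v = 0 ∧ m (s.p v) = 0) ∧ ¬ s.sw m v
  · rw [if_pos h] at hv; exact absurd rfl hv
  · rw [if_neg h] at hv ⊢
    exact hs v hv

theorem frz_app {V : Type*} (s : GSt V) (F : V → ℕ) (M : ℕ) (dec : ℕ → ℕ)
    (hdec : ∀ x ≤ M, dec x = x) :
    (s.frz (fun v => F v - M)).app (dec ∘ F) = dec ∘ s.app F := by
  classical
  funext v
  simp only [app, frz, Function.comp, sw]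
  by_cases hd : s.dir v = true
  · by_cases hz : F v - M = 0 ∧ F (s.p v) - M = 0
    · have h1 := hdec (F v) (by omega)
      have h2 := hdec (F (s.p v)) (by omega)
      simp only [hd, hz, true_and, not_true, false_and, if_false, if_true, decide_true, h1, h2,
        and_true, true_and]
      cases s.lo v
      · rcases max_choice (F v) (F (s.p v)) with h | h <;> simp [h, h1, h2]
      · rcases min_choice (F v) (F (s.p v)) with h | h <;> simp [h, h1, h2]
    · have hd' : ¬ (s.dir v = true ∧ F v - M = 0 ∧ F (s.p v) - M = 0) := fun h => hz h.2
      simp only [hd', decide_false, Bool.false_eq_true, if_false, hd, true_and, if_true, hz,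
        not_false_eq_true]
      cases hl : s.lo v
      · simp only [Bool.false_eq_true, if_false]
        split_ifs with h
        · rw [max_eq_right (by omega)]
        · rw [max_eq_left (by omega)]
      · simp only [if_true]
        split_ifs with h
        · rw [min_eq_right (by omega)]
        · rw [min_eq_left (by omega)]
  · simp [hd]

end GSt

theorem slotCap_of_run {n : ℕ} (G : SimpleGraph (Fin n)) {K : ℕ} (N : ℕ → GSt (Fin n))
    (hN : ∀ t, (N t).AdjOn G) (ι : Fin n → Fin K) (hι : ∀ t v, ι ((N t).p v) = ι v) (T : ℕ)
    (r : Fin n → ℕ) (hr : ∀ u v, ι u = ι v → r u = r v → u = v)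
    (hs : ∀ f : Fin n → ℕ, Function.Injective f → ∀ u w, ι u = ι w → r u < r w →
      GSt.run N T f u < GSt.run N T f w)
    (S : Fin K → Finset (Fin n)) (hS : ∀ k, ∀ v ∈ S k, ι v = k) : SlotCap G K S T := by
  classical
  intro A hA
  set m : Fin n → ℕ := fun v => if ∃ k, v ∈ A k then 0 else (v : ℕ) + 1 with hm
  set N' : ℕ → GSt (Fin n) := fun t => (N t).frz (GSt.run N t m) with hN'
  obtain ⟨L, hL1, hL2⟩ := GSt.toNetwork (G := G) N' T (fun t _ => GSt.frz_adj _ (hN t) _)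
  obtain ⟨π0, h01, h02⟩ := GSt.run_perm N ι hι T m
  have hιγ : ∀ v, ι (π0.symm v) = ι v := fun v => by
    rw [← h02, Equiv.apply_symm_apply]
  refine ⟨L, hL1.le, π0.symm, fun v => r (π0.symm v), ?_, ?_⟩
  · intro k u hu v hv huv
    have := hr _ _ (by rw [hιγ, hιγ, hS k u (hA k hu), hS k v (hA k hv)]) huv
    exact π0.symm.injective this
  intro f hf
  set M := univ.sup f + 1 with hM
  have hfM : ∀ v, f v < M := fun v => Nat.lt_succ_of_le (Finset.le_sup (mem_univ v))
  set F : Fin n → ℕ := fun v => if ∃ k, v ∈ A k then f v else M + v + 1 with hF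
  set dec : ℕ → ℕ := fun x => if x ≤ M then x else
    if h : x - M - 1 < n then f ⟨x - M - 1, h⟩ else 0 with hdec
  have hdecM : ∀ x ≤ M, dec x = x := fun x hx => if_pos hx
  have hdF : ∀ v, dec (F v) = f v := by
    intro v
    simp only [hF]
    split_ifs with h
    · exact hdecM _ (hfM v).le
    · simp only [hdec]
      rw [if_neg (by omega)]
      have : M + (v : ℕ) + 1 - M - 1 = v := by omega
      simp only [this, v.2, dif_pos]
  have hFinj : Function.Injective F := by
    intro u v huv
    apply hf
    rw [← hdF u, ← hdF v, huv]
  have hmono : Monotone (fun x : ℕ => x - M) := fun a b h => Nat.sub_le_sub_right h M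
  have hFm : (fun x : ℕ => x - M) ∘ F = m := by
    funext v
    simp only [Function.comp, hF, hm]
    split_ifs with h
    · have := hfM v; omega
    · omega
  have hmt : ∀ t, GSt.run N t m = fun v => GSt.run N t F v - M := by
    intro t
    rw [← hFm, ← GSt.run_mono N hmono]; rfl
  have hg : ∀ t, GSt.run N' t f = dec ∘ GSt.run N t F := by
    intro t
    induction t with
    | zero => funext v; exact (hdF v).symm
    | succ t ih =>
      rw [GSt.run_succ, GSt.run_succ, ih, ← GSt.frz_app (N t) _ M dec hdecM]
      simp only [hN', hmt]
  obtain ⟨π1, h11, h12⟩ := GSt.run_perm N ι hι T F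
  have hmm : ∀ v, m (π1 (π0.symm v)) = m v := by
    intro v
    have h1 := congrFun (hmt T) (π0.symm v)
    have h2 := congrFun h01 (π0.symm v)
    have h3 := congrFun h11 (π0.symm v)
    have h4 := congrFun hFm (π1 (π0.symm v))
    simp only [Function.comp, Equiv.apply_symm_apply] at h1 h2 h3 h4
    rw [← h4, ← h3, ← h1, h2]
  have hval : ∀ v, runNetwork L f (π0.symm v) = f (π1 (π0.symm v)) := by
    intro v
    rw [hL2, hg, h11]
    exact hdF _
  have hmem : ∀ k, ∀ v ∈ A k, π1 (π0.symm v) ∈ A k := by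
    intro k v hv
    have h1 : m v = 0 := if_pos ⟨k, hv⟩
    rw [← hmm] at h1
    by_cases hx : ∃ j, π1 (π0.symm v) ∈ A j
    · obtain ⟨j, hj⟩ := hx
      have h2 := hS j _ (hA j hj)
      rw [h12, hιγ, hS k v (hA k hv)] at h2
      rw [h2]; exact hj
    · simp only [hm] at h1
      rw [if_neg hx] at h1
      omega
  refine ⟨π0.symm.trans π1, hval, hmem, ?_, ?_⟩
  · intro v hv
    have h1 : m v = v + 1 := if_neg (fun ⟨k, hk⟩ => hv k hk)
    rw [← hmm] at h1
    simp only [hm] at h1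
    rw [Equiv.trans_apply]
    split_ifs at h1 with hx
    exact Fin.ext (by omega)
  · intro k u hu v hv huv
    have h1 := hs F hFinj (π0.symm u) (π0.symm v)
      (by rw [hιγ, hιγ, hS k u (hA k hu), hS k v (hA k hv)]) huv
    rw [h11] at h1
    simp only [Function.comp, hF] at h1
    rw [if_pos ⟨k, hmem k u hu⟩, if_pos ⟨k, hmem k v hv⟩] at h1
    rw [hval, hval]
    exact h1

theorem slotCap_parts {n q : ℕ} (G : SimpleGraph (Fin n)) (parts : Fin q → Finset (Fin n))
    (hd : ∀ i j, i ≠ j → Disjoint (parts i) (parts j))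
    (hu : Finset.univ.biUnion parts = Finset.univ)
    (hc : ∀ i, (G.induce (↑(parts i) : Set (Fin n))).Connected) :
    SlotCap G q parts (Finset.univ.sup fun i => st (G.induce (↑(parts i) : Set (Fin n)))) := by
  classical
  have hex : ∀ v, ∃ i, v ∈ parts i := by
    intro v
    have := hu.ge (mem_univ v)
    simpa using this
  choose ι hι using hex
  have hι' : ∀ i, ∀ v ∈ parts i, ι v = i := by
    intro i v hv
    by_contra h
    exact Finset.disjoint_left.mp (hd _ _ h) (hι v) hv
  have hat := fun i => st_attained (hc i)
  choose π L hL1 hL2 using hat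
  have hnt := fun i => GSt.ofNetwork (L i)
  choose N hN1 hN2 using hnt
  have gp : ∀ (i) (x : (↑(parts i) : Set (Fin n))) (t), ((N (ι x) t).p ⟨x, hι x⟩ : Fin n) = (N i t).p x := by
    rintro i ⟨x, hx⟩ t
    obtain rfl := hι' i x hx
    rfl
  have gl : ∀ (i) (x : (↑(parts i) : Set (Fin n))) (t), (N (ι x) t).lo ⟨x, hι x⟩ = (N i t).lo x := by
    rintro i ⟨x, hx⟩ t
    obtain rfl := hι' i x hx
    rfl
  have gd : ∀ (i) (x : (↑(parts i) : Set (Fin n))) (t), (N (ι x) t).dir ⟨x, hι x⟩ = (N i t).dir x := by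
    rintro i ⟨x, hx⟩ t
    obtain rfl := hι' i x hx
    rfl
  have gr : ∀ (i) (x : (↑(parts i) : Set (Fin n))), ((π (ι x) ⟨x, hι x⟩ : Fin _) : ℕ) = π i x := by
    rintro i ⟨x, hx⟩
    obtain rfl := hι' i x hx
    rfl
  set NN : ℕ → GSt (Fin n) := fun t =>
    { p := fun v => ((N (ι v) t).p ⟨v, hι v⟩ : Fin n)
      inv := fun v => by
        rw [gp (ι v) ((N (ι v) t).p ⟨v, hι v⟩) t, (N (ι v) t).inv]
      lo := fun v => (N (ι v) t).lo ⟨v, hι v⟩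
      opp := fun v hv => by
        rw [gl (ι v) ((N (ι v) t).p ⟨v, hι v⟩) t]
        refine (N (ι v) t).opp _ (fun h => hv ?_)
        rw [h]
      dir := fun v => (N (ι v) t).dir ⟨v, hι v⟩
      dirp := fun v => by
        rw [gd (ι v) ((N (ι v) t).p ⟨v, hι v⟩) t, (N (ι v) t).dirp] } with hNN
  have hrun : ∀ (i) (t) (f : Fin n → ℕ) (x : (↑(parts i) : Set (Fin n))),
      GSt.run NN t f x = GSt.run (N i) t (fun y => f y) x := by
    intro i t f
    induction t with
    | zero => intro x; rfl
    | succ t ih =>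
      intro x
      rw [GSt.run_succ, GSt.run_succ]
      simp only [GSt.app]
      have e1 : (NN t).p x = (N i t).p x := gp i x t
      have e2 : (NN t).lo x = (N i t).lo x := gl i x t
      have e3 : (NN t).dir x = (N i t).dir x := gd i x t
      rw [e1, e2, e3, ih, ih]
  refine slotCap_of_run G NN ?_ ι ?_ _ (fun v => (π (ι v) ⟨v, hι v⟩ : ℕ)) ?_ ?_ parts hι'
  · intro t v hv
    have := hN1 (ι v) t ⟨v, hι v⟩ (fun h => hv (congrArg Subtype.val h))
    exact this
  · intro t v
    exact hι' _ _ ((N (ι v) t).p ⟨v, hι v⟩).2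
  · intro u v huv h
    have hu' : u ∈ parts (ι v) := by rw [← huv]; exact hι u
    have h1 := gr (ι v) ⟨u, hu'⟩
    simp only at h1 h
    rw [h1] at h
    have := (π (ι v)).injective (Fin.ext h)
    exact congrArg Subtype.val this
  · intro f hf u w huw h
    have hu' : u ∈ parts (ι w) := by rw [← huw]; exact hι u
    have h1 := gr (ι w) ⟨u, hu'⟩
    simp only at h1 h
    rw [h1] at h
    have h2 := hrun (ι w) (Finset.univ.sup fun i => st (G.induce (↑(parts i) : Set (Fin n)))) f ⟨u, hu'⟩
    have h3 := hrun (ι w) (Finset.univ.sup fun i => st (G.induce (↑(parts i) : Set (Fin n)))) f ⟨w, hι w⟩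
    have hlen : (L (ι w)).length ≤ Finset.univ.sup fun i => st (G.induce (↑(parts i) : Set (Fin n))) := by
      rw [hL1]
      exact Finset.le_sup (f := fun i => st (G.induce (↑(parts i) : Set (Fin n)))) (mem_univ (ι w))
    rw [hN2 _ _ hlen] at h2 h3
    simp only at h2 h3
    rw [h2, h3]
    exact hL2 (ι w) _ (fun a b hab => Subtype.ext (hf hab)) _ _ (Fin.lt_def.mpr h)


/-! ### Part M: slots of size two when all parts are single vertices -/

open scoped Classical in
theorem pair_stage {V : Type*} {G : SimpleGraph V} {K : ℕ} (B : Finset (Fin K)) (x y : Fin K → V)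
    (hx : Set.InjOn x B) (hy : Set.InjOn y B) (hxy : ∀ i ∈ B, ∀ j ∈ B, x i ≠ y j)
    (hadj : ∀ i ∈ B, G.Adj (x i) (y i)) (d : Bool) :
    ∃ S : Stage G, ∀ f, (∀ k ∈ B,
      S.apply f (x k) = (if d then min (f (x k)) (f (y k)) else f (y k)) ∧
      S.apply f (y k) = (if d then max (f (x k)) (f (y k)) else f (x k))) ∧
      ∀ v, (∀ k ∈ B, v ≠ x k ∧ v ≠ y k) → S.apply f v = f v := by
  refine ⟨⟨B.image (fun k => (x k, y k)), ?_, fun _ => d, ?_⟩, ?_⟩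
  · intro p hp
    obtain ⟨k, hk, rfl⟩ := Finset.mem_image.mp hp
    exact hadj k hk
  · intro p hp q hq hpq
    obtain ⟨k, hk, rfl⟩ := Finset.mem_image.mp hp
    obtain ⟨j, hj, rfl⟩ := Finset.mem_image.mp hq
    have hkj : k ≠ j := by rintro rfl; exact hpq rfl
    exact ⟨fun h => hkj (hx hk hj h), hxy k hk j hj, (hxy j hj k hk).symm, fun h => hkj (hy hk hj h)⟩
  · intro f
    have u1 : ∀ k ∈ B, ∀ p, p ∈ B.image (fun k => (x k, y k)) ∧ p.1 = x k → p = (x k, y k) := by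
      rintro k hk p ⟨hp, h⟩
      obtain ⟨j, hj, rfl⟩ := Finset.mem_image.mp hp
      rw [hx hj hk h]
    have u2 : ∀ k ∈ B, ∀ p, p ∈ B.image (fun k => (x k, y k)) ∧ p.2 = y k → p = (x k, y k) := by
      rintro k hk p ⟨hp, h⟩
      obtain ⟨j, hj, rfl⟩ := Finset.mem_image.mp hp
      rw [hy hj hk h]
    refine ⟨fun k hk => ⟨?_, ?_⟩, ?_⟩
    · unfold Stage.apply
      have h1 : ∃ p, p ∈ B.image (fun k => (x k, y k)) ∧ p.1 = x k :=
        ⟨(x k, y k), Finset.mem_image_of_mem _ hk, rfl⟩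
      have e := u1 k hk _ h1.choose_spec
      simp only
      rw [dif_pos h1, e]
    · unfold Stage.apply
      have h1 : ¬ ∃ p, p ∈ B.image (fun k => (x k, y k)) ∧ p.1 = y k := by
        rintro ⟨p, hp, h⟩
        obtain ⟨j, hj, rfl⟩ := Finset.mem_image.mp hp
        exact hxy j hj k hk h
      have h2 : ∃ p, p ∈ B.image (fun k => (x k, y k)) ∧ p.2 = y k :=
        ⟨(x k, y k), Finset.mem_image_of_mem _ hk, rfl⟩
      have e := u2 k hk _ h2.choose_spec
      simp only
      rw [dif_neg h1, dif_pos h2, e]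
    · intro v hv
      unfold Stage.apply
      have h1 : ¬ ∃ p, p ∈ B.image (fun k => (x k, y k)) ∧ p.1 = v := by
        rintro ⟨p, hp, h⟩
        obtain ⟨j, hj, rfl⟩ := Finset.mem_image.mp hp
        exact (hv j hj).1 h.symm
      have h2 : ¬ ∃ p, p ∈ B.image (fun k => (x k, y k)) ∧ p.2 = v := by
        rintro ⟨p, hp, h⟩
        obtain ⟨j, hj, rfl⟩ := Finset.mem_image.mp hp
        exact (hv j hj).2 h.symm
      simp only
      rw [dif_neg h1, dif_neg h2]

def PairReal {V : Type*} {G : SimpleGraph V} {K : ℕ} (a b : Fin K → V) (B : Finset (Fin K))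
    (L : List (Stage G)) : Prop :=
  ∀ f, (∀ k ∈ B, runNetwork L f (a k) = min (f (a k)) (f (b k)) ∧
      runNetwork L f (b k) = max (f (a k)) (f (b k))) ∧
    ∀ v, (∀ k ∈ B, v ≠ a k ∧ v ≠ b k) → runNetwork L f v = f v

theorem pairReal_append {V : Type*} {G : SimpleGraph V} {K : ℕ} {a b : Fin K → V}
    (ha : Function.Injective a) (hb : Function.Injective b) (hab : ∀ i j, a i ≠ b j)
    {B B' : Finset (Fin K)} (hBB : Disjoint B B') {L L' : List (Stage G)}
    (h : PairReal a b B L) (h' : PairReal a b B' L') : PairReal a b (B ∪ B') (L ++ L') := by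
  intro f
  have key : ∀ C D : Finset (Fin K), Disjoint C D → ∀ k ∈ C, ∀ j ∈ D, a k ≠ a j ∧ a k ≠ b j := by
    intro C D hd k hk j hj
    exact ⟨fun h => Finset.disjoint_left.mp hd hk (ha h ▸ hj), hab k j⟩
  have key' : ∀ C D : Finset (Fin K), Disjoint C D → ∀ k ∈ C, ∀ j ∈ D, b k ≠ a j ∧ b k ≠ b j := by
    intro C D hd k hk j hj
    exact ⟨(hab j k).symm, fun h => Finset.disjoint_left.mp hd hk (hb h ▸ hj)⟩
  refine ⟨fun k hk => ?_, fun v hv => ?_⟩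
  · rw [runNetwork_append]
    rcases Finset.mem_union.mp hk with hk | hk
    · rw [(h' _).2 (a k) (key _ _ hBB k hk), (h' _).2 (b k) (key' _ _ hBB k hk)]
      exact (h f).1 k hk
    · have := (h' (runNetwork L f)).1 k hk
      rw [(h f).2 (a k) (key _ _ hBB.symm k hk), (h f).2 (b k) (key' _ _ hBB.symm k hk)] at this
      exact this
  · rw [runNetwork_append, (h' _).2 v (fun k hk => hv k (Finset.mem_union_right _ hk)),
      (h f).2 v (fun k hk => hv k (Finset.mem_union_left _ hk))]

theorem pairReal_classes {V : Type*} {G : SimpleGraph V} {K : ℕ} {a b : Fin K → V}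
    (ha : Function.Injective a) (hb : Function.Injective b) (hab : ∀ i j, a i ≠ b j)
    (τ : Fin K → ℕ) (c : ℕ)
    (hc : ∀ (t : ℕ) (B : Finset (Fin K)), (∀ k ∈ B, τ k = t) →
      ∃ L : List (Stage G), L.length ≤ c ∧ PairReal a b B L) (B : Finset (Fin K)) (t : ℕ) :
    ∃ L : List (Stage G), L.length ≤ c * t ∧ PairReal a b (B.filter fun k => τ k < t) L := by
  induction t with
  | zero => exact ⟨[], by simp, fun f => ⟨by simp, fun _ _ => rfl⟩⟩
  | succ t ih =>
    obtain ⟨L, h1, h2⟩ := ih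
    obtain ⟨L', h3, h4⟩ := hc t (B.filter fun k => τ k = t) (by simp)
    refine ⟨L ++ L', by rw [List.length_append, mul_add, mul_one]; omega, ?_⟩
    have e : B.filter (fun k => τ k < t + 1) = B.filter (fun k => τ k < t) ∪ B.filter fun k => τ k = t := by
      ext k
      simp only [mem_filter, mem_union, Nat.lt_succ_iff_lt_or_eq]
      tauto
    rw [e]
    refine pairReal_append ha hb hab ?_ h2 h4
    rw [Finset.disjoint_left]
    intro k hk hk'
    simp only [mem_filter] at hk hk'
    omega

theorem pairReal_three {V : Type*} {G : SimpleGraph V} {K : ℕ} {a b w : Fin K → V}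
    (ha : Function.Injective a) (hb : Function.Injective b) (hab : ∀ i j, a i ≠ b j)
    (B : Finset (Fin K)) (hw : Set.InjOn w B) (hwa : ∀ i j, w i ≠ a j) (hwb : ∀ i j, w i ≠ b j)
    (h1 : ∀ k, G.Adj (a k) (w k)) (h2 : ∀ k, G.Adj (w k) (b k)) :
    ∃ L : List (Stage G), L.length ≤ 3 ∧ PairReal a b B L := by
  obtain ⟨S, hS⟩ := pair_stage B a w ha.injOn hw (fun i _ j _ => (hwa j i).symm) (fun i _ => h1 i) false
  obtain ⟨S', hS'⟩ := pair_stage B w b hw hb.injOn (fun i _ j _ => hwb i j) (fun i _ => h2 i) true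
  refine ⟨[S, S', S], by simp, fun f => ?_⟩
  have e : runNetwork [S, S', S] f = S.apply (S'.apply (S.apply f)) := rfl
  rw [e]
  simp only [Bool.false_eq_true, if_false, if_true] at hS hS'
  have fb : ∀ g k, S.apply g (b k) = g (b k) := fun g k =>
    (hS g).2 _ (fun j _ => ⟨(hab j k).symm, (hwb j k).symm⟩)
  have fa : ∀ g k, S'.apply g (a k) = g (a k) := fun g k =>
    (hS' g).2 _ (fun j _ => ⟨(hwa j k).symm, hab k j⟩)
  refine ⟨fun k hk => ⟨?_, ?_⟩, fun v hv => ?_⟩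
  · rw [((hS _).1 k hk).1, ((hS' _).1 k hk).1, ((hS _).1 k hk).2, fb]
  · rw [fb, ((hS' _).1 k hk).2, ((hS _).1 k hk).2, fb]
  · by_cases hvw : ∃ k ∈ B, v = w k
    · obtain ⟨k, hk, rfl⟩ := hvw
      rw [((hS _).1 k hk).2, fa, ((hS _).1 k hk).1]
    · push Not at hvw
      rw [(hS _).2 v (fun k hk => ⟨(hv k hk).1, hvw k hk⟩),
        (hS' _).2 v (fun k hk => ⟨hvw k hk, (hv k hk).2⟩),
        (hS _).2 v (fun k hk => ⟨(hv k hk).1, hvw k hk⟩)]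

theorem slotCap_pairs {n : ℕ} (G : SimpleGraph (Fin n)) {K : ℕ} {a b : Fin K → Fin n}
    (ha : Function.Injective a) (hb : Function.Injective b) (hab : ∀ i j, a i ≠ b j) (T : ℕ)
    (hT : ∀ B, ∃ L : List (Stage G), L.length ≤ T ∧ PairReal a b B L) :
    SlotCap G K (fun k => {a k, b k}) T := by
  classical
  intro A hA
  obtain ⟨L, hL1, hL2⟩ := hT (univ.filter fun k => a k ∈ A k ∧ b k ∈ A k)
  have hA' : ∀ k, ∀ v ∈ A k, v = a k ∨ v = b k := by
    intro k v hv
    simpa using hA k hv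
  refine ⟨L, hL1, 1, fun v => if ∃ k, v = a k then 0 else 1, ?_, ?_⟩
  · intro k u hu v hv huv
    have r1 : ∃ j, a k = a j := ⟨k, rfl⟩
    have r2 : ¬ ∃ j, b k = a j := fun ⟨j, hj⟩ => hab j k hj.symm
    rcases hA' k u hu with rfl | rfl <;> rcases hA' k v hv with rfl | rfl <;>
      simp [r1, r2] at huv ⊢
  intro f hf
  obtain ⟨N, -, hN⟩ := GSt.ofNetwork L
  obtain ⟨π, hπ, -⟩ := GSt.run_perm N (fun _ => ()) (fun _ _ => rfl) L.length f
  rw [hN _ le_rfl] at hπ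
  have hfix : ∀ v, (∀ k, a k ∈ A k → b k ∈ A k → v ≠ a k ∧ v ≠ b k) → π v = v := by
    intro v hv
    apply hf
    have := (hL2 f).2 v (fun k hk => by
      simp only [mem_filter, mem_univ, true_and] at hk; exact hv k hk.1 hk.2)
    rw [hπ] at this
    exact this
  refine ⟨π, fun v => congrFun hπ v, ?_, ?_, ?_⟩
  · intro k v hv
    by_cases hk : a k ∈ A k ∧ b k ∈ A k
    · have h1 := (hL2 f).1 k (by simpa using hk)
      rw [hπ] at h1
      simp only [Function.comp] at h1
      rcases hA' k v hv with rfl | rfl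
      · rcases min_choice (f (a k)) (f (b k)) with h | h
        · rw [h] at h1; rw [hf h1.1]; exact hk.1
        · rw [h] at h1; rw [hf h1.1]; exact hk.2
      · rcases max_choice (f (a k)) (f (b k)) with h | h
        · rw [h] at h1; rw [hf h1.2]; exact hk.1
        · rw [h] at h1; rw [hf h1.2]; exact hk.2
    · rw [hfix v]
      · exact hv
      intro j hj1 hj2
      have hjk : j ≠ k := by rintro rfl; exact hk ⟨hj1, hj2⟩
      rcases hA' k v hv with rfl | rfl
      · exact ⟨fun h => hjk (ha h).symm, hab _ _⟩
      · exact ⟨(hab _ _).symm, fun h => hjk (hb h).symm⟩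
  · intro v hv
    apply hfix
    intro k h1 h2
    exact ⟨fun h => hv k (h ▸ h1), fun h => hv k (h ▸ h2)⟩
  · intro k u hu v hv huv
    have r1 : ∃ j, a k = a j := ⟨k, rfl⟩
    have r2 : ¬ ∃ j, b k = a j := fun ⟨j, hj⟩ => hab j k hj.symm
    rcases hA' k u hu with rfl | rfl <;> rcases hA' k v hv with rfl | rfl <;>
      simp [r1, r2] at huv
    have h1 := (hL2 f).1 k (by simp [hu, hv])
    simp only [Equiv.Perm.one_apply]
    rw [h1.1, h1.2]
    exact min_lt_max.mpr (fun h => hab k k (hf h))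

theorem max_pairs {V : Type*} [Fintype V] (R : V → V → Prop) :
    ∃ (K : ℕ) (a b : Fin K → V), Function.Injective a ∧ Function.Injective b ∧
      (∀ i j, a i ≠ b j) ∧ (∀ k, R (a k) (b k)) ∧
      ∀ u v, u ≠ v → R u v → (∃ k, u = a k ∨ u = b k) ∨ (∃ k, v = a k ∨ v = b k) := by
  classical
  set P : ℕ → Prop := fun K => ∃ a b : Fin K → V, Function.Injective a ∧ Function.Injective b ∧
      (∀ i j, a i ≠ b j) ∧ (∀ k, R (a k) (b k)) with hP
  have hP0 : P 0 := ⟨Fin.elim0, Fin.elim0, fun i => i.elim0, fun i => i.elim0, fun i => i.elim0,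
    fun i => i.elim0⟩
  have hPc : ∀ K, P K → K ≤ Fintype.card V := by
    rintro K ⟨a, b, h1, -⟩
    simpa using Fintype.card_le_of_injective a h1
  obtain ⟨a, b, h1, h2, h3, h4⟩ := Nat.findGreatest_spec (P := P) (Nat.zero_le (Fintype.card V)) hP0
  refine ⟨_, a, b, h1, h2, h3, h4, fun u v huv hR => ?_⟩
  by_contra hcon
  push Not at hcon
  obtain ⟨c1, c2⟩ := hcon
  have hn : P (Nat.findGreatest P (Fintype.card V) + 1) := by
    refine ⟨Fin.cons u a, Fin.cons v b, ?_, ?_, ?_, ?_⟩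
    · rw [Fin.cons_injective_iff]
      exact ⟨fun ⟨k, hk⟩ => (c1 k).1 hk.symm, h1⟩
    · rw [Fin.cons_injective_iff]
      exact ⟨fun ⟨k, hk⟩ => (c2 k).2 hk.symm, h2⟩
    · intro i j
      refine Fin.cases ?_ (fun i => ?_) i <;> refine Fin.cases ?_ (fun j => ?_) j
      · simpa using huv
      · simpa using (c1 j).2
      · simpa using ((c2 i).1).symm
      · simpa using h3 i j
    · intro k
      refine Fin.cases ?_ (fun k => ?_) k
      · simpa using hR
      · simpa using h4 k
  have := Nat.le_findGreatest (hPc _ hn) hn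
  omega

theorem finalPos_fix {V : Type*} (L : List (Equiv.Perm V)) (v : V) (h : ∀ τ ∈ L, τ v = v) :
    finalPos L v = v := by
  induction L with
  | nil => rfl
  | cons τ L ih =>
    have h1 := h τ (by simp)
    have h2 := ih (fun σ hσ => h σ (by simp [hσ]))
    simp only [finalPos, List.foldl_cons] at h2 ⊢
    rw [h1]; exact h2

theorem pair_slots {n : ℕ} (hn : 2 ≤ n) (G : SimpleGraph (Fin n)) (hG : G.Connected) :
    ∃ (K : ℕ) (S : Fin K → Finset (Fin n)), SlotCap G K S (3 * rt G) ∧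
      (∀ i j, i ≠ j → Disjoint (S i) (S j)) ∧ (∀ i, 2 * 1 ≤ #(S i)) ∧ n ≤ 8 * K * 1 := by
  classical
  obtain ⟨L, hL1, hL2, hL3⟩ := exists_route_rt hG (finRotate n)
  have hder : ∀ v : Fin n, finRotate n v ≠ v := by
    obtain ⟨m, rfl⟩ : ∃ m, n = m + 2 := ⟨n - 2, by omega⟩
    intro v h
    rw [finRotate_apply] at h
    simp at h
  have hi : ∀ v, ∃ i : Fin L.length, L.get i v ≠ v := by
    intro v
    by_contra hc
    push Not at hc
    refine hder v ?_
    rw [← hL3]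
    apply finalPos_fix
    intro τ hτ
    obtain ⟨i, rfl⟩ := List.mem_iff_get.mp hτ
    exact hc i
  choose i hi using hi
  set φ : Fin n → Fin n := fun v => L.get (i v) v with hφ
  have hφa : ∀ v, G.Adj v (φ v) := fun v => (hL2 _ (List.get_mem L (i v))).2 v (hi v)
  have hrt : 1 ≤ rt G := by
    have := (i ⟨0, by omega⟩).2
    omega
  have hfin : ∀ (K : ℕ) (a b : Fin K → Fin n), Function.Injective a → Function.Injective b →
      (∀ i j, a i ≠ b j) → (∀ B, ∃ L : List (Stage G), L.length ≤ 3 * rt G ∧ PairReal a b B L) →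
      n ≤ 8 * K → ∃ (K : ℕ) (S : Fin K → Finset (Fin n)), SlotCap G K S (3 * rt G) ∧
      (∀ i j, i ≠ j → Disjoint (S i) (S j)) ∧ (∀ i, 2 * 1 ≤ #(S i)) ∧ n ≤ 8 * K * 1 := by
    intro K a b ha hb hab hT hK
    refine ⟨K, _, slotCap_pairs G ha hb hab _ hT, ?_, ?_, by omega⟩
    · intro i j hij
      rw [Finset.disjoint_left]
      intro v hv hv'
      simp only [mem_insert, mem_singleton] at hv hv'
      rcases hv with rfl | rfl <;> rcases hv' with h | h
      · exact hij (ha h)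
      · exact hab _ _ h
      · exact hab _ _ h.symm
      · exact hij (hb h)
    · intro i
      rw [Finset.card_pair (hab i i)]
  obtain ⟨K1, a1, b1, ha1, hb1, hab1, hR1, hmax1⟩ := max_pairs (fun u v => φ u = v)
  by_cases hK1 : n ≤ 8 * K1
  · refine hfin K1 a1 b1 ha1 hb1 hab1 (fun B => ?_) hK1
    obtain ⟨S, hS⟩ := pair_stage B a1 b1 ha1.injOn hb1.injOn (fun i _ j _ => hab1 i j)
      (fun k _ => by rw [← hR1 k]; exact hφa _) true
    refine ⟨[S], by simp; omega, fun f => ?_⟩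
    simpa [runNetwork] using hS f
  set VM : Finset (Fin n) := univ.image a1 ∪ univ.image b1 with hVM
  have hVMmem : ∀ v, v ∈ VM ↔ ∃ k, v = a1 k ∨ v = b1 k := by
    intro v
    simp only [hVM, mem_union, mem_image, mem_univ, true_and]
    constructor
    · rintro (⟨k, rfl⟩ | ⟨k, rfl⟩)
      · exact ⟨k, Or.inl rfl⟩
      · exact ⟨k, Or.inr rfl⟩
    · rintro ⟨k, rfl | rfl⟩
      · exact Or.inl ⟨k, rfl⟩
      · exact Or.inr ⟨k, rfl⟩
  have hVMcard : #VM ≤ 2 * K1 := by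
    refine (Finset.card_union_le _ _).trans ?_
    have h1 := Finset.card_image_le (s := univ) (f := a1)
    have h2 := Finset.card_image_le (s := univ) (f := b1)
    simp only [card_univ, Fintype.card_fin] at h1 h2
    omega
  have hφVM : ∀ v, v ∉ VM → φ v ∈ VM := by
    intro v hv
    rcases hmax1 v (φ v) (hφa v).ne rfl with h | h
    · exact absurd ((hVMmem v).mpr h) hv
    · exact (hVMmem _).mpr h
  obtain ⟨K2, a, b, ha, hb, hab, hR, hmax⟩ := max_pairs (fun u v => u ∉ VM ∧ v ∉ VM ∧ φ u = φ v)
  refine hfin K2 a b ha hb hab (fun B => ?_) ?_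
  · have hcl : ∀ (t : ℕ) (B : Finset (Fin K2)), (∀ k ∈ B, (i (a k) : ℕ) = t) →
        ∃ L : List (Stage G), L.length ≤ 3 ∧ PairReal a b B L := by
      intro t B hB
      refine pairReal_three (w := fun k => φ (a k)) ha hb hab B ?_ ?_ ?_ ?_ ?_
      · intro k hk j hj hkj
        have e : i (a k) = i (a j) := Fin.ext ((hB k hk).trans (hB j hj).symm)
        simp only [hφ] at hkj
        rw [e] at hkj
        exact ha ((L.get (i (a j))).injective hkj)
      · intro k j h
        exact (hR j).1 (h ▸ hφVM _ (hR k).1)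
      · intro k j h
        exact (hR j).2.1 (h ▸ hφVM _ (hR k).1)
      · intro k; exact hφa _
      · intro k
        rw [(hR k).2.2]
        exact (hφa _).symm
    obtain ⟨M, hM1, hM2⟩ := pairReal_classes (G := G) ha hb hab (fun k => (i (a k) : ℕ)) 3
      hcl B L.length
    refine ⟨M, hM1.trans (Nat.mul_le_mul_left 3 hL1), ?_⟩
    rwa [Finset.filter_true_of_mem (fun k _ => (i (a k)).2)] at hM2
  · set VP : Finset (Fin n) := univ.image a ∪ univ.image b with hVP
    have hVPcard : #VP ≤ 2 * K2 := by
      refine (Finset.card_union_le _ _).trans ?_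
      have h1 := Finset.card_image_le (s := univ) (f := a)
      have h2 := Finset.card_image_le (s := univ) (f := b)
      simp only [card_univ, Fintype.card_fin] at h1 h2
      omega
    have hVPmem : ∀ v, (∃ k, v = a k ∨ v = b k) → v ∈ VP := by
      intro v
      simp only [hVP, mem_union, mem_image, mem_univ, true_and]
      rintro ⟨k, rfl | rfl⟩
      · exact Or.inl ⟨k, rfl⟩
      · exact Or.inr ⟨k, rfl⟩
    have hW : #((univ \ VM) \ VP) ≤ #VM := by
      refine Finset.card_le_card_of_injOn φ ?_ ?_
      · intro v hv
        simp only [coe_sdiff, Set.mem_sdiff, mem_coe, mem_univ, true_and] at hv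
        exact hφVM v hv.1
      · intro u hu v hv huv
        simp only [coe_sdiff, Set.mem_sdiff, mem_coe, mem_univ, true_and] at hu hv
        by_contra hne
        rcases hmax u v hne ⟨hu.1, hv.1, huv⟩ with h | h
        · exact hu.2 (hVPmem _ h)
        · exact hv.2 (hVPmem _ h)
    have h1 := Finset.le_card_sdiff VM (univ : Finset (Fin n))
    have h2 := Finset.le_card_sdiff VP ((univ : Finset (Fin n)) \ VM)
    simp only [card_univ, Fintype.card_fin] at h1
    omega


theorem final_real (C : ℕ) : ∃ C' : ℝ, 0 < C' ∧ ∀ q k x r s : ℕ, 2 ≤ q → k ≤ Nat.clog 2 q + 2 →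
    x ≤ (C * (k + 1) + 1) * (8 * (2 * r + (3 * r + s))) →
    (x : ℝ) ≤ C' * Real.log q * ((r : ℝ) + (s : ℝ)) := by
  have hl2 : (0 : ℝ) < Real.log 2 := Real.log_pos (by norm_num)
  refine ⟨(5 * C + 1) * 40 / Real.log 2, by positivity, fun q k x r s hq hk hx => ?_⟩
  have hq2 : (2 : ℝ) ≤ q := by exact_mod_cast hq
  have hlq : Real.log 2 ≤ Real.log q := Real.log_le_log (by norm_num) hq2
  have h1 : 1 ≤ Nat.clog 2 q := Nat.clog_pos (by norm_num) hq
  have h2 : 2 ^ (Nat.clog 2 q - 1) < q := Nat.pow_pred_clog_lt_self (by norm_num) (by omega)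
  have h3 : ((Nat.clog 2 q - 1 : ℕ) : ℝ) * Real.log 2 ≤ Real.log q := by
    rw [← Real.log_pow]
    exact Real.log_le_log (by positivity) (by exact_mod_cast h2.le)
  set j := Nat.clog 2 q - 1 with hj
  have h4 : (k : ℝ) ≤ j + 3 := by
    have : k ≤ j + 3 := by omega
    exact_mod_cast this
  have h5 : ((k : ℝ) + 1) * Real.log 2 ≤ 5 * Real.log q := by nlinarith
  have hx' : (x : ℝ) ≤ (C * (k + 1) + 1) * (8 * (2 * r + (3 * r + s))) := by exact_mod_cast hx
  have h6 : ((C : ℝ) * (k + 1) + 1) * Real.log 2 ≤ (5 * C + 1) * Real.log q := by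
    have : (0 : ℝ) ≤ C := by positivity
    nlinarith
  have hr : (0 : ℝ) ≤ r := by positivity
  have hs : (0 : ℝ) ≤ s := by positivity
  have h7 : ((C : ℝ) * (k + 1) + 1) ≤ (5 * C + 1) * Real.log q / Real.log 2 := by
    rw [le_div_iff₀ hl2]; exact h6
  calc (x : ℝ) ≤ (C * (k + 1) + 1) * (8 * (2 * r + (3 * r + s))) := hx'
    _ ≤ ((5 * C + 1) * Real.log q / Real.log 2) * (40 * (r + s)) := by
      apply mul_le_mul h7 (by linarith) (by positivity)
      have : 0 ≤ Real.log q := hl2.le.trans hlq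
      positivity
    _ = _ := by ring

/-- if the vertex set of `G` is partitioned into `q` equal parts,
each inducing a connected subgraph `H_i`, then
`st(G) = O(log q · (rt(G) + max_i st(H_i)))`. -/
theorem stmt13 :
    ∃ C : ℝ, 0 < C ∧ ∀ (n q : ℕ) (G : SimpleGraph (Fin n)), G.Connected →
      2 ≤ q → ∀ parts : Fin q → Finset (Fin n),
      (∀ i, (parts i).card = n / q) →
      (∀ i j, i ≠ j → Disjoint (parts i) (parts j)) →
      (Finset.univ.biUnion parts = Finset.univ) →
      (∀ i, (G.induce (↑(parts i) : Set (Fin n))).Connected) →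
      (st G : ℝ) ≤ C * Real.log q * ((rt G : ℝ) +
        (Finset.univ.sup fun i => st (G.induce (↑(parts i) : Set (Fin n)))) ) := by
  obtain ⟨C, hC⟩ := st_le_of_slots
  obtain ⟨C', hC'0, hC'⟩ := final_real C
  refine ⟨C', hC'0, fun n q G hG hq parts hcard hd hu hc => ?_⟩
  have hn : n = q * (n / q) := by
    have h1 : #(Finset.univ.biUnion parts) = ∑ i, #(parts i) :=
      Finset.card_biUnion (fun i _ j _ hij => hd i j hij)
    rw [hu] at h1
    simpa [hcard] using h1
  have hn0 : 0 < n := by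
    obtain ⟨v⟩ := hG.nonempty
    exact lt_of_le_of_lt (Nat.zero_le _) v.2
  have hpow : q ≤ 2 ^ Nat.clog 2 q := Nat.le_pow_clog (by norm_num) q
  set s := n / q with hs
  refine hC' q (Nat.clog 2 q + 2) _ _ _ hq le_rfl ?_
  set T := Finset.univ.sup fun i => st (G.induce (↑(parts i) : Set (Fin n))) with hT
  have hs0 : 0 < s := by
    rcases Nat.eq_zero_or_pos s with h | h
    · rw [h] at hn; omega
    · exact h
  have hpow' : 2 ^ (Nat.clog 2 q + 2) = 4 * 2 ^ Nat.clog 2 q := by ring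
  by_cases hs1 : s = 1
  · have hnq : n = q := by rw [hs1] at hn; omega
    obtain ⟨K, S, h1, h2, h3, h4⟩ := pair_slots (by omega) G hG
    refine (hC n G hG K _ 1 (Nat.clog 2 q + 2) 8 S h1 h2 le_rfl h3 ?_ h4).trans ?_
    · rw [hpow']; omega
    · apply Nat.mul_le_mul_left
      omega
  · have h3 : s ≤ 3 * (s / 2) := by omega
    refine (hC n G hG q T (s / 2) (Nat.clog 2 q + 2) 3 parts (slotCap_parts G parts hd hu hc) hd
      (by omega) (fun i => by rw [hcard]; omega) ?_ ?_).trans ?_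
    · calc n = q * s := hn
        _ ≤ 2 ^ Nat.clog 2 q * (3 * (s / 2)) := Nat.mul_le_mul hpow h3
        _ ≤ 2 ^ (Nat.clog 2 q + 2) * (s / 2) := by rw [hpow']; nlinarith [Nat.zero_le (2 ^ Nat.clog 2 q * (s / 2))]
    · calc n = q * s := hn
        _ ≤ q * (3 * (s / 2)) := Nat.mul_le_mul_left _ h3
        _ = 3 * q * (s / 2) := by ring
    · apply Nat.mul_le_mul_left
      omega
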